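/- There exist a time T > 0 and smooth functions σ₊, σ₋ : [0,∞) × ℝ² → ℝ, with σ±(t,·) compactly supported for each t, solving the unscreened right-handed system ∂ₜσ₊ − 𝕌(σ₋)·∇σ₊ = 0, ∂ₜσ₋ + 𝕌(σ₊)·∇σ₋ = 0 pointwise, such that the canonical momentum F := (σ₊ + σ₋)/2 undergoes a topology change: the interior of the support of F(0,·) has exactly 4 connected components, while the interior of the support of F(T,·) has exactly 2 connected components. -/

import Mathlib

open MeasureTheory ENNReal Set

noncomputable section

/-- The perpendicular rotation `(z₁, z₂)^⊥ = (−z₂, z₁)` in the plane. -/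
def perp (z : EuclideanSpace ℝ (Fin 2)) : EuclideanSpace ℝ (Fin 2) :=
  (WithLp.equiv 2 (Fin 2 → ℝ)).symm ![-(z 1), z 0]

/-- The Biot–Savart velocity `𝕌(ω)(x) = (1/2π) ∫ ((x−y)^⊥/|x−y|²) ω(y) dy`. -/
def biotSavart (ω : EuclideanSpace ℝ (Fin 2) → ℝ) (x : EuclideanSpace ℝ (Fin 2)) :
    EuclideanSpace ℝ (Fin 2) :=
  (1 / (2 * Real.pi)) • ∫ y, (ω y / ‖x - y‖ ^ 2) • perp (x - y)

section

open scoped Convolution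
open Metric

/-- The Euclidean plane. -/
abbrev Plane := EuclideanSpace ℝ (Fin 2)

theorem setIntegral_ball_norm_rpow {s : ℝ} (hs : 0 < s) :
    IntegrableOn (fun z : Plane => ‖z‖ ^ (s - 2)) (ball 0 1) ∧
      ∫ z in ball (0 : Plane) 1, ‖z‖ ^ (s - 2) = 2 * Real.pi / s := by
  have hmul : ∀ y ∈ Ioo (0 : ℝ) 1, y ^ (Module.finrank ℝ Plane - 1) • y ^ (s - 2) = y ^ (s - 1) := by
    intro y hy
    have : Module.finrank ℝ Plane - 1 = 1 := by simp
    rw [this, pow_one, smul_eq_mul]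
    nth_rewrite 1 [← Real.rpow_one y]
    rw [← Real.rpow_add hy.1]
    ring_nf
  have hI : IntegrableOn (fun y : ℝ => y ^ (s - 1)) (Ioo 0 1) :=
    (intervalIntegral.integrableOn_Ioo_rpow_iff zero_lt_one).2 (by linarith)
  refine ⟨?_, ?_⟩
  · rw [integrableOn_fun_norm_addHaar volume (f := fun y => y ^ (s - 2))]
    exact hI.congr_fun (fun y hy => (hmul y hy).symm) measurableSet_Ioo
  · have h1 : ∫ z in ball (0 : Plane) 1, ‖z‖ ^ (s - 2)
        = ∫ z : Plane, (Iio (1:ℝ)).indicator (fun y => y ^ (s - 2)) ‖z‖ := by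
      rw [← integral_indicator measurableSet_ball]
      congr 1
      ext z
      simp [indicator]
    rw [h1, integral_fun_norm_addHaar volume]
    have h2 : ∫ y in Ioi (0 : ℝ), y ^ (Module.finrank ℝ Plane - 1) •
        (Iio (1:ℝ)).indicator (fun y => y ^ (s - 2)) y = ∫ y in Ioo (0:ℝ) 1, y ^ (s - 1) := by
      rw [← integral_indicator measurableSet_Ioi, ← integral_indicator measurableSet_Ioo]
      congr 1
      ext y
      by_cases h0 : 0 < y <;> by_cases hy : y < 1 <;> simp [indicator, h0, hy]
      have := hmul y ⟨h0, hy⟩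
      simpa using this
    rw [h2, ← integral_Ioc_eq_integral_Ioo, ← intervalIntegral.integral_of_le zero_le_one,
      integral_rpow (Or.inl (by linarith))]
    simp [Measure.real, EuclideanSpace.volume_ball_fin_two, ENNReal.toReal_ofReal Real.pi_pos.le,
      Real.zero_rpow hs.ne']
    ring

theorem setIntegral_closedBall_norm_sub_rpow {s : ℝ} (hs : 0 < s) (hs2 : s ≤ 2) (R : ℝ)
    (x : Plane) :
    IntegrableOn (fun z : Plane => ‖x - z‖ ^ (s - 2)) (closedBall 0 R) ∧
      ∫ z in closedBall (0 : Plane) R, ‖x - z‖ ^ (s - 2) ≤ 2 * Real.pi / s + Real.pi * R ^ 2 := by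
  set B := closedBall (0 : Plane) R
  have hBvol : volume.real B ≤ Real.pi * R ^ 2 := by
    rcases le_or_gt 0 R with hR | hR
    · simp [B, Measure.real, EuclideanSpace.volume_closedBall_fin_two, ENNReal.toReal_ofReal hR,
        ENNReal.toReal_ofReal Real.pi_pos.le, mul_comm]
    · simp only [B, closedBall_eq_empty.2 hR, measureReal_empty]
      positivity
  obtain ⟨hi, hv⟩ := setIntegral_ball_norm_rpow hs
  set f : Plane → ℝ := (ball 0 1).indicator fun z => ‖z‖ ^ (s - 2)
  have hf : Integrable f := hi.integrable_indicator measurableSet_ball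
  have hfx : Integrable fun z => f (x - z) := hf.comp_sub_left x
  have hfi : ∫ z, f (x - z) = 2 * Real.pi / s := by
    rw [integral_sub_left_eq_self, integral_indicator measurableSet_ball, hv]
  have hf0 : ∀ z, 0 ≤ f z := fun z => indicator_nonneg (fun _ _ => by positivity) z
  have hB : IntegrableOn (fun _ : Plane => (1 : ℝ)) B :=
    integrableOn_const measure_closedBall_lt_top.ne
  have hle : ∀ z : Plane, ‖x - z‖ ^ (s - 2) ≤ f (x - z) + 1 := by
    intro z
    by_cases h : ‖x - z‖ < 1
    · simp [f, h]
    · have : ‖x - z‖ ^ (s - 2) ≤ 1 := Real.rpow_le_one_of_one_le_of_nonpos (not_lt.1 h) (by linarith)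
      linarith [hf0 (x - z)]
  have hInt : IntegrableOn (fun z : Plane => f (x - z) + 1) B := hfx.integrableOn.add hB
  have hmeas : AEStronglyMeasurable (fun z : Plane => ‖x - z‖ ^ (s - 2)) (volume.restrict B) :=
    (by fun_prop : Measurable fun z : Plane => ‖x - z‖ ^ (s - 2)).aestronglyMeasurable
  have hInt₂ : IntegrableOn (fun z : Plane => ‖x - z‖ ^ (s - 2)) B :=
    hInt.mono' hmeas (.of_forall fun z => by
      rw [Real.norm_of_nonneg (by positivity)]; exact hle z)
  refine ⟨hInt₂, ?_⟩
  calc ∫ z in B, ‖x - z‖ ^ (s - 2) ≤ ∫ z in B, (f (x - z) + 1) :=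
        integral_mono hInt₂ hInt hle
    _ = (∫ z in B, f (x - z)) + ∫ z in B, (1 : ℝ) := integral_add hfx.integrableOn hB
    _ ≤ (∫ z, f (x - z)) + volume.real B := by
        gcongr
        · exact .of_forall fun z => hf0 _
        · exact Measure.restrict_le_self
        · simp
    _ ≤ _ := by rw [hfi]; gcongr

theorem perp_apply_zero (z : Plane) : perp z 0 = -z 1 := rfl
theorem perp_apply_one (z : Plane) : perp z 1 = z 0 := rfl

/-- The rotation `perp` as a linear isometry. -/
def perpL : Plane →ₗᵢ[ℝ] Plane where
  toFun := perp
  map_add' x y := by ext i; fin_cases i <;> simp [perp]; ring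
  map_smul' c x := by ext i; fin_cases i <;> simp [perp]
  norm_map' x := by
    change ‖perp x‖ = ‖x‖
    simp [EuclideanSpace.norm_eq, Fin.sum_univ_two, perp_apply_zero, perp_apply_one, add_comm]

theorem perpL_apply (z : Plane) : perpL z = perp z := rfl

theorem norm_perp (z : Plane) : ‖perp z‖ = ‖z‖ := perpL.norm_map z

/-- The Biot–Savart kernel. -/
def bsKernel (z : Plane) : Plane := (2 * Real.pi)⁻¹ • perp ((1 / ‖z‖) ^ 2 • z)

theorem norm_bsKernel (z : Plane) : ‖bsKernel z‖ = (2 * Real.pi)⁻¹ * ‖z‖⁻¹ := by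
  rw [bsKernel, norm_smul, norm_perp, norm_smul, Real.norm_of_nonneg (by positivity),
    Real.norm_of_nonneg (by positivity)]
  rcases eq_or_ne z 0 with rfl | hz
  · simp
  · have := norm_pos_iff.2 hz
    field_simp

theorem norm_bsKernel_sub {a b : Plane} (ha : a ≠ 0) (hb : b ≠ 0) :
    ‖bsKernel a - bsKernel b‖ = (2 * Real.pi)⁻¹ * (‖a - b‖ / (‖a‖ * ‖b‖)) := by
  rw [bsKernel, bsKernel, ← smul_sub, norm_smul, Real.norm_of_nonneg (by positivity),
    ← perpL_apply, ← perpL_apply, ← map_sub, perpL.norm_map, ← dist_eq_norm,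
    dist_div_norm_sq_smul ha hb, dist_eq_norm]
  ring

theorem measurable_bsKernel : Measurable bsKernel := by
  have h : Measurable fun z : Plane => (1 / ‖z‖) ^ 2 • z := by fun_prop
  exact (perpL.continuous.measurable.comp h).const_smul (2 * Real.pi)⁻¹

theorem integrableOn_bsKernel_sub (R : ℝ) (x : Plane) :
    IntegrableOn (fun z => bsKernel (x - z)) (closedBall 0 R) := by
  have h := (setIntegral_closedBall_norm_sub_rpow one_pos one_le_two R x).1
  refine (h.const_mul (2 * Real.pi)⁻¹).mono'
    (measurable_bsKernel.comp (measurable_const.sub measurable_id)).aestronglyMeasurable (.of_forall fun z => ?_)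
  rw [norm_bsKernel, show (1 - 2 : ℝ) = -1 by norm_num, Real.rpow_neg_one]

theorem locallyIntegrable_bsKernel : LocallyIntegrable bsKernel := by
  intro x
  refine ⟨closedBall x 1, closedBall_mem_nhds _ one_pos, ?_⟩
  have h := integrableOn_bsKernel_sub (‖x‖ + 1) 0
  have h2 : IntegrableOn (fun z => bsKernel z) (closedBall 0 (‖x‖ + 1)) := by
    have h3 := h.neg
    refine h3.congr_fun (fun z _ => ?_) measurableSet_closedBall
    simp only [zero_sub, Pi.neg_apply, bsKernel, norm_neg, smul_neg]
    rw [← perpL_apply, map_neg, smul_neg, neg_neg, perpL_apply]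
  refine h2.mono_set fun z hz => ?_
  rw [mem_closedBall, dist_eq_norm] at *
  rw [sub_zero]
  linarith [norm_le_norm_add_norm_sub' z x]

theorem setIntegral_norm_bsKernel_sub_le (R : ℝ) (x : Plane) :
    ∫ z in closedBall 0 R, ‖bsKernel (x - z)‖ ≤ 1 + R ^ 2 := by
  have h := (setIntegral_closedBall_norm_sub_rpow one_pos one_le_two R x).2
  have h2 : ∀ z, ‖bsKernel (x - z)‖ = (2 * Real.pi)⁻¹ * ‖x - z‖ ^ ((1 : ℝ) - 2) := fun z => by
    rw [norm_bsKernel, show (1 - 2 : ℝ) = -1 by norm_num, Real.rpow_neg_one]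
  simp_rw [h2]
  rw [integral_const_mul]
  have hpi := Real.pi_pos
  calc _ ≤ (2 * Real.pi)⁻¹ * (2 * Real.pi / 1 + Real.pi * R ^ 2) := by gcongr
    _ = 1 + R ^ 2 / 2 := by field_simp
    _ ≤ _ := by nlinarith [sq_nonneg R]

theorem setIntegral_norm_bsKernel_sub_sub_le {s : ℝ} (hs : 0 < s) (hs1 : s ≤ 1) (R : ℝ)
    {x x' : Plane} (hx : x ≠ x') :
    ∫ z in closedBall 0 R, ‖bsKernel (x - z) - bsKernel (x' - z)‖ ≤
      4 * (1 + R ^ 2) * (‖x - x'‖ ^ (1 - s) / s) := by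
  set d := ‖x - x'‖
  have hd : 0 < d := norm_pos_iff.2 (sub_ne_zero.2 hx)
  have hpi := Real.pi_pos
  have hpt : ∀ a b : ℝ, 0 < a → 0 < b → d ≤ a + b →
      d / (a * b) ≤ d ^ (1 - s) * (2 * (a ^ (s - 2) + b ^ (s - 2))) := by
    intro a b ha hb hab
    have h1 : d = d ^ (1 - s) * d ^ s := by rw [← Real.rpow_add hd]; simp
    have h2 : d ^ s ≤ a ^ s + b ^ s :=
      (Real.rpow_le_rpow hd.le hab hs.le).trans (Real.rpow_add_le_add_rpow ha.le hb.le hs.le hs1)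
    have key : ∀ u v : ℝ, 0 < u → 0 < v → u ^ s / (u * v) ≤ u ^ (s - 2) + v ^ (s - 2) := by
      intro u v hu hv
      have e1 : u ^ (s - 2) = u ^ s / (u * u) := by
        rw [Real.rpow_sub hu, Real.rpow_two, sq]
      have e2 : v ^ (s - 2) = v ^ (s - 1) / v := by
        rw [show s - 2 = (s - 1) - 1 by ring, Real.rpow_sub_one hv.ne']
      have e3 : u ^ s / (u * v) = u ^ (s - 1) / v := by
        rw [Real.rpow_sub_one hu.ne']; field_simp
      rcases le_total u v with h | h
      · have : u ^ s / (u * v) ≤ u ^ s / (u * u) := by gcongr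
        have h0 : 0 ≤ v ^ (s - 2) := by positivity
        linarith
      · have : u ^ (s - 1) / v ≤ v ^ (s - 1) / v := by
          gcongr ?_ / v
          exact Real.rpow_le_rpow_of_nonpos hv h (by linarith)
        have h0 : 0 ≤ u ^ (s - 2) := by positivity
        linarith
    calc d / (a * b) = d ^ (1 - s) * (d ^ s / (a * b)) := by
          nth_rewrite 1 [h1]; ring
      _ ≤ d ^ (1 - s) * ((a ^ s + b ^ s) / (a * b)) := by gcongr
      _ = d ^ (1 - s) * (a ^ s / (a * b) + b ^ s / (b * a)) := by ring
      _ ≤ _ := by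
          gcongr
          linarith [key a b ha hb, key b a hb ha]
  obtain ⟨i1, v1⟩ := setIntegral_closedBall_norm_sub_rpow hs (by linarith) R x
  obtain ⟨i2, v2⟩ := setIntegral_closedBall_norm_sub_rpow hs (by linarith) R x'
  have hae : ∀ᵐ z ∂(volume.restrict (closedBall (0 : Plane) R)),
      ‖bsKernel (x - z) - bsKernel (x' - z)‖ ≤
      (2 * Real.pi)⁻¹ * (d ^ (1 - s) * (2 * (‖x - z‖ ^ (s - 2) + ‖x' - z‖ ^ (s - 2)))) := by
    refine ae_restrict_of_ae ?_
    have h1 : ∀ y : Plane, ∀ᵐ z : Plane, z ≠ y := fun y => by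
      simp [ae_iff, measure_singleton]
    filter_upwards [h1 x, h1 x'] with z hz hz'
    have n1 : x - z ≠ 0 := sub_ne_zero.2 hz.symm
    have n2 : x' - z ≠ 0 := sub_ne_zero.2 hz'.symm
    rw [norm_bsKernel_sub n1 n2]
    gcongr
    rw [sub_sub_sub_cancel_right]
    refine hpt _ _ (norm_pos_iff.2 n1) (norm_pos_iff.2 n2) ?_
    have : x - x' = (x - z) - (x' - z) := by abel
    simp only [d]
    rw [this]
    exact norm_sub_le _ _
  calc _ ≤ ∫ z in closedBall (0 : Plane) R,
      (2 * Real.pi)⁻¹ * (d ^ (1 - s) * (2 * (‖x - z‖ ^ (s - 2) + ‖x' - z‖ ^ (s - 2)))) :=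
        integral_mono_ae ((integrableOn_bsKernel_sub R x).sub (integrableOn_bsKernel_sub R x')).norm
          ((((i1.add i2).const_mul 2).const_mul _).const_mul _) hae
    _ = (2 * Real.pi)⁻¹ * (d ^ (1 - s) * (2 * ((∫ z in closedBall (0 : Plane) R, ‖x - z‖ ^ (s - 2))
          + ∫ z in closedBall (0 : Plane) R, ‖x' - z‖ ^ (s - 2)))) := by
        rw [integral_const_mul, integral_const_mul, integral_const_mul, integral_add i1 i2]
    _ ≤ (2 * Real.pi)⁻¹ * (d ^ (1 - s) * (2 * ((2 * Real.pi / s + Real.pi * R ^ 2)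
          + (2 * Real.pi / s + Real.pi * R ^ 2)))) := by gcongr
    _ = d ^ (1 - s) * (4 / s + 2 * R ^ 2) := by field_simp; ring
    _ ≤ d ^ (1 - s) * ((4 + 4 * R ^ 2) / s) := by
        gcongr
        rw [add_div]
        gcongr
        rw [le_div_iff₀ hs]
        nlinarith [sq_nonneg R]
    _ = _ := by ring

end

section

open scoped Convolution
open Metric

variable {F G : Type} [NormedAddCommGroup F] [NormedAddCommGroup G]

/-- The scalar multiplication pairing, kernel first. -/
def bsL : Plane →L[ℝ] ℝ →L[ℝ] Plane := (ContinuousLinearMap.lsmul ℝ ℝ).flip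

theorem norm_bsL_le : ‖bsL‖ ≤ 1 := by
  rw [bsL, ContinuousLinearMap.opNorm_flip]
  exact ContinuousLinearMap.opNorm_lsmul_le

theorem biotSavart_eq_convolution (q : Plane → ℝ) : biotSavart q = bsKernel ⋆[bsL] q := by
  ext1 x
  rw [convolution_eq_swap, biotSavart, ← integral_smul]
  congr 1
  ext1 y
  change _ = q y • bsKernel (x - y)
  rw [bsKernel, ← perpL_apply, ← perpL_apply, map_smul]
  simp only [smul_smul]
  congr 1
  ring

/-- Vanishing outside the centred closed ball of radius `R`. -/
def SuppIn (R : ℝ) (g : Plane → F) : Prop := ∀ x, R < ‖x‖ → g x = 0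

theorem SuppIn.mono {R R' : ℝ} {g : Plane → F} (h : SuppIn R g) (hR : R ≤ R') : SuppIn R' g :=
  fun x hx => h x (hR.trans_lt hx)

theorem SuppIn.hasCompactSupport {R : ℝ} {g : Plane → F} (h : SuppIn R g) :
    HasCompactSupport g :=
  HasCompactSupport.intro (isCompact_closedBall (0 : Plane) R) fun x hx => h x (by simpa using hx)

theorem HasCompactSupport.exists_suppIn {g : Plane → F} (h : HasCompactSupport g) :
    ∃ R, 0 ≤ R ∧ SuppIn R g := by
  obtain ⟨R, hR⟩ := h.isBounded.subset_closedBall 0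
  refine ⟨max R 0, le_max_right _ _, fun x hx => ?_⟩
  by_contra hne
  have := hR (subset_tsupport _ hne)
  rw [mem_closedBall, dist_zero_right] at this
  exact absurd (le_max_left R 0) (by linarith)

variable [NormedSpace ℝ F] [NormedSpace ℝ G]

theorem SuppIn.fderiv {R : ℝ} {g : Plane → F} (h : SuppIn R g) : SuppIn R (fderiv ℝ g) := by
  intro x hx
  have : g =ᶠ[nhds x] fun _ => 0 := by
    filter_upwards [(isOpen_lt continuous_const continuous_norm).mem_nhds hx] with y hy
    exact h y hy
  rw [this.fderiv_eq]
  simp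

theorem norm_bsKernel_convolution_le (L : Plane →L[ℝ] F →L[ℝ] G) {g : Plane → F} {M R : ℝ}
    (hM : ∀ x, ‖g x‖ ≤ M) (hR : SuppIn R g) (x : Plane) :
    ‖(bsKernel ⋆[L] g) x‖ ≤ ‖L‖ * (1 + R ^ 2) * M := by
  have hM0 : 0 ≤ M := (norm_nonneg _).trans (hM 0)
  rw [convolution_eq_swap]
  have hInt : Integrable ((closedBall (0 : Plane) R).indicator
      fun z => ‖L‖ * M * ‖bsKernel (x - z)‖) :=
    (integrable_indicator_iff measurableSet_closedBall).2
      ((integrableOn_bsKernel_sub R x).norm.const_mul _)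
  refine (norm_integral_le_of_norm_le hInt (.of_forall fun z => ?_)).trans ?_
  · by_cases hz : z ∈ closedBall (0 : Plane) R
    · rw [indicator_of_mem hz]
      calc _ ≤ ‖L‖ * ‖bsKernel (x - z)‖ * ‖g z‖ := L.le_opNorm₂ _ _
        _ ≤ ‖L‖ * ‖bsKernel (x - z)‖ * M := by gcongr; exact hM z
        _ = _ := by ring
    · rw [hR z (by simpa using hz)]
      simp [indicator_of_notMem hz]
  · rw [integral_indicator measurableSet_closedBall, integral_const_mul]
    calc _ ≤ ‖L‖ * M * (1 + R ^ 2) := by gcongr; exact setIntegral_norm_bsKernel_sub_le R x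
      _ = _ := by ring

theorem norm_bsKernel_convolution_sub_le (L : Plane →L[ℝ] F →L[ℝ] G) {g : Plane → F} {M R s : ℝ}
    (hg : Continuous g) (hM : ∀ x, ‖g x‖ ≤ M) (hR : SuppIn R g) (hs : 0 < s) (hs1 : s ≤ 1)
    {x x' : Plane} (hx : x ≠ x') :
    ‖(bsKernel ⋆[L] g) x - (bsKernel ⋆[L] g) x'‖ ≤
      ‖L‖ * M * (4 * (1 + R ^ 2) * (‖x - x'‖ ^ (1 - s) / s)) := by
  have hM0 : 0 ≤ M := (norm_nonneg _).trans (hM 0)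
  have hex := hR.hasCompactSupport.convolutionExists_right L locallyIntegrable_bsKernel hg
  rw [convolution_eq_swap, convolution_eq_swap, ← integral_sub (hex x).integrable_swap
    (hex x').integrable_swap]
  have hInt : Integrable ((closedBall (0 : Plane) R).indicator
      fun z => ‖L‖ * M * ‖bsKernel (x - z) - bsKernel (x' - z)‖) :=
    (integrable_indicator_iff measurableSet_closedBall).2
      (((integrableOn_bsKernel_sub R x).sub (integrableOn_bsKernel_sub R x')).norm.const_mul _)
  refine (norm_integral_le_of_norm_le hInt (.of_forall fun z => ?_)).trans ?_
  · by_cases hz : z ∈ closedBall (0 : Plane) R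
    · rw [indicator_of_mem hz, ← sub_apply, ← map_sub]
      calc _ ≤ ‖L‖ * ‖bsKernel (x - z) - bsKernel (x' - z)‖ * ‖g z‖ := L.le_opNorm₂ _ _
        _ ≤ ‖L‖ * ‖bsKernel (x - z) - bsKernel (x' - z)‖ * M := by gcongr; exact hM z
        _ = _ := by ring
    · rw [hR z (by simpa using hz)]
      simp [indicator_of_notMem hz]
  · rw [integral_indicator measurableSet_closedBall, integral_const_mul]
    gcongr
    exact setIntegral_norm_bsKernel_sub_sub_le hs hs1 R hx

theorem hasFDerivAt_bsKernel_convolution (L : Plane →L[ℝ] F →L[ℝ] G) {g : Plane → F} {R : ℝ}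
    (hg : ContDiff ℝ 1 g) (hR : SuppIn R g) (x : Plane) :
    HasFDerivAt (bsKernel ⋆[L] g) ((bsKernel ⋆[L.precompR Plane] fderiv ℝ g) x) x :=
  hR.hasCompactSupport.hasFDerivAt_convolution_right L locallyIntegrable_bsKernel hg x

theorem fderiv_bsKernel_convolution (L : Plane →L[ℝ] F →L[ℝ] G) {g : Plane → F} {R : ℝ}
    (hg : ContDiff ℝ 1 g) (hR : SuppIn R g) :
    fderiv ℝ (bsKernel ⋆[L] g) = bsKernel ⋆[L.precompR Plane] fderiv ℝ g :=
  funext fun x => (hasFDerivAt_bsKernel_convolution L hg hR x).fderiv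

theorem contDiff_bsKernel_convolution (L : Plane →L[ℝ] F →L[ℝ] G) {g : Plane → F} {R : ℝ} {n : ℕ∞}
    (hg : ContDiff ℝ n g) (hR : SuppIn R g) : ContDiff ℝ n (bsKernel ⋆[L] g) :=
  hR.hasCompactSupport.contDiff_convolution_right L locallyIntegrable_bsKernel hg

theorem norm_iteratedFDeriv_bsKernel_convolution_le (k : ℕ) :
    ∀ {F G : Type} [NormedAddCommGroup F] [NormedSpace ℝ F] [NormedAddCommGroup G]
      [NormedSpace ℝ G] (L : Plane →L[ℝ] F →L[ℝ] G) {g : Plane → F} {M R : ℝ},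
      ContDiff ℝ (⊤ : ℕ∞) g → (∀ x, ‖iteratedFDeriv ℝ k g x‖ ≤ M) → SuppIn R g →
      ∀ x, ‖iteratedFDeriv ℝ k (bsKernel ⋆[L] g) x‖ ≤ ‖L‖ * (1 + R ^ 2) * M := by
  induction k with
  | zero =>
    intro F G _ _ _ _ L g M R _ hM hR x
    simp only [norm_iteratedFDeriv_zero] at hM ⊢
    exact norm_bsKernel_convolution_le L hM hR x
  | succ k ih =>
    intro F G _ _ _ _ L g M R hg hM hR x
    have hM0 : 0 ≤ M := (norm_nonneg _).trans (hM 0)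
    rw [← norm_iteratedFDeriv_fderiv,
      fderiv_bsKernel_convolution L (hg.of_le (by exact_mod_cast le_top)) hR]
    refine (ih (L.precompR Plane) (hg.fderiv_right (m := (⊤ : ℕ∞)) (by norm_cast))
      (fun x => by rw [norm_iteratedFDeriv_fderiv]; exact hM x) hR.fderiv x).trans ?_
    gcongr
    exact L.norm_precompR_le Plane

theorem norm_fderiv_bsKernel_convolution_le_log (L : Plane →L[ℝ] F →L[ℝ] G) {g : Plane → F}
    {M N R : ℝ} (hg : ContDiff ℝ 1 g) (hR : SuppIn R g) (hM : ∀ x, ‖g x‖ ≤ M)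
    (hN : ∀ x, ‖fderiv ℝ g x‖ ≤ N) (x : Plane) :
    ‖fderiv ℝ (bsKernel ⋆[L] g) x‖ ≤ ‖L‖ * (32 * (1 + R ^ 2) * (1 + M)) * (1 + Real.log (1 + N)) := by
  have hM0 : 0 ≤ M := (norm_nonneg _).trans (hM 0)
  have hN0 : 0 ≤ N := (norm_nonneg _).trans (hN 0)
  have hlog : 0 ≤ Real.log (1 + N) := Real.log_nonneg (by linarith)
  set w := bsKernel ⋆[L] g
  have hw : ∀ y, HasFDerivAt w (fderiv ℝ w y) y := fun y => by
    rw [fderiv_bsKernel_convolution L hg hR]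
    exact hasFDerivAt_bsKernel_convolution L hg hR y
  set d : ℝ := ((1 + N) ^ 2)⁻¹
  have hd : 0 < d := by positivity
  set s : ℝ := (2 * (1 + Real.log (1 + N)))⁻¹
  have hs : 0 < s := by positivity
  have hs1 : s ≤ 1 := inv_le_one_of_one_le₀ (by linarith)
  have hvar : ∀ y, ‖x - y‖ ≤ d → ‖fderiv ℝ w x - fderiv ℝ w y‖ ≤ ‖L‖ * (8 * (1 + R ^ 2)) := by
    intro y hy
    rcases eq_or_ne x y with rfl | hne
    · simp; positivity
    rw [fderiv_bsKernel_convolution L hg hR]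
    refine (norm_bsKernel_convolution_sub_le (L.precompR Plane) (hg.continuous_fderiv one_ne_zero) hN
      hR.fderiv (by norm_num : (0 : ℝ) < 1 / 2) (by norm_num) hne).trans ?_
    have h1 : ‖x - y‖ ^ (1 - 1 / 2 : ℝ) ≤ (1 + N)⁻¹ := by
      calc _ ≤ d ^ (1 - 1 / 2 : ℝ) := by gcongr
        _ = (1 + N)⁻¹ := by
          rw [show (1 - 1 / 2 : ℝ) = 1 / 2 by norm_num, ← Real.sqrt_eq_rpow, Real.sqrt_inv,
            Real.sqrt_sq (by positivity)]
    calc _ ≤ ‖L‖ * N * (4 * (1 + R ^ 2) * ((1 + N)⁻¹ / (1 / 2))) := by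
          gcongr
          exact L.norm_precompR_le Plane
      _ = ‖L‖ * (8 * (1 + R ^ 2)) * (N * (1 + N)⁻¹) := by ring
      _ ≤ ‖L‖ * (8 * (1 + R ^ 2)) * 1 := by
          gcongr
          rw [← div_eq_mul_inv, div_le_one (by positivity)]
          linarith
      _ = _ := mul_one _
  have hosc : ∀ y, ‖x - y‖ = d → ‖w y - w x‖ ≤
      d * (‖L‖ * (24 * (1 + R ^ 2) * M) * (1 + Real.log (1 + N))) := by
    intro y hy
    have hne : x ≠ y := by
      rintro rfl
      simp at hy
      exact hd.ne hy
    rw [norm_sub_rev]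
    refine (norm_bsKernel_convolution_sub_le L hg.continuous hM hR hs hs1 hne).trans ?_
    rw [hy]
    have h1 : d ^ (1 - s) ≤ d * 3 := by
      rw [Real.rpow_sub hd, Real.rpow_one, div_eq_mul_inv]
      gcongr
      rw [← Real.inv_rpow hd.le, inv_inv, Real.rpow_def_of_pos (by positivity), Real.log_pow]
      refine (Real.exp_le_exp.2 (?_ : _ ≤ (1 : ℝ))).trans Real.exp_one_lt_three.le
      rw [← div_eq_mul_inv, div_le_one (by positivity)]
      push_cast
      linarith
    have h2 : s⁻¹ = 2 * (1 + Real.log (1 + N)) := inv_inv _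
    calc _ ≤ ‖L‖ * M * (4 * (1 + R ^ 2) * (d * 3 / s)) := by gcongr
      _ = _ := by rw [div_eq_mul_inv, h2]; ring
  refine ContinuousLinearMap.opNorm_le_bound _ (by positivity) fun v => ?_
  rcases eq_or_ne v 0 with rfl | hv
  · simp
  have hv0 : 0 < ‖v‖ := norm_pos_iff.2 hv
  set e : Plane := (d / ‖v‖) • v
  have he : ‖e‖ = d := by
    rw [norm_smul, Real.norm_of_nonneg (by positivity)]
    field_simp
  have hmv : ‖w (x + e) - w x - fderiv ℝ w x (x + e - x)‖ ≤ ‖L‖ * (8 * (1 + R ^ 2)) * ‖x + e - x‖ := by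
    refine (convex_closedBall x d).norm_image_sub_le_of_norm_hasFDerivWithin_le'
      (f' := fderiv ℝ w) (fun y _ => (hw y).hasFDerivWithinAt) (fun y hy => ?_)
      (mem_closedBall_self hd.le) (by simp [he])
    rw [norm_sub_rev]
    exact hvar y (by rw [← dist_eq_norm, dist_comm]; exact hy)
  have hosc' := hosc (x + e) (by simp [he])
  rw [add_sub_cancel_left, he] at hmv
  have h3 : ‖fderiv ℝ w x e‖ ≤ d * (‖L‖ * (24 * (1 + R ^ 2) * M) * (1 + Real.log (1 + N)))
      + ‖L‖ * (8 * (1 + R ^ 2)) * d := by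
    have := norm_sub_norm_le (fderiv ℝ w x e) (w (x + e) - w x)
    rw [norm_sub_rev (fderiv ℝ w x e)] at this
    linarith
  have h4 : ‖fderiv ℝ w x e‖ = d / ‖v‖ * ‖fderiv ℝ w x v‖ := by
    rw [map_smul, norm_smul, Real.norm_of_nonneg (by positivity)]
  rw [h4, div_mul_eq_mul_div, div_le_iff₀ hv0] at h3
  have h5 : ‖fderiv ℝ w x v‖ ≤ (‖L‖ * (24 * (1 + R ^ 2) * M) * (1 + Real.log (1 + N))
      + ‖L‖ * (8 * (1 + R ^ 2))) * ‖v‖ := by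
    refine le_of_mul_le_mul_left (h3.trans_eq ?_) hd
    ring
  refine h5.trans ?_
  gcongr
  have h6 : 0 ≤ ‖L‖ * (1 + R ^ 2) := by positivity
  have h7 : 0 ≤ ‖L‖ * (1 + R ^ 2) * M := by positivity
  nlinarith [mul_nonneg h6 hlog, mul_nonneg h7 hlog]

end

section

open Metric

/-- Smooth functions on the plane. -/
abbrev Smooth {F : Type} [NormedAddCommGroup F] [NormedSpace ℝ F] (f : Plane → F) : Prop :=
  ContDiff ℝ (⊤ : ℕ∞) f

/-- All derivatives of order at most `k` are bounded by `M`. -/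
def DerivBound {F : Type} [NormedAddCommGroup F] [NormedSpace ℝ F] (k : ℕ) (M : ℝ)
    (f : Plane → F) : Prop :=
  ∀ j ≤ k, ∀ x, ‖iteratedFDeriv ℝ j f x‖ ≤ M

section

variable {F G H : Type} [NormedAddCommGroup F] [NormedSpace ℝ F] [NormedAddCommGroup G]
  [NormedSpace ℝ G] [NormedAddCommGroup H] [NormedSpace ℝ H]

theorem Smooth.fderiv {f : Plane → F} (hf : Smooth f) : Smooth (fderiv ℝ f) :=
  hf.fderiv_right (m := (⊤ : ℕ∞)) (by norm_cast)

theorem Smooth.nat {f : Plane → F} (hf : Smooth f) (n : ℕ) : ContDiff ℝ n f :=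
  hf.of_le (by exact_mod_cast le_top)

theorem Smooth.one {f : Plane → F} (hf : Smooth f) : ContDiff ℝ 1 f := by
  exact_mod_cast hf.nat 1

theorem Smooth.differentiable {f : Plane → F} (hf : Smooth f) : Differentiable ℝ f :=
  hf.one.differentiable one_ne_zero

namespace DerivBound

variable {f : Plane → F} {g : Plane → G} {k : ℕ} {M N : ℝ}

theorem mono (h : DerivBound k M f) (hMN : M ≤ N) : DerivBound k N f :=
  fun j hj x => (h j hj x).trans hMN

theorem mono_left {l : ℕ} (h : DerivBound k M f) (hl : l ≤ k) : DerivBound l M f :=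
  fun j hj x => h j (hj.trans hl) x

theorem norm_le (h : DerivBound k M f) (x : Plane) : ‖f x‖ ≤ M := by
  simpa using h 0 k.zero_le x

theorem nonneg (h : DerivBound k M f) : 0 ≤ M := (norm_nonneg _).trans (h.norm_le 0)

theorem fderiv (h : DerivBound (k + 1) M f) : DerivBound k M (fderiv ℝ f) := fun j hj x => by
  rw [norm_iteratedFDeriv_fderiv]
  exact h (j + 1) (by omega) x

theorem norm_fderiv_le (h : DerivBound (k + 1) M f) (x : Plane) : ‖_root_.fderiv ℝ f x‖ ≤ M :=
  h.fderiv.norm_le x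

theorem zero_iff : DerivBound 0 M f ↔ ∀ x, ‖f x‖ ≤ M :=
  ⟨norm_le, fun h j hj x => by obtain rfl : j = 0 := by omega
                               simpa using h x⟩

theorem succ_of (h0 : ∀ x, ‖f x‖ ≤ M) (h : DerivBound k M (_root_.fderiv ℝ f)) :
    DerivBound (k + 1) M f := fun j hj x => by
  cases j with
  | zero => simpa using h0 x
  | succ j => rw [← norm_iteratedFDeriv_fderiv]; exact h j (by omega) x

theorem succ_of_le (h0 : DerivBound k M f) (h : ∀ x, ‖iteratedFDeriv ℝ (k + 1) f x‖ ≤ M) :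
    DerivBound (k + 1) M f := fun j hj x => by
  rcases Nat.lt_or_ge k j with hk | hk
  · obtain rfl : j = k + 1 := by omega
    exact h x
  · exact h0 j hk x

theorem add {f' : Plane → F} (hf : Smooth f) (hf' : Smooth f') (h : DerivBound k M f)
    (h' : DerivBound k N f') : DerivBound k (M + N) (fun x => f x + f' x) := fun j hj x => by
  have := iteratedFDeriv_add_apply (x := x) (hf.nat j).contDiffAt (hf'.nat j).contDiffAt
  change ‖iteratedFDeriv ℝ j (f + f') x‖ ≤ _
  rw [this]
  exact (norm_add_le _ _).trans (add_le_add (h j hj x) (h' j hj x))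

theorem const_smul {c : ℝ} (hc : 0 ≤ c) (hf : Smooth f) (h : DerivBound k M f) :
    DerivBound k (c * M) (fun x => c • f x) := fun j hj x => by
  change ‖iteratedFDeriv ℝ j (c • f) x‖ ≤ _
  rw [iteratedFDeriv_const_smul_apply (hf.nat j).contDiffAt, norm_smul, Real.norm_of_nonneg hc]
  gcongr
  exact h j hj x

theorem bilin (B : F →L[ℝ] G →L[ℝ] H) (hB : ‖B‖ ≤ 1) (hf : Smooth f) (hg : Smooth g)
    (h : DerivBound k M f) (h' : DerivBound k N g) :
    DerivBound k (2 ^ k * (M * N)) (fun x => B (f x) (g x)) := fun j hj x => by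
  have hM := h.nonneg
  have hN := h'.nonneg
  refine (B.norm_iteratedFDeriv_le_of_bilinear_of_le_one hf hg x (n := j)
    (by exact_mod_cast le_top) hB).trans ?_
  calc _ ≤ ∑ i ∈ Finset.range (j + 1), (j.choose i : ℝ) * (M * N) := by
        refine Finset.sum_le_sum fun i hi => ?_
        rw [Finset.mem_range] at hi
        rw [mul_assoc]
        gcongr
        · exact h i (by omega) x
        · exact h' (j - i) (by omega) x
    _ = 2 ^ j * (M * N) := by
        rw [← Finset.sum_mul]
        exact_mod_cast congrArg (fun n : ℕ => (n : ℝ) * (M * N)) (Nat.sum_range_choose j)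
    _ ≤ _ := by gcongr; norm_num

end DerivBound

/-- One explicit Euler step of transport of `f` along the velocity `w`. -/
def advect (h : ℝ) (w : Plane → Plane) (f : Plane → F) : Plane → F := fun x => f (x + h • w x)

theorem Smooth.advect {h : ℝ} {w : Plane → Plane} {f : Plane → F} (hf : Smooth f)
    (hw : Smooth w) : Smooth (advect h w f) :=
  by
  have : ContDiff ℝ (⊤ : ℕ∞) fun x => x + h • w x := contDiff_id.add (hw.const_smul h)
  exact ContDiff.comp hf this

theorem fderiv_advect {h : ℝ} {w : Plane → Plane} {f : Plane → F} (hf : Smooth f)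
    (hw : Smooth w) : fderiv ℝ (advect h w f) = fun x => advect h w (fderiv ℝ f) x +
      h • ContinuousLinearMap.compL ℝ Plane Plane F (advect h w (fderiv ℝ f) x) (fderiv ℝ w x) := by
  ext1 x
  have h1 : HasFDerivAt (fun x => x + h • w x) (ContinuousLinearMap.id ℝ Plane + h • fderiv ℝ w x) x :=
    (hasFDerivAt_id x).add ((hw.differentiable x).hasFDerivAt.const_smul h)
  have h2 := (hf.differentiable (x + h • w x)).hasFDerivAt.comp x h1
  rw [show _root_.advect h w f = f ∘ fun x => x + h • w x from rfl, h2.fderiv]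
  ext v
  simp [_root_.advect]

theorem Smooth.compL {f : Plane → Plane →L[ℝ] F} {w : Plane → Plane →L[ℝ] Plane} (hf : Smooth f)
    (hw : Smooth w) : Smooth fun x => ContinuousLinearMap.compL ℝ Plane Plane F (f x) (w x) :=
  ContDiff.clm_comp hf hw

end

theorem exists_derivBound_advect (k : ℕ) {M : ℝ} (hM : 0 ≤ M) : ∃ C : ℝ, 0 ≤ C ∧
    ∀ {F : Type} [NormedAddCommGroup F] [NormedSpace ℝ F] {f : Plane → F} {w : Plane → Plane}
      {h : ℝ}, 0 ≤ h → h ≤ 1 → Smooth f → Smooth w → DerivBound k M f → DerivBound k M w →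
      DerivBound k C (advect h w f) := by
  induction k with
  | zero =>
    refine ⟨M, hM, fun _ _ _ _ hf _ => ?_⟩
    rw [DerivBound.zero_iff] at *
    exact fun x => hf _
  | succ k ih =>
    obtain ⟨C, hC, ih⟩ := ih
    refine ⟨M + (C + 1 * (2 ^ k * (C * M))), by positivity, ?_⟩
    intro F _ _ f w h h0 h1 hf hw hfM hwM
    have hb := ih h0 h1 hf.fderiv hw hfM.fderiv (hwM.mono_left k.le_succ)
    refine DerivBound.succ_of (fun x => ?_) ?_
    · exact (hfM.norm_le _).trans (le_add_of_nonneg_right (by positivity))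
    · rw [fderiv_advect hf hw]
      have hs := hf.fderiv.advect (h := h) hw
      refine (hb.add hs (contDiff_const.smul (hs.compL hw.fderiv))
        (((hb.bilin _ (ContinuousLinearMap.norm_compL_le ℝ Plane Plane F) hs hw.fderiv
          hwM.fderiv).const_smul h0 (hs.compL hw.fderiv)))).mono ?_
      have : h * (2 ^ k * (C * M)) ≤ 1 * (2 ^ k * (C * M)) := by gcongr
      linarith

theorem exists_norm_iteratedFDeriv_advect_le (k : ℕ) {M : ℝ} (hM : 0 ≤ M) : ∃ C : ℝ, 0 ≤ C ∧
    ∀ {F : Type} [NormedAddCommGroup F] [NormedSpace ℝ F] {f : Plane → F} {w : Plane → Plane}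
      {h a b : ℝ}, 0 ≤ h → h ≤ 1 → Smooth f → Smooth w →
      (∀ j < k, ∀ x, ‖iteratedFDeriv ℝ j f x‖ ≤ M) → (∀ j < k, ∀ x, ‖iteratedFDeriv ℝ j w x‖ ≤ M) →
      (∀ x, ‖fderiv ℝ w x‖ ≤ M) → (∀ x, ‖iteratedFDeriv ℝ k f x‖ ≤ a) →
      (∀ x, ‖iteratedFDeriv ℝ k w x‖ ≤ b) →
      ∀ x, ‖iteratedFDeriv ℝ k (advect h w f) x‖ ≤ (1 + C * h) * a + C * h * (1 + b) := by
  induction k with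
  | zero =>
    refine ⟨0, le_rfl, ?_⟩
    intro F _ _ f w h a b _ _ _ _ _ _ _ ha _ x
    simpa [advect] using ha (x + h • w x)
  | succ k ih =>
    obtain ⟨C, hC, ih⟩ := ih
    obtain ⟨C₀, hC₀, hadv⟩ := exists_derivBound_advect (k - 1) hM
    refine ⟨C + C * (1 + M) + 2 ^ k * (M * (1 + C) + M * (C * (1 + M)) + C₀ * M + C₀),
      by positivity, ?_⟩
    intro F _ _ f w h a b h0 h1 hf hw hfM hwM hw1 ha hb x
    have ha0 : 0 ≤ a := (norm_nonneg _).trans (ha 0)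
    have hb0 : 0 ≤ b := (norm_nonneg _).trans (hb 0)
    have hD : ∀ j < k, ∀ x, ‖iteratedFDeriv ℝ j (fderiv ℝ f) x‖ ≤ M := fun j hj x => by
      rw [norm_iteratedFDeriv_fderiv]
      exact hfM _ (by omega) x
    set X := (1 + C * h) * a + C * h * (1 + M)
    have hX0 : 0 ≤ X := by positivity
    have hX := ih h0 h1 hf.fderiv hw hD (fun j hj => hwM j (by omega)) hw1
      (fun x => by rw [norm_iteratedFDeriv_fderiv]; exact ha x) (hwM k k.lt_succ_self)
    have hs := hf.fderiv.advect (h := h) hw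
    have hc := hs.compL hw.fderiv
    have hprod : ‖iteratedFDeriv ℝ k (fun x => ContinuousLinearMap.compL ℝ Plane Plane F
        (advect h w (fderiv ℝ f) x) (fderiv ℝ w x)) x‖ ≤ 2 ^ k * (X * M + C₀ * (M + b)) := by
      refine ((ContinuousLinearMap.compL ℝ Plane Plane F).norm_iteratedFDeriv_le_of_bilinear_of_le_one
        hs hw.fderiv x (n := k) (by exact_mod_cast le_top)
        (ContinuousLinearMap.norm_compL_le ℝ Plane Plane F)).trans ?_
      calc _ ≤ ∑ i ∈ Finset.range (k + 1), (k.choose i : ℝ) * (X * M + C₀ * (M + b)) := by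
            refine Finset.sum_le_sum fun i hi => ?_
            rw [Finset.mem_range] at hi
            rw [mul_assoc]
            gcongr
            rcases Nat.lt_or_ge i k with hik | hik
            · have e1 : ‖iteratedFDeriv ℝ i (advect h w (fderiv ℝ f)) x‖ ≤ C₀ :=
                hadv h0 h1 hf.fderiv hw (fun j hj => hD j (by omega))
                  (fun j hj => hwM j (by omega)) i (by omega) x
              have e2 : ‖iteratedFDeriv ℝ (k - i) (fderiv ℝ w) x‖ ≤ M + b := by
                rw [norm_iteratedFDeriv_fderiv]
                rcases Nat.eq_zero_or_pos i with rfl | hi0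
                · exact (hb x).trans (le_add_of_nonneg_left hM)
                · exact (hwM _ (by omega) x).trans (le_add_of_nonneg_right hb0)
              exact (mul_le_mul e1 e2 (norm_nonneg _) hC₀).trans
                (le_add_of_nonneg_left (by positivity))
            · obtain rfl : i = k := by omega
              refine (mul_le_mul (hX x) (?_ : _ ≤ M) (norm_nonneg _) hX0).trans
                (le_add_of_nonneg_right (by positivity))
              rw [Nat.sub_self, norm_iteratedFDeriv_zero]
              exact hw1 x
        _ = _ := by
            rw [← Finset.sum_mul]
            exact_mod_cast congrArg (fun n : ℕ => (n : ℝ) * (X * M + C₀ * (M + b)))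
              (Nat.sum_range_choose k)
    have hXle : X ≤ (1 + C) * a + C * (1 + M) := by
      have e1 : C * h ≤ C := mul_le_of_le_one_right hC h1
      simp only [X]
      gcongr
    have hfin : ‖iteratedFDeriv ℝ (k + 1) (advect h w f) x‖ ≤
        X + h * (2 ^ k * (X * M + C₀ * (M + b))) := by
      rw [← norm_iteratedFDeriv_fderiv, fderiv_advect hf hw]
      have := iteratedFDeriv_add_apply (x := x) (hs.nat k).contDiffAt
        ((contDiff_const (c := h)).smul (hc.nat k)).contDiffAt
      refine (le_of_eq (congrArg norm this)).trans ((norm_add_le _ _).trans ?_)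
      gcongr
      · exact hX x
      · refine (le_of_eq (congrArg norm
          (iteratedFDeriv_const_smul_apply (a := h) (hc.nat k).contDiffAt))).trans ?_
        rw [norm_smul, Real.norm_of_nonneg h0]
        gcongr
    refine hfin.trans ?_
    set P : ℝ := 2 ^ k
    have hP : 0 ≤ P := by positivity
    calc X + h * (P * (X * M + C₀ * (M + b)))
        ≤ X + h * (P * (((1 + C) * a + C * (1 + M)) * M + C₀ * (M + b))) := by gcongr
      _ = (1 + (C + P * (M * (1 + C))) * h) * a
          + h * (C * (1 + M) + P * (M * (C * (1 + M)) + C₀ * M)) + h * (P * C₀) * b := by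
          simp only [X]; ring
      _ ≤ (1 + (C + C * (1 + M) + P * (M * (1 + C) + M * (C * (1 + M)) + C₀ * M + C₀)) * h) * a
          + h * (C + C * (1 + M) + P * (M * (1 + C) + M * (C * (1 + M)) + C₀ * M + C₀))
          + h * (C + C * (1 + M) + P * (M * (1 + C) + M * (C * (1 + M)) + C₀ * M + C₀)) * b := by
          have q1 : 0 ≤ C * (1 + M) := by positivity
          have q2 : 0 ≤ P * (M * (1 + C)) := by positivity
          have q3 : 0 ≤ P * (M * (C * (1 + M))) := by positivity
          have q4 : 0 ≤ P * (C₀ * M) := by positivity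
          have q5 : 0 ≤ P * C₀ := by positivity
          rw [show P * (M * (1 + C) + M * (C * (1 + M)) + C₀ * M + C₀) = P * (M * (1 + C)) +
            P * (M * (C * (1 + M))) + P * (C₀ * M) + P * C₀ by ring,
            show P * (M * (C * (1 + M)) + C₀ * M) = P * (M * (C * (1 + M))) + P * (C₀ * M) by ring]
          generalize P * (M * (1 + C)) = r2 at *
          generalize P * (M * (C * (1 + M))) = r3 at *
          generalize P * (C₀ * M) = r4 at *
          generalize P * C₀ = r5 at *
          generalize C * (1 + M) = r1 at *
          have e1 : (C + r2) * h ≤ (C + r1 + (r2 + r3 + r4 + r5)) * h :=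
            mul_le_mul_of_nonneg_right (by linarith) h0
          have e2 : h * (r1 + (r3 + r4)) ≤ h * (C + r1 + (r2 + r3 + r4 + r5)) :=
            mul_le_mul_of_nonneg_left (by linarith) h0
          have e3 : h * r5 ≤ h * (C + r1 + (r2 + r3 + r4 + r5)) :=
            mul_le_mul_of_nonneg_left (by linarith) h0
          have e4 := mul_le_mul_of_nonneg_right e1 ha0
          have e5 := mul_le_mul_of_nonneg_right e3 hb0
          linarith
      _ = _ := by ring

theorem exists_derivBound_advect_sub (k : ℕ) {M : ℝ} (hM : 0 ≤ M) : ∃ C : ℝ, 0 ≤ C ∧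
    ∀ {F : Type} [NormedAddCommGroup F] [NormedSpace ℝ F] {f : Plane → F} {w : Plane → Plane}
      {h : ℝ}, 0 ≤ h → h ≤ 1 → Smooth f → Smooth w → DerivBound (k + 1) M f → DerivBound k M w →
      DerivBound k (C * h) (fun x => advect h w f x - f x) := by
  have hlip : ∀ {F : Type} [NormedAddCommGroup F] [NormedSpace ℝ F] {f : Plane → F}
      {w : Plane → Plane} {h : ℝ}, 0 ≤ h → Smooth f → DerivBound 1 M f → (∀ x, ‖w x‖ ≤ M) →
      ∀ x, ‖advect h w f x - f x‖ ≤ M * M * h := by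
    intro F _ _ f w h h0 hf hfM hwM x
    have := convex_univ.norm_image_sub_le_of_norm_fderiv_le (f := f) (𝕜 := ℝ)
      (fun y _ => hf.differentiable y) (fun y _ => hfM.norm_fderiv_le y) (mem_univ x)
      (mem_univ (x + h • w x))
    refine this.trans ?_
    rw [add_sub_cancel_left, norm_smul, Real.norm_of_nonneg h0]
    nlinarith [mul_le_mul_of_nonneg_left (hwM x) (mul_nonneg hM h0)]
  induction k with
  | zero =>
    refine ⟨M * M, by positivity, ?_⟩
    intro F _ _ f w h h0 _ hf _ hfM hwM
    rw [DerivBound.zero_iff]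
    exact hlip h0 hf hfM hwM.norm_le
  | succ k ih =>
    obtain ⟨C, hC, ih⟩ := ih
    obtain ⟨C₀, hC₀, hadv⟩ := exists_derivBound_advect k hM
    refine ⟨M * M + (C + 2 ^ k * (C₀ * M)), by positivity, ?_⟩
    intro F _ _ f w h h0 h1 hf hw hfM hwM
    have hs := hf.fderiv.advect (h := h) hw
    have hc := hs.compL hw.fderiv
    refine DerivBound.succ_of (fun x => ?_) ?_
    · refine (hlip h0 hf (hfM.mono_left (by omega)) hwM.norm_le x).trans ?_
      gcongr
      exact le_add_of_nonneg_right (by positivity)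
    · have e : fderiv ℝ (fun x => advect h w f x - f x) = fun x =>
          (advect h w (fderiv ℝ f) x - fderiv ℝ f x) + h • ContinuousLinearMap.compL ℝ Plane Plane F
            (advect h w (fderiv ℝ f) x) (fderiv ℝ w x) := by
        ext1 x
        rw [fderiv_fun_sub (Smooth.differentiable (hf.advect hw) x) (hf.differentiable x),
          fderiv_advect hf hw]
        exact add_sub_right_comm _ _ _
      rw [e]
      have b1 := ih h0 h1 hf.fderiv hw hfM.fderiv (hwM.mono_left k.le_succ)
      have b2 := hadv h0 h1 hf.fderiv hw (hfM.fderiv.mono_left k.le_succ)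
        (hwM.mono_left k.le_succ)
      refine (b1.add (hs.sub hf.fderiv) (contDiff_const.smul hc)
        ((b2.bilin _ (ContinuousLinearMap.norm_compL_le ℝ Plane Plane F) hs hw.fderiv
          hwM.fderiv).const_smul h0 hc)).mono ?_
      nlinarith [mul_nonneg (mul_nonneg hM hM) h0]

theorem norm_advect_sub_sub_le {f : Plane → ℝ} {w : Plane → Plane} {h M : ℝ} (h0 : 0 ≤ h)
    (hf : Smooth f) (hfM : DerivBound 2 M f) (hwM : ∀ x, ‖w x‖ ≤ M) (x : Plane) :
    ‖advect h w f x - f x - h * fderiv ℝ f x (w x)‖ ≤ M * M ^ 2 * h ^ 2 := by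
  have hM := hfM.nonneg
  set y := x + h • w x
  have hy : ‖y - x‖ ≤ h * M := by
    simp only [y, add_sub_cancel_left, norm_smul, Real.norm_of_nonneg h0]
    gcongr
    exact hwM x
  have hvar : ∀ z ∈ closedBall x (h * M), ‖fderiv ℝ f z - fderiv ℝ f x‖ ≤ M * (h * M) := by
    intro z hz
    have := convex_univ.norm_image_sub_le_of_norm_fderiv_le (f := fderiv ℝ f) (𝕜 := ℝ)
      (fun y _ => hf.fderiv.differentiable y) (fun y _ => hfM.fderiv.norm_fderiv_le y) (mem_univ x)
      (mem_univ z)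
    refine this.trans ?_
    gcongr
    rwa [← dist_eq_norm]
  have := (convex_closedBall x (h * M)).norm_image_sub_le_of_norm_hasFDerivWithin_le'
      (f := f) (f' := fderiv ℝ f) (φ := fderiv ℝ f x)
      (fun y _ => (hf.differentiable y).hasFDerivAt.hasFDerivWithinAt) hvar
      (mem_closedBall_self (by positivity)) (by rwa [mem_closedBall, dist_eq_norm] : y ∈ _)
  have e : fderiv ℝ f x (y - x) = h * fderiv ℝ f x (w x) := by simp [y]
  rw [e] at this
  refine this.trans ?_
  calc _ ≤ M * (h * M) * (h * M) := by gcongr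
    _ = _ := by ring

end

section

open Metric
open scoped Convolution

theorem biotSavart_dilate (q : Plane → ℝ) {R : ℝ} (hR : 0 < R) (x : Plane) :
    biotSavart q (R • x) = R • biotSavart (fun y => q (R • y)) x := by
  have h := Measure.integral_comp_smul (volume : Measure Plane)
    (fun y => (q y / ‖R • x - y‖ ^ 2) • perp (R • x - y)) R
  have e : ∀ y, (q (R • y) / ‖R • x - R • y‖ ^ 2) • perp (R • x - R • y) =
      R⁻¹ • ((q (R • y) / ‖x - y‖ ^ 2) • perp (x - y)) := fun y => by
    rw [← smul_sub, ← perpL_apply, ← perpL_apply, map_smul, norm_smul, Real.norm_of_nonneg hR.le,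
      smul_smul, smul_smul]
    congr 1
    field_simp
  simp only [e] at h
  rw [integral_smul] at h
  have hd : Module.finrank ℝ Plane = 2 := by simp
  rw [hd, abs_of_pos (by positivity)] at h
  rw [biotSavart, biotSavart, smul_comm R]
  congr 1
  have h2 := congrArg (fun v => (R ^ 2) • v) h
  simp only [smul_smul] at h2
  rw [mul_inv_cancel₀ (by positivity), one_smul] at h2
  rw [← h2]
  congr 1
  field_simp

theorem norm_biotSavart_le {q : Plane → ℝ} {M R : ℝ} (hM : ∀ x, ‖q x‖ ≤ M) (hR : 0 < R)
    (hq : SuppIn R q) (x : Plane) : ‖biotSavart q x‖ ≤ 2 * M * R := by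
  have hM0 : 0 ≤ M := (norm_nonneg _).trans (hM 0)
  obtain ⟨y, rfl⟩ : ∃ y, x = R • y := ⟨R⁻¹ • x, by rw [smul_smul, mul_inv_cancel₀ hR.ne', one_smul]⟩
  rw [biotSavart_dilate q hR, norm_smul, Real.norm_of_nonneg hR.le, biotSavart_eq_convolution]
  have := norm_bsKernel_convolution_le bsL (g := fun y => q (R • y)) (R := 1) (fun y => hM _)
    (fun z hz => hq _ (by rw [norm_smul, Real.norm_of_nonneg hR.le]; nlinarith)) y
  have h2 := norm_bsL_le
  nlinarith [mul_nonneg hR.le hM0, mul_le_mul_of_nonneg_right h2 hM0,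
    mul_le_mul_of_nonneg_left this hR.le]

theorem exists_derivBound {f : Plane → ℝ} (hf : Smooth f) (hc : HasCompactSupport f) (k : ℕ) :
    ∃ M, DerivBound k M f := by
  induction k with
  | zero =>
    obtain ⟨C, hC⟩ := hf.continuous.bounded_above_of_compact_support hc
    exact ⟨C, DerivBound.zero_iff.2 hC⟩
  | succ k ih =>
    obtain ⟨M, hM⟩ := ih
    obtain ⟨C, hC⟩ := ((hf.nat (k + 1)).continuous_iteratedFDeriv
      (le_refl _)).bounded_above_of_compact_support (hc.iteratedFDeriv (𝕜 := ℝ) (k + 1))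
    exact ⟨max M C, (hM.mono (le_max_left _ _)).succ_of_le fun x => (hC x).trans (le_max_right _ _)⟩

/-- The direction of advection of each of the two scalars. -/
def orient (b : Bool) : ℝ := if b then 1 else -1

/-- The velocities advecting the pair `s`. -/
def velocity (s : Bool → Plane → ℝ) (b : Bool) (x : Plane) : Plane :=
  orient b • biotSavart (s (!b)) x

/-- The explicit Euler scheme with time step `h`. -/
def euler (h : ℝ) (s : Bool → Plane → ℝ) : ℕ → Bool → Plane → ℝ
  | 0 => s
  | n + 1 => fun b => advect h (velocity (euler h s n) b) (euler h s n b)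

theorem abs_orient (b : Bool) : |orient b| = 1 := by cases b <;> simp [orient]

theorem norm_velocity (s : Bool → Plane → ℝ) (b : Bool) (x : Plane) :
    ‖velocity s b x‖ = ‖biotSavart (s (!b)) x‖ := by
  rw [velocity, norm_smul, Real.norm_eq_abs, abs_orient, one_mul]

theorem velocity_eq_convolution (s : Bool → Plane → ℝ) (b : Bool) :
    velocity s b = bsKernel ⋆[orient b • bsL] s (!b) := by
  ext1 x
  rw [velocity, biotSavart_eq_convolution]
  simp only [convolution, smul_apply, integral_smul]

theorem norm_orient_bsL_le (b : Bool) : ‖orient b • bsL‖ ≤ 1 := by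
  cases b
  · rw [show orient false • bsL = -bsL by ext; simp [orient]]
    exact (norm_neg bsL).trans_le norm_bsL_le
  · rw [show orient true • bsL = bsL by ext; simp [orient]]
    exact norm_bsL_le

theorem smooth_velocity {s : Bool → Plane → ℝ} {R : ℝ} (hs : ∀ b, Smooth (s b))
    (hR : ∀ b, SuppIn R (s b)) (b : Bool) : Smooth (velocity s b) := by
  rw [velocity_eq_convolution]
  exact contDiff_bsKernel_convolution _ (hs _) (hR _)

theorem norm_iteratedFDeriv_velocity_le {s : Bool → Plane → ℝ} {M R : ℝ} {j : ℕ}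
    (hs : ∀ b, Smooth (s b)) (hR : ∀ b, SuppIn R (s b))
    (hM : ∀ b x, ‖iteratedFDeriv ℝ j (s b) x‖ ≤ M) (b : Bool) (x : Plane) :
    ‖iteratedFDeriv ℝ j (velocity s b) x‖ ≤ (1 + R ^ 2) * M := by
  have hM0 : 0 ≤ M := (norm_nonneg _).trans (hM b x)
  rw [velocity_eq_convolution]
  refine (norm_iteratedFDeriv_bsKernel_convolution_le j _ (hs _) (hM _) (hR _) x).trans ?_
  gcongr
  exact mul_le_of_le_one_left (by positivity) (norm_orient_bsL_le b)

theorem DerivBound.velocity {s : Bool → Plane → ℝ} {M R : ℝ} {k : ℕ} (hs : ∀ b, Smooth (s b))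
    (hR : ∀ b, SuppIn R (s b)) (hM : ∀ b, DerivBound k M (s b)) (b : Bool) :
    DerivBound k ((1 + R ^ 2) * M) (velocity s b) := fun j hj x =>
  norm_iteratedFDeriv_velocity_le hs hR (fun b x => hM b j hj x) b x

theorem SuppIn.advect {f : Plane → ℝ} {w : Plane → Plane} {h R W : ℝ} (hf : SuppIn R f) (h0 : 0 ≤ h)
    (hw : ∀ x, ‖w x‖ ≤ W) : SuppIn (R + h * W) (advect h w f) := fun x hx => by
  refine hf _ ?_
  have h1 := norm_sub_le (x + h • w x) (h • w x)
  rw [add_sub_cancel_right, norm_smul, Real.norm_of_nonneg h0] at h1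
  have := mul_le_mul_of_nonneg_left (hw x) h0
  linarith

section

variable {s : Bool → Plane → ℝ}

theorem norm_euler_le {M : ℝ} (hM : ∀ b x, ‖s b x‖ ≤ M) (h : ℝ) (n : ℕ) (b : Bool) (x : Plane) :
    ‖euler h s n b x‖ ≤ M := by
  induction n generalizing x with
  | zero => exact hM b x
  | succ n ih => exact ih _

theorem suppIn_euler_exp {M R h : ℝ} (hM : ∀ b x, ‖s b x‖ ≤ M) (hR0 : 0 < R)
    (hR : ∀ b, SuppIn R (s b)) (h0 : 0 ≤ h) (n : ℕ) (b : Bool) :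
    SuppIn (R * Real.exp (2 * M * (n * h))) (euler h s n b) := by
  have hM0 : 0 ≤ M := (norm_nonneg _).trans (hM true 0)
  induction n generalizing b with
  | zero => simpa [euler] using hR b
  | succ n ih =>
    refine ((ih b).advect h0 (W := 2 * M * (R * Real.exp (2 * M * (n * h)))) fun x => ?_).mono ?_
    · rw [norm_velocity]
      exact norm_biotSavart_le (norm_euler_le hM h n _) (by positivity) (ih _) x
    · have : 2 * M * ((n + 1 : ℕ) * h) = 2 * M * (n * h) + 2 * M * h := by push_cast; ring
      rw [this, Real.exp_add]
      have h1 := Real.add_one_le_exp (2 * M * h)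
      have h2 := mul_le_mul_of_nonneg_left h1
        (by positivity : 0 ≤ R * Real.exp (2 * M * (n * h)))
      linarith

theorem exists_suppIn_euler (hs : ∀ b, Smooth (s b)) (hc : ∀ b, HasCompactSupport (s b)) (τ : ℝ) :
    ∃ R, 0 ≤ R ∧ ∀ h, 0 ≤ h → ∀ n : ℕ, n * h ≤ τ → ∀ b, SuppIn R (euler h s n b) := by
  obtain ⟨M₁, h₁⟩ := exists_derivBound (hs true) (hc true) 0
  obtain ⟨M₂, h₂⟩ := exists_derivBound (hs false) (hc false) 0
  obtain ⟨R₁, hR₁, hs₁⟩ := (hc true).exists_suppIn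
  obtain ⟨R₂, hR₂, hs₂⟩ := (hc false).exists_suppIn
  have hM : ∀ b x, ‖s b x‖ ≤ max M₁ M₂ := by
    rintro (_ | _) x
    · exact (h₂.norm_le x).trans (le_max_right _ _)
    · exact (h₁.norm_le x).trans (le_max_left _ _)
  have hM0 : 0 ≤ max M₁ M₂ := (norm_nonneg _).trans (hM true 0)
  have hR : ∀ b, SuppIn (R₁ + R₂ + 1) (s b) := by
    rintro (_ | _)
    · exact hs₂.mono (by linarith)
    · exact hs₁.mono (by linarith)
  refine ⟨(R₁ + R₂ + 1) * Real.exp (2 * max M₁ M₂ * τ), by positivity, fun h h0 n hn b => ?_⟩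
  refine (suppIn_euler_exp hM (by positivity) hR h0 n b).mono ?_
  gcongr

theorem smooth_euler (hs : ∀ b, Smooth (s b)) (hc : ∀ b, HasCompactSupport (s b)) {h : ℝ}
    (h0 : 0 ≤ h) (n : ℕ) (b : Bool) : Smooth (euler h s n b) := by
  induction n generalizing b with
  | zero => exact hs b
  | succ n ih =>
    obtain ⟨R, -, hR⟩ := exists_suppIn_euler hs hc (n * h)
    exact (ih b).advect (smooth_velocity ih (hR h h0 n le_rfl) b)

theorem exists_norm_fderiv_euler_le (hs : ∀ b, Smooth (s b)) (hc : ∀ b, HasCompactSupport (s b))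
    (τ : ℝ) : ∃ M, 0 ≤ M ∧ ∀ h, 0 ≤ h → ∀ n : ℕ, n * h ≤ τ → ∀ b x,
      ‖fderiv ℝ (euler h s n b) x‖ ≤ M := by
  obtain ⟨R, hR0, hR⟩ := exists_suppIn_euler hs hc τ
  obtain ⟨M₁, h₁⟩ := exists_derivBound (hs true) (hc true) 1
  obtain ⟨M₂, h₂⟩ := exists_derivBound (hs false) (hc false) 1
  set M := max M₁ M₂
  have hM : ∀ b, DerivBound 1 M (s b) := by
    rintro (_ | _)
    · exact h₂.mono (le_max_right _ _)
    · exact h₁.mono (le_max_left _ _)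
  have hM0 : 0 ≤ M := (hM true).nonneg
  set K := 32 * (1 + R ^ 2) * (1 + M)
  set ℓ := 1 + Real.log (1 + M)
  have hℓ : 0 ≤ ℓ := by
    have := Real.log_nonneg (by linarith : 1 ≤ 1 + M)
    positivity
  have key : ∀ h, 0 ≤ h → ∀ n : ℕ, n * h ≤ τ → ∀ b x,
      1 + ‖fderiv ℝ (euler h s n b) x‖ ≤ Real.exp (ℓ * Real.exp (K * (n * h)) - 1) := by
    intro h h0 n
    induction n with
    | zero =>
      intro _ b x
      have e : Real.exp (ℓ * Real.exp (K * ((0 : ℕ) * h)) - 1) = 1 + M := by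
        simp only [Nat.cast_zero, zero_mul, mul_zero, Real.exp_zero, mul_one, ℓ]
        rw [add_sub_cancel_left, Real.exp_log (by linarith)]
      rw [e]
      gcongr
      exact (hM b).norm_fderiv_le x
    | succ n ih =>
      intro hn b x
      push_cast at hn
      have hn' : n * h ≤ τ := by nlinarith
      set X := ℓ * Real.exp (K * (n * h))
      set N := Real.exp (X - 1) - 1
      have hN : ∀ b x, ‖fderiv ℝ (euler h s n b) x‖ ≤ N := fun b x => by
        have := ih hn' b x
        simp only [N]
        linarith
      have hN0 : 0 ≤ N := (norm_nonneg _).trans (hN b x)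
      have hes := smooth_euler hs hc h0 n
      have hv := smooth_velocity hes (hR h h0 n hn') b
      have hvb : ‖fderiv ℝ (velocity (euler h s n) b) x‖ ≤ K * X := by
        rw [velocity_eq_convolution]
        refine (norm_fderiv_bsKernel_convolution_le_log _ (hes _).one (hR h h0 n hn' _)
          (norm_euler_le (fun b x => (hM b).norm_le x) h n _) (hN _) x).trans ?_
        have e : 1 + Real.log (1 + N) = X := by simp [N]
        rw [e]
        have : 0 ≤ X := by positivity
        have hK : 0 ≤ K := by positivity
        gcongr
        exact mul_le_of_le_one_left hK (norm_orient_bsL_le b)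
      have hX : 0 ≤ X := by positivity
      have hK : 0 ≤ K := by positivity
      have hstep : ‖fderiv ℝ (euler h s (n + 1) b) x‖ ≤ N + h * (N * (K * X)) := by
        rw [euler, fderiv_advect (hes b) hv]
        refine (norm_add_le _ _).trans (add_le_add (hN _ _) ?_)
        rw [norm_smul, Real.norm_of_nonneg h0]
        gcongr
        rw [ContinuousLinearMap.compL_apply]
        refine (ContinuousLinearMap.opNorm_comp_le _ _).trans ?_
        gcongr
        exact hN _ _
      have e1 : K * ((n + 1 : ℕ) * h) = K * (n * h) + K * h := by push_cast; ring
      rw [e1, Real.exp_add, ← mul_assoc]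
      have h3 : X + h * (K * X) ≤ X * Real.exp (K * h) := by
        have := mul_le_mul_of_nonneg_left (Real.add_one_le_exp (K * h)) hX
        linarith
      calc 1 + ‖fderiv ℝ (euler h s (n + 1) b) x‖ ≤ (1 + N) * (h * (K * X) + 1) := by
            have : 0 ≤ h * (K * X) := by positivity
            linarith
        _ ≤ Real.exp (X - 1) * Real.exp (h * (K * X)) := by
            have e : 1 + N = Real.exp (X - 1) := by simp [N]
            rw [e]
            gcongr
            exact Real.add_one_le_exp _
        _ ≤ _ := by
            rw [← Real.exp_add]
            gcongr
            linarith
  refine ⟨Real.exp (ℓ * Real.exp (K * τ) - 1), by positivity, fun h h0 n hn b x => ?_⟩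
  refine (le_add_of_nonneg_left zero_le_one).trans ((key h h0 n hn b x).trans ?_)
  have hK : 0 ≤ K := by positivity
  gcongr

theorem exists_derivBound_euler (hs : ∀ b, Smooth (s b)) (hc : ∀ b, HasCompactSupport (s b))
    (τ : ℝ) (k : ℕ) : ∃ M, 0 ≤ M ∧ ∀ h, 0 ≤ h → h ≤ 1 → ∀ n : ℕ, n * h ≤ τ → ∀ b,
      DerivBound k M (euler h s n b) := by
  obtain ⟨R, hR0, hR⟩ := exists_suppIn_euler hs hc τ
  obtain ⟨B, hB0, hB⟩ := exists_norm_fderiv_euler_le hs hc τ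
  induction k with
  | zero =>
    obtain ⟨M₁, h₁⟩ := exists_derivBound (hs true) (hc true) 0
    obtain ⟨M₂, h₂⟩ := exists_derivBound (hs false) (hc false) 0
    have hM : ∀ b x, ‖s b x‖ ≤ max M₁ M₂ := by
      rintro (_ | _) x
      · exact (h₂.norm_le x).trans (le_max_right _ _)
      · exact (h₁.norm_le x).trans (le_max_left _ _)
    exact ⟨max M₁ M₂, (norm_nonneg _).trans (hM true 0), fun h _ _ n _ b =>
      DerivBound.zero_iff.2 (norm_euler_le hM h n b)⟩
  | succ k ih =>
    obtain ⟨M, hM0, hM⟩ := ih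
    obtain ⟨M₁, h₁⟩ := exists_derivBound (hs true) (hc true) (k + 1)
    obtain ⟨M₂, h₂⟩ := exists_derivBound (hs false) (hc false) (k + 1)
    set A := max M₁ M₂
    have hA : ∀ b x, ‖iteratedFDeriv ℝ (k + 1) (s b) x‖ ≤ A := by
      rintro (_ | _) x
      · exact (h₂ _ le_rfl x).trans (le_max_right _ _)
      · exact (h₁ _ le_rfl x).trans (le_max_left _ _)
    have hA0 : 0 ≤ A := (norm_nonneg _).trans (hA true 0)
    set M' := (1 + R ^ 2) * (M + B)
    have hMM' : M ≤ M' := by simp only [M']; nlinarith [mul_nonneg (sq_nonneg R) (add_nonneg hM0 hB0)]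
    have hBM' : (1 + R ^ 2) * B ≤ M' := by simp only [M']; nlinarith [mul_nonneg (sq_nonneg R) hM0]
    have hMM'' : (1 + R ^ 2) * M ≤ M' := by simp only [M']; nlinarith [mul_nonneg (sq_nonneg R) hB0]
    obtain ⟨C, hC0, hC⟩ := exists_norm_iteratedFDeriv_advect_le (k + 1) (hM0.trans hMM')
    set K := C * (2 + R ^ 2)
    have hK : 0 ≤ K := by positivity
    have key : ∀ h, 0 ≤ h → h ≤ 1 → ∀ n : ℕ, n * h ≤ τ → ∀ b x,
        ‖iteratedFDeriv ℝ (k + 1) (euler h s n b) x‖ ≤ (1 + A) * Real.exp (K * (n * h)) - 1 := by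
      intro h h0 h1 n
      induction n with
      | zero => intro _ b x; simpa [euler] using hA b x
      | succ n ih =>
        intro hn b x
        push_cast at hn
        have hn' : n * h ≤ τ := by nlinarith
        have ih := ih hn'
        set Y := (1 + A) * Real.exp (K * (n * h)) - 1
        have hY : 0 ≤ Y := (norm_nonneg _).trans (ih b x)
        have hes := smooth_euler hs hc h0 n
        have hv := smooth_velocity hes (hR h h0 n hn') b
        have hvM := DerivBound.velocity hes (hR h h0 n hn') (hM h h0 h1 n hn') b
        refine (hC h0 h1 (hes b) hv (a := Y) (b := (1 + R ^ 2) * Y) (fun j hj y =>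
          (hM h h0 h1 n hn' b j (by omega) y).trans hMM') (fun j hj y =>
          (hvM j (by omega) y).trans hMM'') (fun y => ?_) (ih b) (fun y => ?_) x).trans ?_
        · have := norm_iteratedFDeriv_velocity_le (j := 1) hes (hR h h0 n hn')
            (fun b x => by rw [norm_iteratedFDeriv_one]; exact hB h h0 n hn' b x) b y
          rw [norm_iteratedFDeriv_one] at this
          exact this.trans hBM'
        · exact norm_iteratedFDeriv_velocity_le hes (hR h h0 n hn') ih b y
        · have e1 : K * ((n + 1 : ℕ) * h) = K * (n * h) + K * h := by push_cast; ring
          rw [e1, Real.exp_add, ← mul_assoc,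
            show (1 + A) * Real.exp (K * (n * h)) = 1 + Y by simp only [Y]; ring]
          have h2 := mul_le_mul_of_nonneg_left (Real.add_one_le_exp (K * h))
            (by linarith : 0 ≤ 1 + Y)
          have h4 : 0 ≤ C * h * (1 + R ^ 2) := by positivity
          simp only [K] at h2 ⊢
          nlinarith
    set Z := (1 + A) * Real.exp (K * τ)
    refine ⟨M + Z, by positivity, fun h h0 h1 n hn b => ?_⟩
    refine ((hM h h0 h1 n hn b).mono (le_add_of_nonneg_right (by positivity))).succ_of_le
      fun x => ?_
    have h5 : (1 + A) * Real.exp (K * (n * h)) ≤ Z := by simp only [Z]; gcongr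
    linarith [key h h0 h1 n hn b x]

end

end

section

open Metric
open scoped Convolution

theorem velocity_sub {s s' : Bool → Plane → ℝ} {R : ℝ} (hs : ∀ b, Smooth (s b))
    (hs' : ∀ b, Smooth (s' b)) (hR : ∀ b, SuppIn R (s b)) (hR' : ∀ b, SuppIn R (s' b)) (b : Bool)
    (x : Plane) : velocity s b x - velocity s' b x = velocity (fun b x => s b x - s' b x) b x := by
  have h1 := (hR (!b)).hasCompactSupport.convolutionExists_right (orient b • bsL)
    locallyIntegrable_bsKernel (hs _).continuous x
  have h2 := (hR' (!b)).hasCompactSupport.convolutionExists_right (orient b • bsL)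
    locallyIntegrable_bsKernel (hs' _).continuous x
  rw [velocity_eq_convolution, velocity_eq_convolution, velocity_eq_convolution, convolution,
    convolution, convolution, ← integral_sub h1 h2]
  simp only [map_sub]

theorem SuppIn.sub {f g : Plane → ℝ} {R : ℝ} (hf : SuppIn R f) (hg : SuppIn R g) :
    SuppIn R (fun x => f x - g x) := fun x hx => by simp [hf x hx, hg x hx]

section

variable {s : Bool → Plane → ℝ}

/-- The rate of change of the scalars of the pair `s`. -/
def rate (s : Bool → Plane → ℝ) (b : Bool) (x : Plane) : ℝ := fderiv ℝ (s b) x (velocity s b x)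

theorem exists_euler_increment (hs : ∀ b, Smooth (s b)) (hc : ∀ b, HasCompactSupport (s b))
    (τ : ℝ) (k : ℕ) : ∃ C, 0 ≤ C ∧ ∀ h, 0 ≤ h → h ≤ 1 → ∀ j n : ℕ, j ≤ n → n * h ≤ τ → ∀ b,
      DerivBound k (C * ((n - j) * h)) (fun x => euler h s n b x - euler h s j b x) := by
  obtain ⟨R, hR0, hR⟩ := exists_suppIn_euler hs hc τ
  obtain ⟨M, hM0, hM⟩ := exists_derivBound_euler hs hc τ (k + 1)
  have hle : M ≤ (1 + R ^ 2) * M := by nlinarith [mul_nonneg (sq_nonneg R) hM0]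
  obtain ⟨C, hC0, hC⟩ := exists_derivBound_advect_sub k (hM0.trans hle)
  refine ⟨C, hC0, fun h h0 h1 j n hjn => ?_⟩
  induction n, hjn using Nat.le_induction with
  | base =>
    intro _ b i _ x
    have : (fun x => euler h s j b x - euler h s j b x) = fun _ => 0 := by simp
    rw [this, iteratedFDeriv_fun_zero]
    simp
  | succ n hjn ih =>
    intro hn b
    push_cast at hn
    have hn' : n * h ≤ τ := by nlinarith
    have hes := smooth_euler hs hc h0 n
    have hej := smooth_euler hs hc h0 j b
    have hv := smooth_velocity hes (hR h h0 n hn') b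
    have h2 := hC h0 h1 (hes b) hv ((hM h h0 h1 n hn' b).mono hle)
      (DerivBound.velocity hes (hR h h0 n hn') (fun b => (hM h h0 h1 n hn' b).mono_left k.le_succ) b)
    have h3 := h2.add (((hes b).advect hv).sub (hes b)) ((hes b).sub hej) (ih hn' b)
    have e : (fun x => euler h s (n + 1) b x - euler h s j b x) = fun x =>
        (advect h (velocity (euler h s n) b) (euler h s n b) x - euler h s n b x) +
        (euler h s n b x - euler h s j b x) := by
      ext1 x
      simp [euler]
    rw [e]
    refine h3.mono (le_of_eq ?_)
    push_cast
    ring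

theorem exists_rate_increment (hs : ∀ b, Smooth (s b)) (hc : ∀ b, HasCompactSupport (s b))
    (τ : ℝ) : ∃ C, 0 ≤ C ∧ ∀ h, 0 ≤ h → h ≤ 1 → ∀ j n : ℕ, j ≤ n → n * h ≤ τ → ∀ b x,
      ‖rate (euler h s n) b x - rate (euler h s j) b x‖ ≤ C * ((n - j) * h) := by
  obtain ⟨R, hR0, hR⟩ := exists_suppIn_euler hs hc τ
  obtain ⟨M, hM0, hM⟩ := exists_derivBound_euler hs hc τ 1
  obtain ⟨C, hC0, hC⟩ := exists_euler_increment hs hc τ 1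
  refine ⟨C * ((1 + R ^ 2) * M) + M * ((1 + R ^ 2) * C), by positivity, ?_⟩
  intro h h0 h1 j n hjn hn b x
  have hjn' : (j : ℝ) ≤ n := by exact_mod_cast hjn
  have hd : 0 ≤ ((n : ℝ) - j) * h := mul_nonneg (by linarith) h0
  have hj : j * h ≤ τ := (mul_le_mul_of_nonneg_right hjn' h0).trans hn
  have sn := smooth_euler hs hc h0 n
  have sj := smooth_euler hs hc h0 j
  have bn := hC h h0 h1 j n hjn hn
  have e1 : ‖fderiv ℝ (euler h s n b) x - fderiv ℝ (euler h s j b) x‖ ≤ C * ((n - j) * h) := by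
    rw [← fderiv_fun_sub ((sn b).differentiable x) ((sj b).differentiable x)]
    exact (bn b).norm_fderiv_le x
  have e2 : ‖velocity (euler h s n) b x‖ ≤ (1 + R ^ 2) * M :=
    (DerivBound.velocity sn (hR h h0 n hn) (hM h h0 h1 n hn) b).norm_le x
  have e3 : ‖velocity (euler h s n) b x - velocity (euler h s j) b x‖ ≤
      (1 + R ^ 2) * (C * ((n - j) * h)) := by
    rw [velocity_sub sn sj (hR h h0 n hn) (hR h h0 j hj)]
    exact (DerivBound.velocity (fun b => (sn b).sub (sj b))
      (fun b => (hR h h0 n hn b).sub (hR h h0 j hj b)) bn b).norm_le x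
  have e4 : ‖fderiv ℝ (euler h s j b) x‖ ≤ M := (hM h h0 h1 j hj b).norm_fderiv_le x
  have split : rate (euler h s n) b x - rate (euler h s j) b x =
      (fderiv ℝ (euler h s n b) x - fderiv ℝ (euler h s j b) x) (velocity (euler h s n) b x) +
      fderiv ℝ (euler h s j b) x (velocity (euler h s n) b x - velocity (euler h s j) b x) := by
    simp only [rate, map_sub, sub_apply]
    ring
  rw [split]
  refine (norm_add_le _ _).trans ?_
  refine (add_le_add ((ContinuousLinearMap.le_opNorm _ _).trans
    (mul_le_mul e1 e2 (norm_nonneg _) (by positivity)))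
    ((ContinuousLinearMap.le_opNorm _ _).trans
    (mul_le_mul e4 e3 (norm_nonneg _) (by positivity)))).trans (le_of_eq ?_)
  ring

theorem exists_euler_taylor (hs : ∀ b, Smooth (s b)) (hc : ∀ b, HasCompactSupport (s b))
    (τ : ℝ) : ∃ C, 0 ≤ C ∧ ∀ h, 0 ≤ h → h ≤ 1 → ∀ j n : ℕ, j ≤ n → n * h ≤ τ → ∀ i, i = j ∨ i = n →
      ∀ b x, ‖euler h s n b x - euler h s j b x - ((n - j) * h) * rate (euler h s i) b x‖ ≤
        C * ((n - j) * h) * ((n - j) * h + h) := by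
  obtain ⟨R, hR0, hR⟩ := exists_suppIn_euler hs hc τ
  obtain ⟨M, hM0, hM⟩ := exists_derivBound_euler hs hc τ 2
  obtain ⟨C, hC0, hC⟩ := exists_rate_increment hs hc τ
  set M' := (1 + R ^ 2) * M
  have hle : M ≤ M' := by simp only [M']; nlinarith [mul_nonneg (sq_nonneg R) hM0]
  set K := M' * M' ^ 2
  have hK : 0 ≤ K := by positivity
  have key : ∀ h, 0 ≤ h → h ≤ 1 → ∀ j n : ℕ, j ≤ n → n * h ≤ τ →
      ∀ b x, ‖euler h s n b x - euler h s j b x - ((n - j) * h) * rate (euler h s j) b x‖ ≤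
        ((n - j) * h) * (C * ((n - j) * h) + K * h) := by
    intro h h0 h1 j n hjn
    induction n, hjn using Nat.le_induction with
    | base => intro _ b x; simp
    | succ n hjn ih =>
      intro hn b x
      push_cast at hn
      have hn' : n * h ≤ τ := by nlinarith
      have hes := smooth_euler hs hc h0 n
      have h2 := norm_advect_sub_sub_le h0 (hes b) ((hM h h0 h1 n hn' b).mono hle)
        (DerivBound.velocity hes (hR h h0 n hn') (hM h h0 h1 n hn') b).norm_le x
      have h3 := hC h h0 h1 j n hjn hn' b x
      have h4 := ih hn' b x
      have hjn' : (j : ℝ) ≤ n := by exact_mod_cast hjn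
      have hd : 0 ≤ ((n : ℝ) - j) * h := mul_nonneg (by linarith) h0
      have split : euler h s (n + 1) b x - euler h s j b x -
          (((n + 1 : ℕ) - j) * h) * rate (euler h s j) b x =
          (advect h (velocity (euler h s n) b) (euler h s n b) x - euler h s n b x -
            h * fderiv ℝ (euler h s n b) x (velocity (euler h s n) b x)) +
          (euler h s n b x - euler h s j b x - ((n - j) * h) * rate (euler h s j) b x) +
          h * (rate (euler h s n) b x - rate (euler h s j) b x) := by
        simp only [rate, euler]
        push_cast
        ring
      rw [split]
      refine (norm_add₃_le).trans ?_
      rw [norm_mul, Real.norm_of_nonneg h0]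
      have h5 := mul_le_mul_of_nonneg_left h3 h0
      push_cast
      have : 0 ≤ C * (((n : ℝ) - j) * h) * h := by positivity
      have : 0 ≤ C * (h * h) := by positivity
      nlinarith
  refine ⟨2 * C + K, by positivity, ?_⟩
  intro h h0 h1 j n hjn hn i hi b x
  have hjn' : (j : ℝ) ≤ n := by exact_mod_cast hjn
  have hd : 0 ≤ ((n : ℝ) - j) * h := mul_nonneg (by linarith) h0
  have hj := key h h0 h1 j n hjn hn b x
  set d := ((n : ℝ) - j) * h
  have hdh : 0 ≤ d * h := mul_nonneg hd h0
  have hKd : 0 ≤ K * (d * d) := by positivity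
  have hCd : 0 ≤ C * (d * d) := by positivity
  have hCdh : 0 ≤ C * (d * h) := by positivity
  rcases hi with rfl | rfl
  · exact hj.trans (by nlinarith)
  · have h3 := mul_le_mul_of_nonneg_left (hC h h0 h1 j i hjn hn b x) hd
    have split : euler h s i b x - euler h s j b x - d * rate (euler h s i) b x =
      (euler h s i b x - euler h s j b x - d * rate (euler h s j) b x) -
      d * (rate (euler h s i) b x - rate (euler h s j) b x) := by ring
    rw [split]
    refine (norm_sub_le _ _).trans ?_
    rw [norm_mul, Real.norm_of_nonneg hd]
    nlinarith

end

end

section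

open Metric Filter
open scoped Convolution Topology

section

variable {F : Type} [NormedAddCommGroup F] [NormedSpace ℝ F]

/-- A sequence of time-dependent smooth functions, bounded with all its space derivatives and
asymptotically Lipschitz in time, locally uniformly in time. -/
structure Compatible (f : ℕ → ℝ → Plane → F) : Prop where
  smooth : ∀ m t, 0 ≤ t → Smooth (f m t)
  bound : ∀ τ k, ∃ C, 0 ≤ C ∧ ∀ m t, 0 ≤ t → t ≤ τ → DerivBound k C (f m t)
  lip : ∀ τ k, ∃ C, 0 ≤ C ∧ ∀ (m : ℕ) (s t : ℝ), 0 ≤ s → s ≤ t → t ≤ τ →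
    DerivBound k (C * (t - s + 1 / (m + 1))) (fun x => f m t x - f m s x)

theorem Compatible.fderiv {f : ℕ → ℝ → Plane → F} (hf : Compatible f) :
    Compatible fun m t => fderiv ℝ (f m t) where
  smooth m t ht := (hf.smooth m t ht).fderiv
  bound τ k := by
    obtain ⟨C, h0, hC⟩ := hf.bound τ (k + 1)
    exact ⟨C, h0, fun m t h1 h2 => (hC m t h1 h2).fderiv⟩
  lip τ k := by
    obtain ⟨C, h0, hC⟩ := hf.lip τ (k + 1)
    refine ⟨C, h0, fun m s t h1 h2 h3 => ?_⟩
    have := (hC m s t h1 h2 h3).fderiv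
    have e : _root_.fderiv ℝ (fun x => f m t x - f m s x) =
        fun x => _root_.fderiv ℝ (f m t) x - _root_.fderiv ℝ (f m s) x := by
      ext1 x
      exact fderiv_fun_sub ((hf.smooth m t (h1.trans h2)).differentiable x)
        ((hf.smooth m s h1).differentiable x)
    rwa [e] at this

/-- The pointwise limit of a sequence of functions along a fixed nonprincipal ultrafilter. -/
def ultraLim (f : ℕ → ℝ → Plane → F) (t : ℝ) (x : Plane) : F :=
  limUnder (hyperfilter ℕ : Filter ℕ) fun m => f m t x

theorem tendsto_clm_apply {ι E G : Type*} [NormedAddCommGroup E] [NormedSpace ℝ E]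
    [NormedAddCommGroup G] [NormedSpace ℝ G] {l : Filter ι} {A : ι → E →L[ℝ] G} {v : ι → E}
    {A₀ : E →L[ℝ] G} {v₀ : E} (hA : Tendsto A l (𝓝 A₀)) (hv : Tendsto v l (𝓝 v₀)) :
    Tendsto (fun i => A i (v i)) l (𝓝 (A₀ v₀)) :=
  (isBoundedBilinearMap_apply.continuous.tendsto (A₀, v₀)).comp (hA.prodMk_nhds hv)

theorem tendsto_one_div_hyperfilter :
    Tendsto (fun m : ℕ => 1 / ((m : ℝ) + 1)) (hyperfilter ℕ) (𝓝 0) :=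
  tendsto_one_div_add_atTop_nhds_zero_nat.mono_left (Nat.hyperfilter_le_atTop)

namespace Compatible

variable [FiniteDimensional ℝ F] {f : ℕ → ℝ → Plane → F}

theorem tendsto (hf : Compatible f) {t : ℝ} (ht : 0 ≤ t) (x : Plane) :
    Tendsto (fun m => f m t x) (hyperfilter ℕ) (𝓝 (ultraLim f t x)) := by
  obtain ⟨C, -, hC⟩ := hf.bound t 0
  have := FiniteDimensional.proper ℝ F
  have hmem : closedBall (0 : F) C ∈ (hyperfilter ℕ).map (fun m => f m t x) := by
    rw [Ultrafilter.mem_map]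
    exact Filter.univ_mem' fun m => by simpa using (hC m t ht le_rfl).norm_le x
  obtain ⟨y, -, hy⟩ := (isCompact_closedBall (0 : F) C).ultrafilter_le_nhds' _ hmem
  exact tendsto_nhds_limUnder ⟨y, hy⟩

theorem norm_ultraLim_sub_le (hf : Compatible f) (τ : ℝ) : ∃ C, 0 ≤ C ∧ ∀ s t, 0 ≤ s → s ≤ t →
    t ≤ τ → ∀ x, ‖ultraLim f t x - ultraLim f s x‖ ≤ C * (t - s) := by
  obtain ⟨C, h0, hC⟩ := hf.lip τ 0
  refine ⟨C, h0, fun s t h1 h2 h3 x => ?_⟩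
  have hr : Tendsto (fun m : ℕ => C * (t - s + 1 / ((m : ℝ) + 1))) (hyperfilter ℕ)
      (𝓝 (C * (t - s + 0))) := (tendsto_one_div_hyperfilter.const_add _).const_mul _
  rw [add_zero] at hr
  exact le_of_tendsto_of_tendsto' ((hf.tendsto (h1.trans h2) x).sub (hf.tendsto h1 x)).norm hr
    fun m => (hC m s t h1 h2 h3).norm_le x

theorem norm_ultraLim_sub_le_abs (hf : Compatible f) (τ : ℝ) : ∃ C, 0 ≤ C ∧ ∀ s t, 0 ≤ s → 0 ≤ t →
    s ≤ τ → t ≤ τ → ∀ x, ‖ultraLim f t x - ultraLim f s x‖ ≤ C * |t - s| := by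
  obtain ⟨C, h0, hC⟩ := hf.norm_ultraLim_sub_le τ
  refine ⟨C, h0, fun s t h1 h2 h3 h4 x => ?_⟩
  rcases le_total s t with h | h
  · rw [abs_of_nonneg (by linarith)]
    exact hC s t h1 h h4 x
  · rw [abs_of_nonpos (by linarith), neg_sub, norm_sub_rev]
    exact hC t s h2 h h3 x

theorem hasFDerivAt (hf : Compatible f) {t : ℝ} (ht : 0 ≤ t) (x : Plane) :
    HasFDerivAt (ultraLim f t) (ultraLim (fun m t => _root_.fderiv ℝ (f m t)) t x) x := by
  obtain ⟨C, h0, hC⟩ := hf.bound t 2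
  have hm : ∀ m y, ‖f m t y - f m t x - _root_.fderiv ℝ (f m t) x (y - x)‖ ≤ C * ‖y - x‖ ^ 2 := by
    intro m y
    have hs := hf.smooth m t ht
    have hvar : ∀ z ∈ closedBall x ‖y - x‖,
        ‖_root_.fderiv ℝ (f m t) z - _root_.fderiv ℝ (f m t) x‖ ≤ C * ‖y - x‖ := by
      intro z hz
      refine (convex_univ.norm_image_sub_le_of_norm_fderiv_le (𝕜 := ℝ)
        (fun y _ => hs.fderiv.differentiable y)
        (fun y _ => (hC m t ht le_rfl).fderiv.norm_fderiv_le y) (mem_univ x) (mem_univ z)).trans ?_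
      gcongr
      rwa [← dist_eq_norm]
    have := (convex_closedBall x ‖y - x‖).norm_image_sub_le_of_norm_hasFDerivWithin_le'
      (f := f m t) (f' := _root_.fderiv ℝ (f m t)) (φ := _root_.fderiv ℝ (f m t) x)
      (fun y _ => (hs.differentiable y).hasFDerivAt.hasFDerivWithinAt) hvar
      (mem_closedBall_self (by positivity)) (by rw [mem_closedBall, dist_eq_norm] : y ∈ _)
    exact this.trans (le_of_eq (by ring))
  have hlim : ∀ y, ‖ultraLim f t y - ultraLim f t x -
      ultraLim (fun m t => _root_.fderiv ℝ (f m t)) t x (y - x)‖ ≤ C * ‖y - x‖ ^ 2 := fun y =>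
    le_of_tendsto' (((hf.tendsto ht y).sub (hf.tendsto ht x)).sub
      (tendsto_clm_apply (hf.fderiv.tendsto ht x) tendsto_const_nhds)).norm fun m => hm m y
  refine HasFDerivAt.of_isLittleO ?_
  refine (Asymptotics.IsBigO.of_bound C (.of_forall fun y => ?_)).trans_isLittleO
    (Asymptotics.isLittleO_pow_sub_sub x one_lt_two)
  rw [norm_pow, norm_norm]
  exact hlim y

theorem fderiv_ultraLim (hf : Compatible f) {t : ℝ} (ht : 0 ≤ t) :
    _root_.fderiv ℝ (ultraLim f t) = ultraLim (fun m t => _root_.fderiv ℝ (f m t)) t :=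
  funext fun x => (hf.hasFDerivAt ht x).fderiv

theorem differentiable_ultraLim (hf : Compatible f) {t : ℝ} (ht : 0 ≤ t) :
    Differentiable ℝ (ultraLim f t) :=
  fun x => (hf.hasFDerivAt ht x).differentiableAt

theorem continuousOn_ultraLim (hf : Compatible f) :
    ContinuousOn (fun p : ℝ × Plane => ultraLim f p.1 p.2) (Ioi 0 ×ˢ univ) := by
  rintro ⟨t, x⟩ ⟨ht, -⟩
  have ht : 0 < t := ht
  refine ContinuousAt.continuousWithinAt ?_
  obtain ⟨C, h0, hC⟩ := hf.norm_ultraLim_sub_le_abs (t + 1)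
  rw [ContinuousAt, tendsto_iff_norm_sub_tendsto_zero]
  have h1 : Tendsto (fun p : ℝ × Plane => C * |p.1 - t| + ‖ultraLim f t p.2 - ultraLim f t x‖)
      (𝓝 (t, x)) (𝓝 (C * |t - t| + ‖ultraLim f t x - ultraLim f t x‖)) := by
    have hc := (hf.differentiable_ultraLim ht.le).continuous
    have : Continuous fun p : ℝ × Plane => C * |p.1 - t| + ‖ultraLim f t p.2 - ultraLim f t x‖ := by
      fun_prop
    exact this.tendsto (t, x)
  simp only [sub_self, abs_zero, mul_zero, norm_zero, add_zero] at h1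
  refine squeeze_zero' (.of_forall fun _ => norm_nonneg _) ?_ h1
  have hev : ∀ᶠ p : ℝ × Plane in 𝓝 (t, x), 0 < p.1 ∧ p.1 < t + 1 :=
    (continuous_fst.tendsto (t, x)).eventually (Ioo_mem_nhds ht (by linarith))
  filter_upwards [hev] with p hp
  have := hC t p.1 ht.le hp.1.le (by linarith) hp.2.le p.2
  have h3 : ultraLim f p.1 p.2 - ultraLim f t x = (ultraLim f p.1 p.2 - ultraLim f t p.2) +
      (ultraLim f t p.2 - ultraLim f t x) := by abel
  rw [h3]
  exact (norm_add_le _ _).trans (add_le_add_left this _)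

end Compatible

end

theorem Compatible.tendsto_biotSavart {f : ℕ → ℝ → Plane → ℝ} (hf : Compatible f) {t R : ℝ}
    (ht : 0 ≤ t) (hR : ∀ m, SuppIn R (f m t)) (x : Plane) :
    Tendsto (fun m => biotSavart (f m t) x) (hyperfilter ℕ) (𝓝 (biotSavart (ultraLim f t) x)) := by
  have hRl : SuppIn R (ultraLim f t) := fun y hy => by
    have := hf.tendsto ht y
    simp only [hR _ y hy] at this
    exact tendsto_nhds_unique this tendsto_const_nhds |>.symm ▸ rfl
  obtain ⟨C, h0, hC⟩ := hf.bound t 1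
  have hlip : ∀ m y z, ‖f m t y - f m t z‖ ≤ C * ‖y - z‖ := fun m y z =>
    convex_univ.norm_image_sub_le_of_norm_fderiv_le (𝕜 := ℝ)
      (fun y _ => (hf.smooth m t ht).differentiable y)
      (fun y _ => (hC m t ht le_rfl).norm_fderiv_le y) (mem_univ z) (mem_univ y)
  have hlipl : ∀ y z, ‖ultraLim f t y - ultraLim f t z‖ ≤ C * ‖y - z‖ := fun y z =>
    le_of_tendsto' ((hf.tendsto ht y).sub (hf.tendsto ht z)).norm fun m => hlip m y z
  have hunif : ∀ ε > 0, ∀ᶠ m in (hyperfilter ℕ : Filter ℕ), ∀ y,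
      ‖f m t y - ultraLim f t y‖ ≤ ε := by
    intro ε hε
    set δ := ε / (3 * (C + 1))
    have hδ : 0 < δ := by positivity
    have hCδ : C * δ ≤ ε / 3 := by
      simp only [δ]
      rw [mul_div_assoc', div_le_div_iff₀ (by positivity) (by norm_num)]
      nlinarith
    obtain ⟨T, -, hT, hcov⟩ := finite_cover_balls_of_compact
      (isCompact_closedBall (0 : Plane) R) hδ
    have hev : ∀ᶠ m in (hyperfilter ℕ : Filter ℕ), ∀ z ∈ T, ‖f m t z - ultraLim f t z‖ < ε / 3 := by
      refine (Filter.eventually_all_finite hT).2 fun z _ => ?_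
      have := (tendsto_iff_norm_sub_tendsto_zero.1 (hf.tendsto ht z)).eventually
        (gt_mem_nhds (by positivity : (0 : ℝ) < ε / 3))
      exact this
    filter_upwards [hev] with m hm y
    rcases lt_or_ge R ‖y‖ with hy | hy
    · rw [hR m y hy, hRl y hy]
      simpa using hε.le
    · obtain ⟨z, hz, hyz⟩ := mem_iUnion₂.1 (hcov (mem_closedBall_zero_iff.2 hy))
      have hyz : ‖y - z‖ ≤ δ := by
        rw [← dist_eq_norm]
        exact hyz.le
      have e : f m t y - ultraLim f t y = (f m t y - f m t z) + (f m t z - ultraLim f t z) +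
        (ultraLim f t z - ultraLim f t y) := by ring
      rw [e]
      refine norm_add₃_le.trans ?_
      have h1 := (hlip m y z).trans (mul_le_mul_of_nonneg_left hyz h0)
      have h2 := (hlipl z y).trans
        (mul_le_mul_of_nonneg_left ((norm_sub_rev z y).trans_le hyz) h0)
      linarith [hm z hz]
  rw [tendsto_iff_norm_sub_tendsto_zero]
  refine tendsto_order.2 ⟨fun a ha => .of_forall fun m => ha.trans_le (norm_nonneg _),
    fun a ha => ?_⟩
  filter_upwards [hunif (a / (2 * (1 + R ^ 2))) (by positivity)] with m hm
  have hcl : Continuous (ultraLim f t) := (hf.differentiable_ultraLim ht).continuous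
  have h1 := (hR m).hasCompactSupport.convolutionExists_right bsL
    locallyIntegrable_bsKernel (hf.smooth m t ht).continuous x
  have h2 := hRl.hasCompactSupport.convolutionExists_right bsL
    locallyIntegrable_bsKernel hcl x
  have e : biotSavart (f m t) x - biotSavart (ultraLim f t) x =
      (bsKernel ⋆[bsL] fun y => f m t y - ultraLim f t y) x := by
    rw [biotSavart_eq_convolution, biotSavart_eq_convolution, convolution, convolution,
      convolution, ← integral_sub h1 h2]
    simp only [map_sub]
  rw [e]
  refine (norm_bsKernel_convolution_le bsL hm ((hR m).sub hRl) x).trans_lt ?_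
  calc ‖bsL‖ * (1 + R ^ 2) * (a / (2 * (1 + R ^ 2)))
      ≤ 1 * (1 + R ^ 2) * (a / (2 * (1 + R ^ 2))) := by
        gcongr
        exact norm_bsL_le
    _ = a / 2 := by field_simp
    _ < a := by linarith

/-- The Euler approximations as functions of time. -/
def eulerFamily (s : Bool → Plane → ℝ) (b : Bool) (m : ℕ) (t : ℝ) : Plane → ℝ :=
  euler (1 / (m + 1)) s ⌊t * (m + 1)⌋₊ b

section

variable {s : Bool → Plane → ℝ}

theorem floor_step {m : ℕ} {t : ℝ} (ht : 0 ≤ t) :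
    (⌊t * (m + 1)⌋₊ : ℝ) * (1 / (m + 1)) ≤ t ∧ t < (⌊t * (m + 1)⌋₊ : ℝ) * (1 / (m + 1)) + 1 / (m + 1) := by
  have hm : (0 : ℝ) < m + 1 := by positivity
  have h1 := Nat.floor_le (mul_nonneg ht hm.le)
  have h2 := Nat.lt_floor_add_one (t * (m + 1))
  constructor
  · rw [mul_one_div, div_le_iff₀ hm]
    exact h1
  · rw [mul_one_div, ← add_div, lt_div_iff₀ hm]
    exact h2

theorem one_div_succ_mem (m : ℕ) : 0 ≤ 1 / ((m : ℝ) + 1) ∧ 1 / ((m : ℝ) + 1) ≤ 1 :=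
  ⟨by positivity, by rw [div_le_one (by positivity)]; linarith [m.cast_nonneg (α := ℝ)]⟩

theorem exists_suppIn_eulerFamily (hs : ∀ b, Smooth (s b)) (hc : ∀ b, HasCompactSupport (s b))
    (τ : ℝ) : ∃ R, 0 ≤ R ∧ ∀ b m t, 0 ≤ t → t ≤ τ → SuppIn R (eulerFamily s b m t) := by
  obtain ⟨R, h0, hR⟩ := exists_suppIn_euler hs hc τ
  exact ⟨R, h0, fun b m t h1 h2 => hR _ (one_div_succ_mem m).1 _ ((floor_step h1).1.trans h2) b⟩

theorem compatible_eulerFamily (hs : ∀ b, Smooth (s b)) (hc : ∀ b, HasCompactSupport (s b))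
    (b : Bool) : Compatible (eulerFamily s b) where
  smooth m t ht := smooth_euler hs hc (one_div_succ_mem m).1 _ b
  bound τ k := by
    obtain ⟨M, h0, hM⟩ := exists_derivBound_euler hs hc τ k
    exact ⟨M, h0, fun m t h1 h2 => hM _ (one_div_succ_mem m).1 (one_div_succ_mem m).2 _
      ((floor_step h1).1.trans h2) b⟩
  lip τ k := by
    obtain ⟨M, h0, hM⟩ := exists_euler_increment hs hc τ k
    refine ⟨M, h0, fun m s t h1 h2 h3 => ?_⟩
    refine (hM _ (one_div_succ_mem m).1 (one_div_succ_mem m).2 ⌊s * (m + 1)⌋₊ ⌊t * (m + 1)⌋₊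
      (by gcongr) ((floor_step (h1.trans h2)).1.trans h3) b).mono ?_
    gcongr
    have e1 := (floor_step (m := m) h1).2
    have e2 := (floor_step (m := m) (h1.trans h2)).1
    linarith

/-- The solution of the system with initial data `s`. -/
def solution (s : Bool → Plane → ℝ) (b : Bool) : ℝ → Plane → ℝ := ultraLim (eulerFamily s b)

theorem exists_suppIn_solution (hs : ∀ b, Smooth (s b)) (hc : ∀ b, HasCompactSupport (s b))
    (τ : ℝ) : ∃ R, 0 ≤ R ∧ ∀ b t, 0 ≤ t → t ≤ τ → SuppIn R (solution s b t) := by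
  obtain ⟨R, h0, hR⟩ := exists_suppIn_eulerFamily hs hc τ
  refine ⟨R, h0, fun b t h1 h2 x hx => ?_⟩
  refine tendsto_nhds_unique ((compatible_eulerFamily hs hc b).tendsto h1 x) ?_
  simp only [hR b _ t h1 h2 x hx]
  exact tendsto_const_nhds

theorem tendsto_rate (hs : ∀ b, Smooth (s b)) (hc : ∀ b, HasCompactSupport (s b)) {t : ℝ}
    (ht : 0 ≤ t) (b : Bool) (x : Plane) :
    Tendsto (fun m => rate (fun b => eulerFamily s b m t) b x) (hyperfilter ℕ)
      (𝓝 (rate (fun b => solution s b t) b x)) := by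
  obtain ⟨R, h0, hR⟩ := exists_suppIn_eulerFamily hs hc t
  have h1 := (compatible_eulerFamily hs hc b).fderiv.tendsto ht x
  have h2 := (compatible_eulerFamily hs hc (!b)).tendsto_biotSavart ht
    (fun m => hR _ m t ht le_rfl) x
  rw [← (compatible_eulerFamily hs hc b).fderiv_ultraLim ht] at h1
  exact tendsto_clm_apply h1 (h2.const_smul _)

theorem hasDerivAt_solution (hs : ∀ b, Smooth (s b)) (hc : ∀ b, HasCompactSupport (s b)) {t : ℝ}
    (ht : 0 < t) (b : Bool) (x : Plane) :
    HasDerivAt (fun t => solution s b t x) (rate (fun b => solution s b t) b x) t := by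
  obtain ⟨C, h0, hC⟩ := exists_euler_taylor hs hc (t + 1)
  obtain ⟨B, hB0, hB⟩ := (compatible_eulerFamily hs hc b).lip (t + 1) 0
  have hcomp := compatible_eulerFamily hs hc b
  have hfl : ∀ r : ℝ, 0 ≤ r → Tendsto (fun m : ℕ => (⌊r * (m + 1)⌋₊ : ℝ) * (1 / ((m : ℝ) + 1)))
      (hyperfilter ℕ) (𝓝 r) := by
    intro r hr
    have h1 : Tendsto (fun m : ℕ => r - 1 / ((m : ℝ) + 1)) (hyperfilter ℕ) (𝓝 (r - 0)) :=
      tendsto_one_div_hyperfilter.const_sub r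
    rw [sub_zero] at h1
    exact tendsto_of_tendsto_of_tendsto_of_le_of_le h1 tendsto_const_nhds
      (fun m => by linarith [(floor_step (m := m) hr).2]) (fun m => (floor_step hr).1)
  have key : ∀ r₁ r₂, 0 ≤ r₁ → r₁ ≤ r₂ → r₂ ≤ t + 1 → ∀ r, r = r₁ ∨ r = r₂ →
      ‖solution s b r₂ x - solution s b r₁ x - (r₂ - r₁) * rate (fun b => solution s b r) b x‖ ≤
        C * (r₂ - r₁) * (r₂ - r₁) := by
    intro r₁ r₂ h1 h2 h3 r hr
    have hr0 : 0 ≤ r := by rcases hr with rfl | rfl <;> linarith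
    have hd := (hfl r₂ (h1.trans h2)).sub (hfl r₁ h1)
    have hL := (((hcomp.tendsto (h1.trans h2) x).sub (hcomp.tendsto h1 x)).sub
      (hd.mul (tendsto_rate hs hc hr0 b x))).norm
    have hRt := (hd.const_mul C).mul (hd.add tendsto_one_div_hyperfilter)
    rw [add_zero] at hRt
    refine le_of_tendsto_of_tendsto' hL hRt fun m => ?_
    have := hC _ (one_div_succ_mem m).1 (one_div_succ_mem m).2 ⌊r₁ * (m + 1)⌋₊ ⌊r₂ * (m + 1)⌋₊
      (by gcongr) ((floor_step (h1.trans h2)).1.trans h3) ⌊r * (m + 1)⌋₊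
      (by rcases hr with rfl | rfl <;> simp) b x
    rw [sub_mul] at this
    exact this
  have hev : ∀ᶠ r in 𝓝 t, ‖solution s b r x - solution s b t x -
      (r - t) • rate (fun b => solution s b t) b x‖ ≤ C * ‖‖r - t‖ ^ 2‖ := by
    filter_upwards [Ioo_mem_nhds ht (lt_add_one t)] with r hr
    rw [norm_pow, norm_norm, Real.norm_eq_abs, Real.norm_eq_abs, sq_abs, smul_eq_mul]
    rcases le_total t r with h | h
    · refine (key t r ht.le h hr.2.le t (Or.inl rfl)).trans (le_of_eq (by ring))
    · have := key r t hr.1.le h (by linarith) t (Or.inr rfl)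
      rw [Real.norm_eq_abs, ← abs_neg] at this
      refine le_trans (le_of_eq ?_) (this.trans (le_of_eq (by ring)))
      congr 1
      ring
  rw [hasDerivAt_iff_isLittleO]
  exact (Asymptotics.IsBigO.of_bound C hev).trans_isLittleO
    (Asymptotics.isLittleO_pow_sub_sub t one_lt_two)

end

end

section

open Metric Filter
open scoped Convolution Topology

/-- Joint regularity `C^n` on positive times of the space derivatives of order at most `k`. -/
def MixedSmooth (n : ℕ) : ℕ → ∀ {F : Type} [NormedAddCommGroup F] [NormedSpace ℝ F],
    (ℝ → Plane → F) → Prop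
  | 0, _, _, _, g => ContDiffOn ℝ n (fun p : ℝ × Plane => g p.1 p.2) (Ioi 0 ×ˢ univ)
  | k + 1, _, _, _, g => ContDiffOn ℝ n (fun p : ℝ × Plane => g p.1 p.2) (Ioi 0 ×ˢ univ) ∧
      (∀ t, 0 < t → Differentiable ℝ (g t)) ∧ MixedSmooth n k (fun t => fderiv ℝ (g t))

theorem isOpen_posTime : IsOpen (Ioi (0 : ℝ) ×ˢ (univ : Set Plane)) := isOpen_Ioi.prod isOpen_univ

namespace MixedSmooth

section

variable {F G H : Type} [NormedAddCommGroup F] [NormedSpace ℝ F] [NormedAddCommGroup G]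
  [NormedSpace ℝ G] [NormedAddCommGroup H] [NormedSpace ℝ H] {n k : ℕ}

theorem contDiffOn {g : ℝ → Plane → F} (hg : MixedSmooth n k g) :
    ContDiffOn ℝ n (fun p : ℝ × Plane => g p.1 p.2) (Ioi 0 ×ˢ univ) := by
  cases k with
  | zero => exact hg
  | succ k => exact hg.1

theorem continuous {g : ℝ → Plane → F} (hg : MixedSmooth n k g) {t : ℝ} (ht : 0 < t) :
    Continuous (g t) :=
  hg.contDiffOn.continuousOn.comp_continuous (f := fun x : Plane => (t, x)) (by fun_prop)
    fun x => ⟨ht, mem_univ x⟩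

theorem contDiff_one {g : ℝ → Plane → F} (hg : MixedSmooth n (k + 1) g) {t : ℝ} (ht : 0 < t) :
    ContDiff ℝ 1 (g t) :=
  contDiff_one_iff_fderiv.2 ⟨hg.2.1 t ht, hg.2.2.continuous ht⟩

end

theorem of_succ {n k : ℕ} : ∀ {F : Type} [NormedAddCommGroup F] [NormedSpace ℝ F]
    {g : ℝ → Plane → F}, MixedSmooth n (k + 1) g → MixedSmooth n k g := by
  induction k with
  | zero => intro F _ _ g h; exact h.1
  | succ k ih => intro F _ _ g h; exact ⟨h.1, h.2.1, ih h.2.2⟩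

theorem congr {n k : ℕ} : ∀ {F : Type} [NormedAddCommGroup F] [NormedSpace ℝ F]
    {g g' : ℝ → Plane → F}, MixedSmooth n k g → (∀ t, 0 < t → g' t = g t) →
    MixedSmooth n k g' := by
  induction k with
  | zero =>
    intro F _ _ g g' h e
    exact ContDiffOn.congr h fun p hp => by rw [e p.1 hp.1]
  | succ k ih =>
    intro F _ _ g g' h e
    exact ⟨h.1.congr fun p hp => by rw [e p.1 hp.1], fun t ht => by rw [e t ht]; exact h.2.1 t ht,
      ih h.2.2 fun t ht => by rw [e t ht]⟩

theorem add {n k : ℕ} : ∀ {F : Type} [NormedAddCommGroup F] [NormedSpace ℝ F]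
    {g g' : ℝ → Plane → F}, MixedSmooth n k g → MixedSmooth n k g' →
    MixedSmooth n k (fun t x => g t x + g' t x) := by
  induction k with
  | zero => intro F _ _ g g' h h'; exact ContDiffOn.add h h'
  | succ k ih =>
    intro F _ _ g g' h h'
    refine ⟨h.1.add h'.1, fun t ht => (h.2.1 t ht).add (h'.2.1 t ht), ?_⟩
    refine (ih h.2.2 h'.2.2).congr fun t ht => ?_
    ext1 x
    exact fderiv_fun_add (h.2.1 t ht x) (h'.2.1 t ht x)

theorem bilin {n k : ℕ} : ∀ {F G H : Type} [NormedAddCommGroup F] [NormedSpace ℝ F]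
    [NormedAddCommGroup G] [NormedSpace ℝ G] [NormedAddCommGroup H] [NormedSpace ℝ H]
    (B : F →L[ℝ] G →L[ℝ] H) {f : ℝ → Plane → F} {g : ℝ → Plane → G}, MixedSmooth n k f →
    MixedSmooth n k g → MixedSmooth n k (fun t x => B (f t x) (g t x)) := by
  have hbase : ∀ {F G H : Type} [NormedAddCommGroup F] [NormedSpace ℝ F]
    [NormedAddCommGroup G] [NormedSpace ℝ G] [NormedAddCommGroup H] [NormedSpace ℝ H]
    (B : F →L[ℝ] G →L[ℝ] H) {f : ℝ → Plane → F} {g : ℝ → Plane → G},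
    ContDiffOn ℝ n (fun p : ℝ × Plane => f p.1 p.2) (Ioi 0 ×ˢ univ) →
    ContDiffOn ℝ n (fun p : ℝ × Plane => g p.1 p.2) (Ioi 0 ×ˢ univ) →
    ContDiffOn ℝ n (fun p : ℝ × Plane => B (f p.1 p.2) (g p.1 p.2)) (Ioi 0 ×ˢ univ) := by
    intro F G H _ _ _ _ _ _ B f g hf hg
    exact B.isBoundedBilinearMap.contDiff.comp_contDiffOn (hf.prodMk hg)
  induction k with
  | zero => intro F G H _ _ _ _ _ _ B f g hf hg; exact hbase B hf hg
  | succ k ih =>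
    intro F G H _ _ _ _ _ _ B f g hf hg
    refine ⟨hbase B hf.1 hg.1, fun t ht x =>
      (B.hasFDerivAt_of_bilinear (hf.2.1 t ht x).hasFDerivAt
        (hg.2.1 t ht x).hasFDerivAt).differentiableAt, ?_⟩
    refine ((ih (B.precompR Plane) hf.of_succ hg.2.2).add
      (ih (B.precompL Plane) hf.2.2 hg.of_succ)).congr fun t ht => ?_
    ext1 x
    exact B.fderiv_of_bilinear (hf.2.1 t ht x) (hg.2.1 t ht x)

theorem convolution {n k : ℕ} : ∀ {F G : Type} [NormedAddCommGroup F] [NormedSpace ℝ F]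
    [NormedAddCommGroup G] [NormedSpace ℝ G] (L : Plane →L[ℝ] F →L[ℝ] G) {g : ℝ → Plane → F},
    (∀ τ, ∃ R, ∀ t, 0 < t → t < τ → SuppIn R (g t)) → MixedSmooth n k g →
    MixedSmooth n k (fun t => bsKernel ⋆[L] g t) := by
  have hbase : ∀ {F G : Type} [NormedAddCommGroup F] [NormedSpace ℝ F]
    [NormedAddCommGroup G] [NormedSpace ℝ G] (L : Plane →L[ℝ] F →L[ℝ] G) {g : ℝ → Plane → F},
    (∀ τ, ∃ R, ∀ t, 0 < t → t < τ → SuppIn R (g t)) →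
    ContDiffOn ℝ n (fun p : ℝ × Plane => g p.1 p.2) (Ioi 0 ×ˢ univ) →
    ContDiffOn ℝ n (fun p : ℝ × Plane => (bsKernel ⋆[L] g p.1) p.2) (Ioi 0 ×ˢ univ) := by
    intro F G _ _ _ _ L g hR hg
    rintro ⟨t, x⟩ ⟨ht, -⟩
    have ht : 0 < t := ht
    obtain ⟨R, hR⟩ := hR (t + 1)
    have := contDiffOn_convolution_right_with_param (μ := volume) (n := n) L (g := g)
      (s := Ioo 0 (t + 1)) (k := closedBall (0 : Plane) R) isOpen_Ioo (isCompact_closedBall _ _)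
      (fun r y hr hy => hR r hr.1 hr.2 y (by simpa using hy)) locallyIntegrable_bsKernel
      (hg.mono (prod_mono Ioo_subset_Ioi_self Subset.rfl))
    exact (this.contDiffAt ((isOpen_Ioo.prod isOpen_univ).mem_nhds
      ⟨⟨ht, lt_add_one t⟩, mem_univ x⟩)).contDiffWithinAt
  induction k with
  | zero => intro F G _ _ _ _ L g hR hg; exact hbase L hR hg
  | succ k ih =>
    intro F G _ _ _ _ L g hR hg
    refine ⟨hbase L hR hg.1, fun t ht x => ?_, ?_⟩
    · obtain ⟨R, hR⟩ := hR (t + 1)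
      exact (hasFDerivAt_bsKernel_convolution L (hg.contDiff_one ht)
        (hR t ht (lt_add_one t)) x).differentiableAt
    · refine (ih (L.precompR Plane) (fun τ => ?_) hg.2.2).congr fun t ht => ?_
      · obtain ⟨R, hR⟩ := hR τ
        exact ⟨R, fun t h1 h2 => (hR t h1 h2).fderiv⟩
      · obtain ⟨R, hR⟩ := hR (t + 1)
        exact fderiv_bsKernel_convolution L (hg.contDiff_one ht) (hR t ht (lt_add_one t))

end MixedSmooth

theorem Compatible.mixedSmooth {k : ℕ} : ∀ {F : Type} [NormedAddCommGroup F] [NormedSpace ℝ F]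
    [FiniteDimensional ℝ F] {f : ℕ → ℝ → Plane → F}, Compatible f →
    MixedSmooth 0 k (ultraLim f) := by
  induction k with
  | zero => intro F _ _ _ f hf; exact contDiffOn_zero.2 hf.continuousOn_ultraLim
  | succ k ih =>
    intro F _ _ _ f hf
    exact ⟨contDiffOn_zero.2 hf.continuousOn_ultraLim,
      fun t ht => hf.differentiable_ultraLim ht.le,
      (ih hf.fderiv).congr fun t ht => hf.fderiv_ultraLim ht.le⟩

section

variable {F : Type} [NormedAddCommGroup F] [NormedSpace ℝ F]

theorem hasDerivAt_fderiv_of_hasDerivAt [CompleteSpace F] {f g : ℝ → Plane → F}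
    (hfg : ∀ t, 0 < t → ∀ x, HasDerivAt (fun t => f t x) (g t x) t) (hf : MixedSmooth 0 1 f)
    (hg : MixedSmooth 0 1 g) {t : ℝ} (ht : 0 < t) (x : Plane) :
    HasDerivAt (fun t => fderiv ℝ (f t) x) (fderiv ℝ (g t) x) t := by
  have hgc : ∀ y, ContinuousOn (fun r => g r y) (Ioi 0) := fun y =>
    hg.contDiffOn.continuousOn.comp (f := fun r : ℝ => (r, y)) (by fun_prop)
      fun r hr => ⟨hr, mem_univ y⟩
  have hDg : ContinuousOn (fun p : ℝ × Plane => fderiv ℝ (g p.1) p.2) (Ioi 0 ×ˢ univ) :=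
    hg.2.2.contDiffOn.continuousOn
  have hDgc : ∀ y, ContinuousOn (fun r => fderiv ℝ (g r) y) (Ioi 0) := fun y =>
    hDg.comp (f := fun r : ℝ => (r, y)) (by fun_prop) fun r hr => ⟨hr, mem_univ y⟩
  have hsub : ∀ r, 0 < r → uIcc t r ⊆ Ioi 0 := fun r hr z hz =>
    (lt_min ht hr).trans_le hz.1
  have key : ∀ r, 0 < r → fderiv ℝ (f r) x = fderiv ℝ (f t) x + ∫ z in t..r, fderiv ℝ (g z) x := by
    intro r hr
    have hInt : ∀ y, ∫ z in t..r, g z y = f r y - f t y := fun y =>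
      intervalIntegral.integral_eq_sub_of_hasDerivAt (fun z hz => hfg z (hsub r hr hz) y)
        ((hgc y).mono (hsub r hr)).intervalIntegrable
    obtain ⟨C, hC⟩ := (isCompact_uIcc.prod (isCompact_closedBall x 1)).exists_bound_of_continuousOn
      (hDg.mono (prod_mono (hsub r hr) (subset_univ _)))
    have hd : HasFDerivAt (fun y => ∫ z in t..r, g z y) (∫ z in t..r, fderiv ℝ (g z) x) x := by
      refine intervalIntegral.hasFDerivAt_integral_of_dominated_of_fderiv_le (bound := fun _ => C)
        (F := fun y z => g z y) (F' := fun y z => fderiv ℝ (g z) y)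
        (closedBall_mem_nhds x one_pos) (.of_forall fun y => ?_)
        ((hgc x).mono (hsub r hr)).intervalIntegrable ?_ ?_ intervalIntegrable_const ?_
      · exact (((hgc y).mono (hsub r hr)).mono uIoc_subset_uIcc).aestronglyMeasurable
          measurableSet_uIoc
      · exact (((hDgc x).mono (hsub r hr)).mono uIoc_subset_uIcc).aestronglyMeasurable
          measurableSet_uIoc
      · exact .of_forall fun z hz y hy => hC (z, y) ⟨uIoc_subset_uIcc hz, hy⟩
      · exact .of_forall fun z hz y hy =>
          (hg.2.1 z (hsub r hr (uIoc_subset_uIcc hz)) y).hasFDerivAt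
    have hd2 : HasFDerivAt (fun y => ∫ z in t..r, g z y) (fderiv ℝ (f r) x - fderiv ℝ (f t) x) x := by
      simp only [hInt]
      exact (hf.2.1 r hr x).hasFDerivAt.sub (hf.2.1 t ht x).hasFDerivAt
    rw [hd.unique hd2]
    abel
  have hFTC : HasDerivAt (fun r => fderiv ℝ (f t) x + ∫ z in t..r, fderiv ℝ (g z) x)
      (fderiv ℝ (g t) x) t := by
    refine (intervalIntegral.integral_hasDerivAt_right ?_ ?_ ?_).const_add _
    · simp
    · exact (hDgc x).stronglyMeasurableAtFilter isOpen_Ioi t ht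
    · exact (hDgc x).continuousAt (isOpen_Ioi.mem_nhds ht)
  refine hFTC.congr_of_eventuallyEq ?_
  filter_upwards [isOpen_Ioi.mem_nhds ht] with r hr
  exact key r hr

theorem contDiffOn_succ_of_hasDerivAt {n : ℕ} {f g : ℝ → Plane → F}
    (hfg : ∀ t, 0 < t → ∀ x, HasDerivAt (fun t => f t x) (g t x) t) (hf : MixedSmooth n 1 f)
    (hg : MixedSmooth n 0 g) :
    ContDiffOn ℝ (n + 1) (fun p : ℝ × Plane => f p.1 p.2) (Ioi 0 ×ˢ univ) := by
  have h1 : ContDiffOn ℝ n (fun p : ℝ × Plane => ContinuousLinearMap.toSpanSingleton ℝ (g p.1 p.2))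
      (Ioi 0 ×ˢ univ) :=
    (ContinuousLinearMap.toSpanSingletonCLE (𝕜 := ℝ) (E := F)).contDiff.comp_contDiffOn hg
  have h2 : ContDiffOn ℝ n (fun p : ℝ × Plane => fderiv ℝ (f p.1) p.2) (Ioi 0 ×ˢ univ) :=
    hf.2.2.contDiffOn
  rw [contDiffOn_succ_iff_hasFDerivWithinAt_of_uniqueDiffOn isOpen_posTime.uniqueDiffOn]
  refine ⟨by simp, fun p => (ContinuousLinearMap.toSpanSingleton ℝ (g p.1 p.2)).coprod
    (fderiv ℝ (f p.1) p.2), ?_, fun p hp => ?_⟩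
  · have hc : ∀ p : ℝ × Plane, (ContinuousLinearMap.toSpanSingleton ℝ (g p.1 p.2)).coprod
        (fderiv ℝ (f p.1) p.2) =
        (ContinuousLinearMap.toSpanSingleton ℝ (g p.1 p.2)).comp (ContinuousLinearMap.fst ℝ ℝ Plane) +
        (fderiv ℝ (f p.1) p.2).comp (ContinuousLinearMap.snd ℝ ℝ Plane) := fun p => by
      ext <;> simp
    simp only [hc]
    exact (h1.clm_comp contDiffOn_const).add (h2.clm_comp contDiffOn_const)
  · have hev := isOpen_posTime.mem_nhds hp
    exact (hasStrictFDerivAt_uncurry_coprod (𝕜 := ℝ) (f := f)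
      (f₁ := fun t x => ContinuousLinearMap.toSpanSingleton ℝ (g t x))
      (f₂ := fun t x => fderiv ℝ (f t) x)
      (by filter_upwards [hev] with q hq using (hfg q.1 hq.1 q.2).hasFDerivAt)
      (by filter_upwards [hev] with q hq using (hf.2.1 q.1 hq.1 q.2).hasFDerivAt)
      (h1.continuousOn.continuousAt hev) (h2.continuousOn.continuousAt hev)).hasFDerivAt.hasFDerivWithinAt

end

theorem MixedSmooth.mono_zero {n k : ℕ} : ∀ {F : Type} [NormedAddCommGroup F] [NormedSpace ℝ F]
    {g : ℝ → Plane → F}, MixedSmooth n k g → MixedSmooth 0 k g := by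
  induction k with
  | zero => intro F _ _ g h; exact ContDiffOn.of_le h (by simp)
  | succ k ih => intro F _ _ g h; exact ⟨h.1.of_le (by simp), h.2.1, ih h.2.2⟩

theorem MixedSmooth.succ_of_hasDerivAt {n k : ℕ} : ∀ {F : Type} [NormedAddCommGroup F]
    [NormedSpace ℝ F] [CompleteSpace F] {f g : ℝ → Plane → F},
    (∀ t, 0 < t → ∀ x, HasDerivAt (fun t => f t x) (g t x) t) → (∀ j, MixedSmooth n j f) →
    (∀ j, MixedSmooth n j g) → MixedSmooth (n + 1) k f := by
  induction k with
  | zero =>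
    intro F _ _ _ f g hfg hf hg
    exact contDiffOn_succ_of_hasDerivAt hfg (hf 1) (hg 0)
  | succ k ih =>
    intro F _ _ _ f g hfg hf hg
    refine ⟨contDiffOn_succ_of_hasDerivAt hfg (hf 1) (hg 0), (hf 1).2.1, ?_⟩
    exact ih (fun t ht x => hasDerivAt_fderiv_of_hasDerivAt hfg (hf 1).mono_zero (hg 1).mono_zero ht x)
      (fun j => (hf (j + 1)).2.2) (fun j => (hg (j + 1)).2.2)

theorem contDiffOn_solution {s : Bool → Plane → ℝ} (hs : ∀ b, Smooth (s b))
    (hc : ∀ b, HasCompactSupport (s b)) (b : Bool) :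
    ContDiffOn ℝ (⊤ : ℕ∞) (fun p : ℝ × Plane => solution s b p.1 p.2) (Ioi 0 ×ˢ univ) := by
  have key : ∀ n k b, MixedSmooth n k (solution s b) := by
    intro n
    induction n with
    | zero => exact fun k b => (compatible_eulerFamily hs hc b).mixedSmooth
    | succ n ih =>
      intro k b
      refine MixedSmooth.succ_of_hasDerivAt (g := fun t => rate (fun b => solution s b t) b)
        (fun t ht x => hasDerivAt_solution hs hc ht b x) (fun j => ih j b) fun j => ?_
      have hv : MixedSmooth n j (fun t => velocity (fun b => solution s b t) b) := by
        simp only [velocity_eq_convolution]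
        refine MixedSmooth.convolution _ (fun τ => ?_) (ih j (!b))
        obtain ⟨R, -, hR⟩ := exists_suppIn_solution hs hc τ
        exact ⟨R, fun t h1 h2 => hR _ t h1.le h2.le⟩
      exact MixedSmooth.bilin (ContinuousLinearMap.id ℝ (Plane →L[ℝ] ℝ)) (ih (j + 1) b).2.2 hv
  exact contDiffOn_infty.2 fun n => (key n 0 b).contDiffOn

end

section

open Metric Filter
open scoped Convolution Topology NNReal

theorem biotSavart_translate (q : Plane → ℝ) (v x : Plane) :
    biotSavart (fun y => q (y + v)) x = biotSavart q (x + v) := by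
  rw [biotSavart, biotSavart,
    ← integral_add_right_eq_self (fun y => (q y / ‖x + v - y‖ ^ 2) • perp (x + v - y)) v]
  simp only [add_sub_add_right_eq_sub]

theorem exists_lipschitzWith_biotSavart {q : Plane → ℝ} (hq : Smooth q)
    (hc : HasCompactSupport q) : ∃ L, LipschitzWith L (biotSavart q) := by
  obtain ⟨R, -, hR⟩ := hc.exists_suppIn
  obtain ⟨M, hM⟩ := exists_derivBound hq hc 1
  have hv : velocity (fun _ => q) true = biotSavart q := by
    ext1 x
    simp [velocity, orient]
  rw [← hv]
  have hb := (DerivBound.velocity (s := fun _ => q) (fun _ => hq) (fun _ => hR)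
    (fun _ => hM) true)
  exact ⟨_, lipschitzWith_of_nnnorm_fderiv_le (smooth_velocity (s := fun _ => q) (fun _ => hq)
    (fun _ => hR) true).differentiable (C := ⟨_, hb.nonneg⟩) fun x => hb.norm_fderiv_le x⟩

/-- While `q` travels with velocity `-e` through the region where the velocity induced by `p` is
`-e`, and `p` vanishes where the velocity induced by `q` does not, the Euler scheme is exact. -/
theorem euler_eq_translate {p q : Plane → ℝ} {e : Plane} {D h : ℝ} {L : ℝ≥0}
    (hLp : LipschitzWith L (biotSavart p)) (hLq : LipschitzWith L (biotSavart q))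
    (h0 : 0 ≤ h) (hL : L * h < 1)
    (hp : ∀ τ, 0 ≤ τ → τ ≤ D → ∀ x, biotSavart q (x + τ • e) ≠ 0 → p x = 0)
    (hq : ∀ τ, 0 ≤ τ → τ ≤ D → ∀ x, q (x + τ • e) ≠ 0 → biotSavart p x = -e) (n : ℕ)
    (hn : n * h ≤ D) :
    euler h (fun b => cond b p q) n true = p ∧
      euler h (fun b => cond b p q) n false = fun x => q (x + ((n : ℝ) * h) • e) := by
  induction n with
  | zero => simp [euler]
  | succ n ih =>
    push_cast at hn
    obtain ⟨h1, h2⟩ := ih (by linarith)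
    have hn0 : 0 ≤ n * h := by positivity
    constructor
    · ext1 x
      simp only [euler, advect, velocity, h1, h2, Bool.not_true, orient, if_true, one_smul,
        biotSavart_translate]
      set w := biotSavart q (x + ((n : ℝ) * h) • e) with hw
      by_cases hwx : w = 0
      · simp [hwx]
      rw [hp _ hn0 (by linarith) x hwx]
      refine hp _ hn0 (by linarith) _ fun hy => hwx ?_
      have := hLq.dist_le_mul (x + ((n : ℝ) * h) • e) (x + h • w + ((n : ℝ) * h) • e)
      rw [hy, ← hw, dist_zero_right, add_right_comm, dist_self_add_right, norm_smul,
        Real.norm_of_nonneg h0, ← mul_assoc] at this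
      by_contra hne
      have := mul_lt_mul_of_pos_right hL (norm_pos_iff.2 hne)
      linarith
    · ext1 x
      simp only [euler, advect, velocity, h1, h2, Bool.not_false, orient, Bool.false_eq_true,
        if_false, neg_smul, one_smul, smul_neg]
      have hcast : ((n + 1 : ℕ) : ℝ) * h = n * h + h := by push_cast; ring
      rw [hcast]
      by_cases hx : biotSavart p x = -e
      · rw [hx, smul_neg, neg_neg, add_smul, add_assoc, add_comm (h • e)]
      have hr : q (x + ((n : ℝ) * h + h) • e) = 0 := by
        by_contra hne
        exact hx (hq _ (by linarith) (by linarith) x hne)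
      rw [hr]
      by_contra hne
      set y := x + -(h • biotSavart p x) with hy
      have hpos : y - h • e + ((n : ℝ) * h + h) • e = y + ((n : ℝ) * h) • e := by
        rw [add_smul]
        abel
      have hz := hq (n * h + h) (by linarith) (by linarith) (y - h • e) (by rwa [hpos])
      have hxz : x - (y - h • e) = h • (biotSavart p x - -e) := by
        rw [hy, smul_sub, smul_neg]
        abel
      have := hLp.dist_le_mul x (y - h • e)
      rw [hz, dist_eq_norm, dist_eq_norm, hxz, norm_smul, Real.norm_of_nonneg h0,
        ← mul_assoc] at this
      have h3 := mul_lt_mul_of_pos_right hL (norm_pos_iff.2 (sub_ne_zero.2 hx))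
      linarith

theorem solution_eq_translate {p q : Plane → ℝ} {e : Plane} {D : ℝ} (hps : Smooth p)
    (hqs : Smooth q) (hpc : HasCompactSupport p) (hqc : HasCompactSupport q)
    (hp : ∀ τ, 0 ≤ τ → τ ≤ D → ∀ x, biotSavart q (x + τ • e) ≠ 0 → p x = 0)
    (hq : ∀ τ, 0 ≤ τ → τ ≤ D → ∀ x, q (x + τ • e) ≠ 0 → biotSavart p x = -e) {t : ℝ}
    (ht : 0 ≤ t) (htD : t ≤ D) :
    solution (fun b => cond b p q) true t = p ∧
      solution (fun b => cond b p q) false t = fun x => q (x + t • e) := by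
  have hs : ∀ b, Smooth ((fun b => cond b p q) b) := by rintro (_ | _) <;> assumption
  have hc : ∀ b, HasCompactSupport ((fun b => cond b p q) b) := by rintro (_ | _) <;> assumption
  obtain ⟨L₁, hL₁⟩ := exists_lipschitzWith_biotSavart hps hpc
  obtain ⟨L₂, hL₂⟩ := exists_lipschitzWith_biotSavart hqs hqc
  set L := max L₁ L₂
  have hev : ∀ᶠ m : ℕ in (hyperfilter ℕ : Filter ℕ), (L : ℝ) * (1 / ((m : ℝ) + 1)) < 1 := by
    have := tendsto_one_div_hyperfilter.const_mul (L : ℝ)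
    rw [mul_zero] at this
    exact this.eventually_lt_const one_pos
  have key : ∀ᶠ m : ℕ in (hyperfilter ℕ : Filter ℕ),
      eulerFamily (fun b => cond b p q) true m t = p ∧
      eulerFamily (fun b => cond b p q) false m t =
        fun x => q (x + ((⌊t * (m + 1)⌋₊ : ℝ) * (1 / (m + 1))) • e) := by
    filter_upwards [hev] with m hm
    exact euler_eq_translate (hL₁.weaken (le_max_left _ _)) (hL₂.weaken (le_max_right _ _))
      (one_div_succ_mem m).1 hm hp hq _ ((floor_step ht).1.trans htD)
  have hfl : Tendsto (fun m : ℕ => (⌊t * (m + 1)⌋₊ : ℝ) * (1 / (m + 1))) (hyperfilter ℕ)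
      (𝓝 t) := by
    have h1 := tendsto_one_div_hyperfilter.const_sub t
    rw [sub_zero] at h1
    exact tendsto_of_tendsto_of_tendsto_of_le_of_le h1 tendsto_const_nhds
      (fun m => by linarith [(floor_step (m := m) ht).2]) (fun m => (floor_step ht).1)
  constructor
  · ext1 x
    refine tendsto_nhds_unique ((compatible_eulerFamily hs hc true).tendsto ht x) ?_
    refine tendsto_const_nhds.congr' ?_
    filter_upwards [key] with m hm
    rw [hm.1]
  · ext1 x
    refine tendsto_nhds_unique ((compatible_eulerFamily hs hc false).tendsto ht x) ?_
    have : Tendsto (fun m : ℕ => q (x + ((⌊t * (m + 1)⌋₊ : ℝ) * (1 / (m + 1))) • e))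
        (hyperfilter ℕ) (𝓝 (q (x + t • e))) :=
      (hqs.continuous.tendsto _).comp ((hfl.smul_const e).const_add x)
    refine this.congr' ?_
    filter_upwards [key] with m hm
    rw [hm.2]

end

section

open Metric Filter
open scoped Topology

/-- The unit vector of angle `θ`. -/
def angleVec (θ : ℝ) : Plane :=
  Complex.orthonormalBasisOneI.repr (Real.cos θ + Real.sin θ * Complex.I)

theorem angleVec_zero (θ : ℝ) : angleVec θ 0 = Real.cos θ := by
  simp [angleVec, -Complex.ofReal_cos, -Complex.ofReal_sin]

theorem angleVec_one (θ : ℝ) : angleVec θ 1 = Real.sin θ := by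
  simp [angleVec, -Complex.ofReal_cos, -Complex.ofReal_sin]

theorem norm_angleVec (θ : ℝ) : ‖angleVec θ‖ = 1 := by
  rw [EuclideanSpace.norm_eq, Fin.sum_univ_two, angleVec_zero, angleVec_one]
  simp

theorem hasDerivAt_angleVec (θ : ℝ) : HasDerivAt angleVec (perpL (angleVec θ)) θ := by
  have h1 : HasDerivAt (fun θ : ℝ => ((Real.cos θ : ℂ) + Real.sin θ * Complex.I))
      (((-Real.sin θ : ℝ) : ℂ) + (Real.cos θ : ℝ) * Complex.I) θ :=
    ((Real.hasDerivAt_cos θ).ofReal_comp).add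
      ((Real.hasDerivAt_sin θ).ofReal_comp.mul_const Complex.I)
  have h2 := (Complex.orthonormalBasisOneI.repr.toContinuousLinearEquiv.toContinuousLinearMap.hasFDerivAt
    (x := ((Real.cos θ : ℂ) + Real.sin θ * Complex.I))).comp_hasDerivAt θ h1
  refine h2.congr_deriv ?_
  ext i
  fin_cases i
  · simp [perpL_apply, perp_apply_zero, angleVec_one, -Complex.ofReal_cos, -Complex.ofReal_sin]
  · simp [perpL_apply, perp_apply_one, angleVec_zero, -Complex.ofReal_cos, -Complex.ofReal_sin]

theorem continuous_angleVec : Continuous angleVec :=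
  continuous_iff_continuousAt.2 fun θ => (hasDerivAt_angleVec θ).continuousAt

theorem integral_polar (f : Plane → ℝ) :
    ∫ x, f x = ∫ p in Ioi (0 : ℝ) ×ˢ Ioo (-Real.pi) Real.pi, p.1 * f (p.1 • angleVec p.2) := by
  rw [← (Complex.orthonormalBasisOneI.measurePreserving_repr).integral_comp
    (Complex.orthonormalBasisOneI.repr.toHomeomorph.measurableEmbedding),
    ← Complex.integral_comp_polarCoord_symm, polarCoord_target]
  congr 1
  ext1 p
  rw [Complex.polarCoord_symm_apply, smul_eq_mul, angleVec, ← LinearIsometryEquiv.map_smul,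
    Complex.real_smul]

section

variable {ψ : Plane → ℝ}

theorem integrableOn_polar (hψ : ContDiff ℝ 1 ψ) (hc : HasCompactSupport ψ) (A : Plane →L[ℝ] Plane) :
    IntegrableOn (fun p : ℝ × ℝ => fderiv ℝ ψ (p.1 • angleVec p.2) (A (angleVec p.2)))
      (Ioi (0 : ℝ) ×ˢ Ioo (-Real.pi) Real.pi) := by
  obtain ⟨R, hR0, hR⟩ := hc.exists_suppIn
  have hcont : Continuous (fun p : ℝ × ℝ => fderiv ℝ ψ (p.1 • angleVec p.2) (A (angleVec p.2))) := by
    have h1 := hψ.continuous_fderiv one_ne_zero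
    have h2 := continuous_angleVec
    fun_prop
  refine (hcont.continuousOn.integrableOn_compact
    (isCompact_Icc.prod isCompact_Icc : IsCompact (Icc (0 : ℝ) R ×ˢ Icc (-Real.pi) Real.pi))).of_forall_sdiff_eq_zero
    (measurableSet_Ioi.prod measurableSet_Ioo) ?_
  rintro ⟨r, θ⟩ ⟨⟨h1, h2⟩, h3⟩
  have hr : R < r := by
    by_contra! h
    exact h3 ⟨⟨h1.le, h⟩, Ioo_subset_Icc_self h2⟩
  have : fderiv ℝ ψ (r • angleVec θ) = 0 := hR.fderiv _ (by
    rw [norm_smul, norm_angleVec, mul_one, Real.norm_of_nonneg (le_of_lt h1)]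
    exact hr)
  simp [this]

theorem integral_fderiv_radial (hψ : ContDiff ℝ 1 ψ) (hc : HasCompactSupport ψ) :
    ∫ z, fderiv ℝ ψ z z / ‖z‖ ^ 2 = -(2 * Real.pi) * ψ 0 := by
  have hI := integrableOn_polar hψ hc (ContinuousLinearMap.id ℝ Plane)
  rw [integral_polar]
  have h1 : ∫ p in Ioi (0 : ℝ) ×ˢ Ioo (-Real.pi) Real.pi, p.1 *
      (fderiv ℝ ψ (p.1 • angleVec p.2) (p.1 • angleVec p.2) / ‖p.1 • angleVec p.2‖ ^ 2) =
      ∫ p in Ioi (0 : ℝ) ×ˢ Ioo (-Real.pi) Real.pi,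
        fderiv ℝ ψ (p.1 • angleVec p.2) (ContinuousLinearMap.id ℝ Plane (angleVec p.2)) := by
    refine setIntegral_congr_fun (measurableSet_Ioi.prod measurableSet_Ioo) ?_
    rintro ⟨r, θ⟩ ⟨hr, -⟩
    have hr' : r ≠ 0 := ne_of_gt hr
    simp only [map_smul, smul_eq_mul, norm_smul, norm_angleVec, Real.norm_eq_abs, mul_one, sq_abs,
      ContinuousLinearMap.id_apply]
    field_simp
  rw [IntegrableOn, Measure.volume_eq_prod, ← Measure.prod_restrict] at hI
  rw [h1, Measure.volume_eq_prod, ← Measure.prod_restrict, integral_prod_symm _ hI]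
  obtain ⟨R, hR0, hR⟩ := hc.exists_suppIn
  have h2 : ∀ᵐ θ ∂(volume.restrict (Ioo (-Real.pi) Real.pi)), ∫ r in Ioi (0 : ℝ),
      fderiv ℝ ψ (r • angleVec θ) (ContinuousLinearMap.id ℝ Plane (angleVec θ)) = -ψ 0 := by
    filter_upwards [hI.prod_left_ae] with θ hθ
    have := integral_Ioi_of_hasDerivAt_of_tendsto' (f := fun r : ℝ => ψ (r • angleVec θ)) (a := 0)
      (m := 0) (f' := fun r => fderiv ℝ ψ (r • angleVec θ) (angleVec θ)) (fun r _ => ?_) hθ ?_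
    · simpa using this
    · have := ((hψ.differentiable one_ne_zero) (r • angleVec θ)).hasFDerivAt.comp_hasDerivAt r
        ((hasDerivAt_id r).smul_const (angleVec θ))
      simpa [Function.comp_def] using this
    · refine tendsto_const_nhds.congr' ?_
      filter_upwards [eventually_gt_atTop R] with r hr
      rw [hR]
      rw [norm_smul, norm_angleVec, mul_one]
      exact hr.trans_le (le_abs_self r)
  rw [integral_congr_ae h2]
  simp [Real.pi_pos.le]
  exact Or.inl (by ring)

theorem integral_fderiv_angular (hψ : ContDiff ℝ 1 ψ) (hc : HasCompactSupport ψ) :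
    ∫ z, fderiv ℝ ψ z (perp z) / ‖z‖ ^ 2 = 0 := by
  have hI := integrableOn_polar hψ hc perpL.toContinuousLinearMap
  rw [integral_polar]
  have h1 : ∫ p in Ioi (0 : ℝ) ×ˢ Ioo (-Real.pi) Real.pi, p.1 *
      (fderiv ℝ ψ (p.1 • angleVec p.2) (perp (p.1 • angleVec p.2)) / ‖p.1 • angleVec p.2‖ ^ 2) =
      ∫ p in Ioi (0 : ℝ) ×ˢ Ioo (-Real.pi) Real.pi,
        fderiv ℝ ψ (p.1 • angleVec p.2) (perpL.toContinuousLinearMap (angleVec p.2)) := by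
    refine setIntegral_congr_fun (measurableSet_Ioi.prod measurableSet_Ioo) ?_
    rintro ⟨r, θ⟩ ⟨hr, -⟩
    have hr' : r ≠ 0 := ne_of_gt hr
    simp only [← perpL_apply, map_smul, smul_eq_mul, norm_smul, norm_angleVec, Real.norm_eq_abs, mul_one, sq_abs,
      LinearIsometry.coe_toContinuousLinearMap]
    field_simp
  rw [h1, Measure.volume_eq_prod, setIntegral_prod _ hI]
  refine setIntegral_eq_zero_of_forall_eq_zero fun r hr => ?_
  have hr' : r ≠ 0 := (mem_Ioi.1 hr).ne'
  have hcont : Continuous (fun θ : ℝ => fderiv ℝ ψ (r • angleVec θ) (perpL (angleVec θ))) := by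
    have h1 := hψ.continuous_fderiv one_ne_zero
    have h2 := continuous_angleVec
    have h3 : Continuous perpL := perpL.continuous
    fun_prop
  have h2 : ∫ θ in (-Real.pi)..Real.pi, fderiv ℝ ψ (r • angleVec θ) (perpL (angleVec θ)) =
      r⁻¹ * ψ (r • angleVec Real.pi) - r⁻¹ * ψ (r • angleVec (-Real.pi)) := by
    refine intervalIntegral.integral_eq_sub_of_hasDerivAt
      (f := fun θ => r⁻¹ * ψ (r • angleVec θ)) (fun θ _ => ?_) (hcont.intervalIntegrable _ _)
    have := (((hψ.differentiable one_ne_zero) (r • angleVec θ)).hasFDerivAt.comp_hasDerivAt θ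
        ((hasDerivAt_angleVec θ).const_smul r)).const_mul r⁻¹
    refine this.congr_deriv ?_
    rw [map_smul, smul_eq_mul, inv_mul_cancel_left₀ hr']
  have h3 : angleVec (-Real.pi) = angleVec Real.pi := by
    ext i
    fin_cases i
    · simp [angleVec_zero]
    · simp [angleVec_one]
  rw [h3, sub_self, intervalIntegral.integral_of_le (by linarith [Real.pi_pos]),
    integral_Ioc_eq_integral_Ioo] at h2
  exact h2

end

end

section

open Metric Filter
open scoped Topology

/-- The partial derivative in the `i`-th direction. -/
def pd (i : Fin 2) (φ : Plane → ℝ) (x : Plane) : ℝ := fderiv ℝ φ x (EuclideanSpace.single i 1)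

/-- The Laplacian. -/
def lap (φ : Plane → ℝ) (x : Plane) : ℝ := pd 0 (pd 0 φ) x + pd 1 (pd 1 φ) x

section

variable {φ : Plane → ℝ}

theorem fderiv_apply_eq_pd (φ : Plane → ℝ) (x v : Plane) :
    fderiv ℝ φ x v = v 0 * pd 0 φ x + v 1 * pd 1 φ x := by
  have hv : v = v 0 • EuclideanSpace.single 0 (1 : ℝ) + v 1 • EuclideanSpace.single 1 (1 : ℝ) := by
    ext i
    fin_cases i <;> simp
  nth_rewrite 1 [hv]
  simp [pd]

theorem Smooth.pd (hφ : Smooth φ) (i : Fin 2) : Smooth (pd i φ) := by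
  have := hφ.fderiv
  unfold _root_.pd
  exact this.clm_apply contDiff_const

theorem Smooth.lap (hφ : Smooth φ) : Smooth (lap φ) := ((hφ.pd 0).pd 0).add ((hφ.pd 1).pd 1)

theorem tsupport_pd_subset (φ : Plane → ℝ) (i : Fin 2) : tsupport (pd i φ) ⊆ tsupport φ := by
  refine (closure_mono fun x hx => ?_).trans (tsupport_fderiv_subset ℝ (f := φ))
  rw [Function.mem_support] at hx ⊢
  exact fun h => hx (by simp [pd, h])

theorem tsupport_lap_subset (φ : Plane → ℝ) : tsupport (lap φ) ⊆ tsupport φ :=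
  (tsupport_add _ _).trans (union_subset
    ((tsupport_pd_subset _ _).trans (tsupport_pd_subset _ _))
    ((tsupport_pd_subset _ _).trans (tsupport_pd_subset _ _)))

theorem HasCompactSupport.pd (hc : HasCompactSupport φ) (i : Fin 2) : HasCompactSupport (pd i φ) :=
  hc.of_isClosed_subset (isClosed_tsupport _) (tsupport_pd_subset φ i)

theorem HasCompactSupport.lap (hc : HasCompactSupport φ) : HasCompactSupport (lap φ) :=
  hc.of_isClosed_subset (isClosed_tsupport _) (tsupport_lap_subset φ)

theorem pd_translate (φ : Plane → ℝ) (i : Fin 2) (v : Plane) :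
    pd i (fun y => φ (y + v)) = fun y => pd i φ (y + v) := by
  ext1 y
  simp only [pd, fderiv_comp_add_right]

theorem lap_translate (φ : Plane → ℝ) (v : Plane) :
    lap (fun y => φ (y + v)) = fun y => lap φ (y + v) := by
  ext1 y
  simp only [lap, pd_translate]

theorem pd_comm (hφ : Smooth φ) (x : Plane) : pd 0 (pd 1 φ) x = pd 1 (pd 0 φ) x := by
  have h : ∀ i j, pd i (pd j φ) x =
      fderiv ℝ (fderiv ℝ φ) x (EuclideanSpace.single i 1) (EuclideanSpace.single j 1) := by
    intro i j
    have hd := hφ.fderiv.differentiable x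
    unfold pd
    rw [fderiv_clm_apply hd (differentiableAt_const _)]
    simp
  rw [h, h]
  exact ((hφ.nat 2).contDiffAt.isSymmSndFDerivAt (by simp)).eq _ _

theorem integrable_mul_coord {c : Plane → ℝ} (hc : Continuous c) (hs : HasCompactSupport c)
    (i : Fin 2) : Integrable fun y : Plane => c y * (y i / ‖y‖ ^ 2) := by
  have h := locallyIntegrable_bsKernel.integrable_smul_left_of_hasCompactSupport hc hs
  have h0 := (EuclideanSpace.proj (1 - i) : Plane →L[ℝ] ℝ).integrable_comp h
  have hpi := Real.pi_ne_zero
  fin_cases i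
  · refine (h0.const_mul (2 * Real.pi)).congr (Eventually.of_forall fun y => ?_)
    simp [bsKernel, perp_apply_one]
    field_simp
  · refine (h0.const_mul (-(2 * Real.pi))).congr (Eventually.of_forall fun y => ?_)
    simp [bsKernel, perp_apply_zero]
    field_simp

theorem integrable_fderiv_apply {ψ : Plane → ℝ} (hψ : Smooth ψ) (hc : HasCompactSupport ψ) :
    Integrable (fun z => fderiv ℝ ψ z z / ‖z‖ ^ 2) ∧
      Integrable (fun z => fderiv ℝ ψ z (perp z) / ‖z‖ ^ 2) := by
  have h := fun i j => integrable_mul_coord (hψ.pd i).continuous (hc.pd i) j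
  constructor
  · refine ((h 0 0).add (h 1 1)).congr (Eventually.of_forall fun y => ?_)
    simp only [Pi.add_apply, fderiv_apply_eq_pd ψ y]
    ring
  · refine ((h 1 0).sub (h 0 1)).congr (Eventually.of_forall fun y => ?_)
    simp only [Pi.sub_apply, fderiv_apply_eq_pd ψ y, perp_apply_zero, perp_apply_one]
    ring

theorem biotSavart_apply_zero {q : Plane → ℝ} (hq : Continuous q) (hs : HasCompactSupport q) :
    biotSavart q 0 0 = (2 * Real.pi)⁻¹ * ∫ y, q y * (y 1 / ‖y‖ ^ 2) ∧
      biotSavart q 0 1 = -((2 * Real.pi)⁻¹ * ∫ y, q y * (y 0 / ‖y‖ ^ 2)) := by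
  have hI : Integrable fun y : Plane => (q y / ‖0 - y‖ ^ 2) • perp (0 - y) := by
    have h := locallyIntegrable_bsKernel.integrable_smul_left_of_hasCompactSupport hq hs
    refine (h.smul (-(2 * Real.pi))).congr (Eventually.of_forall fun y => ?_)
    have hpi := Real.pi_ne_zero
    simp only [zero_sub, norm_neg, bsKernel, ← perpL_apply, map_neg, map_smul, Pi.smul_apply]
    simp only [smul_smul, smul_neg, ← neg_smul]
    congr 1
    field_simp
  have hproj : ∀ i, biotSavart q 0 i =
      (1 / (2 * Real.pi)) * ∫ y, ((q y / ‖0 - y‖ ^ 2) • perp (0 - y)) i := by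
    intro i
    rw [biotSavart]
    simp only [PiLp.smul_apply, smul_eq_mul]
    congr 1
    exact ((EuclideanSpace.proj i : Plane →L[ℝ] ℝ).integral_comp_comm hI).symm
  constructor
  · rw [hproj, one_div]
    congr 2
    ext1 y
    simp [perp_apply_zero]
    ring
  · rw [hproj, one_div, ← mul_neg, ← integral_neg]
    congr 2
    ext1 y
    simp [perp_apply_one]
    ring

theorem biotSavart_lap (hφ : Smooth φ) (hc : HasCompactSupport φ) (x : Plane) :
    biotSavart (lap φ) x 0 = -pd 1 φ x ∧ biotSavart (lap φ) x 1 = pd 0 φ x := by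
  wlog hx : x = 0 generalizing φ x
  · have hφ' : Smooth fun y => φ (y + x) := hφ.comp (contDiff_id.add contDiff_const)
    have hc' : HasCompactSupport fun y => φ (y + x) :=
      hc.comp_homeomorph (Homeomorph.addRight x)
    have := this hφ' hc' 0 rfl
    simpa only [lap_translate, biotSavart_translate, pd_translate, zero_add] using this
  subst hx
  obtain ⟨e0, e1⟩ := biotSavart_apply_zero hφ.lap.continuous hc.lap
  have hpi := Real.pi_ne_zero
  have hA := fun i => integral_fderiv_radial (hφ.pd i).one (hc.pd i)
  have hB := fun i => integral_fderiv_angular (hφ.pd i).one (hc.pd i)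
  have hI := fun i => integrable_fderiv_apply (hφ.pd i) (hc.pd i)
  constructor
  · have h : (fun y : Plane => lap φ y * (y 1 / ‖y‖ ^ 2)) = fun y =>
        fderiv ℝ (pd 1 φ) y y / ‖y‖ ^ 2 - fderiv ℝ (pd 0 φ) y (perp y) / ‖y‖ ^ 2 := by
      ext1 y
      simp only [fderiv_apply_eq_pd, perp_apply_zero, perp_apply_one, pd_comm hφ, lap]
      ring
    rw [e0, h, integral_sub (hI 1).1 (hI 0).2, hA, hB]
    field_simp
    ring
  · have h : (fun y : Plane => lap φ y * (y 0 / ‖y‖ ^ 2)) = fun y =>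
        fderiv ℝ (pd 0 φ) y y / ‖y‖ ^ 2 + fderiv ℝ (pd 1 φ) y (perp y) / ‖y‖ ^ 2 := by
      ext1 y
      simp only [fderiv_apply_eq_pd, perp_apply_zero, perp_apply_one, pd_comm hφ, lap]
      ring
    rw [e1, h, integral_add (hI 0).1 (hI 1).2, hA, hB]
    field_simp
    ring

end

end

section

open Metric Filter
open scoped Topology

theorem Disjoint.of_subset_closure {X : Type*} [TopologicalSpace X] {U V A B : Set X}
    (h : Disjoint A B) (hB : IsOpen B) (hU : IsOpen U) (hUA : U ⊆ closure A)
    (hVB : V ⊆ closure B) : Disjoint U V :=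
  (((h.closure_left hB).mono_left hUA).closure_right hU).mono_right hVB

/-- If the support of `K` is the union of the closures of finitely many connected open sets with
disjoint closures, its interior has one connected component for each of them. -/
theorem card_connectedComponents_interior {X ι : Type*} [TopologicalSpace X] [Fintype ι]
    {K : Set X} {A : ι → Set X} (hA : ∀ i, IsOpen (A i)) (hne : ∀ i, (A i).Nonempty)
    (hconn : ∀ i, IsPreconnected (A i))
    (hdisj : ∀ i j, i ≠ j → Disjoint (closure (A i)) (closure (A j)))
    (hK : K = ⋃ i, closure (A i)) :
    Nat.card (ConnectedComponents (interior K)) = Fintype.card ι := by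
  have hmem : ∀ x : interior K, ∃ i, (x : X) ∈ closure (A i) := fun x => by
    simpa [hK] using interior_subset x.2
  choose c hc using hmem
  have huniq : ∀ (x : interior K) i, (x : X) ∈ closure (A i) → c x = i := fun x i hi => by
    by_contra h
    exact (hdisj _ _ h).le_bot ⟨hc x, hi⟩
  have hAK : ∀ i, A i ⊆ interior K := fun i =>
    interior_maximal (subset_closure.trans (hK ▸ subset_iUnion (fun i => closure (A i)) i)) (hA i)
  let _ : TopologicalSpace ι := ⊥
  have _ : DiscreteTopology ι := ⟨rfl⟩
  have hcont : Continuous c := by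
    refine continuous_iff_isClosed.2 fun s _ => ?_
    have : c ⁻¹' s = ⋃ i ∈ s, Subtype.val ⁻¹' closure (A i) := by
      ext x
      simp only [mem_preimage, mem_iUnion, exists_prop]
      exact ⟨fun h => ⟨_, h, hc x⟩, fun ⟨i, hi, hx⟩ => huniq x i hx ▸ hi⟩
    rw [this]
    exact s.toFinite.isClosed_biUnion fun i _ => isClosed_closure.preimage continuous_subtype_val
  have hpre : ∀ i, IsPreconnected (Subtype.val ⁻¹' closure (A i) : Set (interior K)) := fun i => by
    rw [← Topology.IsInducing.subtypeVal.isPreconnected_image]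
    refine (hconn i).subset_closure (fun x hx => ⟨⟨x, hAK i hx⟩, subset_closure hx, rfl⟩) ?_
    rintro _ ⟨x, hx, rfl⟩
    exact hx
  rw [← Nat.card_eq_fintype_card]
  refine Nat.card_congr (Equiv.ofBijective hcont.connectedComponentsLift ⟨?_, ?_⟩)
  · intro a b hab
    obtain ⟨x, rfl⟩ := ConnectedComponents.surjective_coe a
    obtain ⟨y, rfl⟩ := ConnectedComponents.surjective_coe b
    rw [Continuous.connectedComponentsLift_apply_coe,
      Continuous.connectedComponentsLift_apply_coe] at hab
    rw [ConnectedComponents.coe_eq_coe']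
    exact (hpre (c y)).subset_connectedComponent (hc y) (by rw [← hab]; exact hc x)
  · intro i
    obtain ⟨x, hx⟩ := hne i
    exact ⟨((⟨x, hAK i hx⟩ : interior K) : ConnectedComponents (interior K)), by
      rw [Continuous.connectedComponentsLift_apply_coe]
      exact huniq _ i (subset_closure hx)⟩

theorem support_sum_of_disjoint {X ι : Type*} [Fintype ι] {f : ι → X → ℝ}
    (h : ∀ i j, i ≠ j → Disjoint (Function.support (f i)) (Function.support (f j))) :
    Function.support (fun x => ∑ i, f i x) = ⋃ i, Function.support (f i) := by
  ext x
  simp only [Function.mem_support, mem_iUnion]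
  constructor
  · intro hx
    by_contra! h0
    exact hx (Finset.sum_eq_zero fun i _ => h0 i)
  · rintro ⟨i, hi⟩
    rw [Finset.sum_eq_single i (fun j _ hj => ?_) (by simp)]
    · exact hi
    · by_contra hne
      exact (h i j hj.symm).le_bot ⟨hi, hne⟩

section

variable {φ : Plane → ℝ}

theorem eq_zero_of_lap_eq_zero (hφ : Smooth φ) (hc : HasCompactSupport φ) (h : lap φ = 0) :
    φ = 0 := by
  have hU : ∀ x, fderiv ℝ φ x = 0 := fun x => by
    obtain ⟨h0, h1⟩ := biotSavart_lap hφ hc x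
    have hz : biotSavart (lap φ) x = 0 := by simp [h, biotSavart]
    rw [hz] at h0 h1
    have e0 : pd 1 φ x = 0 := by simpa using h0.symm
    have e1 : pd 0 φ x = 0 := by simpa using h1.symm
    ext v
    simp [fderiv_apply_eq_pd, e0, e1]
  obtain ⟨R, hR0, hR⟩ := hc.exists_suppIn
  obtain ⟨y, hy⟩ := exists_norm_eq Plane (by linarith : 0 ≤ R + 1)
  ext x
  rw [is_const_of_fderiv_eq_zero hφ.differentiable hU x y, hR y (by linarith)]
  rfl

theorem analyticOnNhd_pd {O : Set Plane} (h : AnalyticOnNhd ℝ φ O) (i : Fin 2) :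
    AnalyticOnNhd ℝ (pd i φ) O :=
  (ContinuousLinearMap.apply ℝ ℝ (EuclideanSpace.single i (1 : ℝ) : Plane)).comp_analyticOnNhd
    h.fderiv

theorem tsupport_lap_eq (hφ : Smooth φ) (hc : HasCompactSupport φ) (hne : φ ≠ 0) {O : Set Plane}
    (hO : IsPreconnected O) (han : AnalyticOnNhd ℝ φ O)
    (hsupp : Function.support (lap φ) ⊆ closure O) : tsupport (lap φ) = closure O := by
  refine (closure_minimal hsupp isClosed_closure).antisymm (closure_minimal (fun x hx => ?_)
    (isClosed_tsupport _))
  by_contra hxs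
  refine hne (eq_zero_of_lap_eq_zero hφ hc (funext fun y => ?_))
  have hlap : AnalyticOnNhd ℝ (lap φ) O :=
    (analyticOnNhd_pd (analyticOnNhd_pd han 0) 0).add (analyticOnNhd_pd (analyticOnNhd_pd han 1) 1)
  have h0 : O ⊆ lap φ ⁻¹' {0} :=
    hlap.eqOn_zero_of_preconnected_of_eventuallyEq_zero hO hx (notMem_tsupport_iff_eventuallyEq.1 hxs)
  by_contra hy
  exact hy (closure_minimal h0 (isClosed_singleton.preimage hφ.lap.continuous) (hsupp hy))

end

end

section

open Metric Filter
open scoped Topology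

theorem analyticAt_expNegInvGlue {x : ℝ} (hx : 0 < x) : AnalyticAt ℝ expNegInvGlue x := by
  have h : AnalyticAt ℝ (fun y : ℝ => Real.exp (-y⁻¹)) x :=
    (analyticAt_id.inv hx.ne').neg.rexp'
  refine h.congr ?_
  filter_upwards [lt_mem_nhds hx] with y hy
  simp [expNegInvGlue, hy.not_ge]

theorem analyticAt_smoothTransition {x : ℝ} (hx : x ∈ Ioo (0 : ℝ) 1) :
    AnalyticAt ℝ Real.smoothTransition x := by
  have h1 := analyticAt_expNegInvGlue hx.1
  have h2 : AnalyticAt ℝ (fun y => expNegInvGlue (1 - y)) x :=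
    AnalyticAt.fun_comp (g := expNegInvGlue) (f := fun y => 1 - y) (analyticAt_expNegInvGlue
      (sub_pos.2 hx.2)) (analyticAt_const.sub analyticAt_id)
  exact h1.div (h1.add h2) (Real.smoothTransition.pos_denom x).ne'

theorem analyticAt_coord (i : Fin 2) (x : Plane) : AnalyticAt ℝ (fun y : Plane => y i) x :=
  (EuclideanSpace.proj i : Plane →L[ℝ] ℝ).analyticAt x

theorem smooth_coord (i : Fin 2) : Smooth fun y : Plane => y i :=
  (EuclideanSpace.proj i : Plane →L[ℝ] ℝ).contDiff

/-- The open box with corners `a` and `b`. -/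
def box (a b : Fin 2 → ℝ) : Set Plane := {x | ∀ i, x i ∈ Ioo (a i) (b i)}

/-- A nonnegative smooth function positive exactly on a box. -/
def boxBump (a b : Fin 2 → ℝ) (x : Plane) : ℝ :=
  ∏ i, expNegInvGlue (x i - a i) * expNegInvGlue (b i - x i)

section

variable {a b : Fin 2 → ℝ}

theorem box_eq_preimage (a b : Fin 2 → ℝ) :
    box a b = (EuclideanSpace.equiv (Fin 2) ℝ).toHomeomorph ⁻¹' univ.pi fun i => Ioo (a i) (b i) := by
  ext x
  simp [box]

theorem isOpen_box : IsOpen (box a b) := by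
  rw [box_eq_preimage]
  exact (isOpen_set_pi finite_univ fun _ _ => isOpen_Ioo).preimage (Homeomorph.continuous _)

theorem closure_box (h : ∀ i, a i < b i) : closure (box a b) = {x | ∀ i, x i ∈ Icc (a i) (b i)} := by
  rw [box_eq_preimage, ← Homeomorph.preimage_closure, closure_pi_set]
  ext x
  simp only [closure_Ioo (h _).ne, mem_preimage, mem_univ_pi]
  rfl

theorem closure_box_subset : closure (box a b) ⊆ {x | ∀ i, x i ∈ Icc (a i) (b i)} := by
  refine closure_minimal (fun x hx i => Ioo_subset_Icc_self (hx i)) ?_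
  simp only [ofPred_forall]
  exact isClosed_iInter fun i => isClosed_Icc.preimage (smooth_coord i).continuous

theorem isPreconnected_box : IsPreconnected (box a b) := by
  refine Convex.isPreconnected fun x hx y hy s t hs ht hst i => ?_
  exact (convex_Ioo (a i) (b i)) (hx i) (hy i) hs ht hst

theorem nonempty_box (h : ∀ i, a i < b i) : (box a b).Nonempty :=
  ⟨WithLp.toLp 2 fun i => (a i + b i) / 2, fun i => by
    constructor <;> simp only [] <;> linarith [h i]⟩

theorem support_boxBump : Function.support (boxBump a b) = box a b := by
  ext x
  simp [boxBump, box]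

theorem tsupport_boxBump : tsupport (boxBump a b) = closure (box a b) := by
  rw [tsupport, support_boxBump]

theorem smooth_boxBump : Smooth (boxBump a b) :=
  contDiff_prod fun i _ => (expNegInvGlue.contDiff.comp ((smooth_coord i).sub contDiff_const)).mul
    (expNegInvGlue.contDiff.comp (contDiff_const.sub (smooth_coord i)))

theorem analyticOnNhd_boxBump : AnalyticOnNhd ℝ (boxBump a b) (box a b) := by
  refine Finset.analyticOnNhd_fun_prod _ fun i _ x hx => ?_
  have h1 := analyticAt_coord i x
  exact (AnalyticAt.fun_comp (g := expNegInvGlue) (f := fun y : Plane => y i - a i)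
    (analyticAt_expNegInvGlue (sub_pos.2 (hx i).1)) (h1.sub analyticAt_const)).mul
    (AnalyticAt.fun_comp (g := expNegInvGlue) (f := fun y : Plane => b i - y i)
    (analyticAt_expNegInvGlue (sub_pos.2 (hx i).2)) (analyticAt_const.sub h1))

theorem hasCompactSupport_boxBump : HasCompactSupport (boxBump a b) := by
  rw [HasCompactSupport, tsupport_boxBump, box_eq_preimage, ← Homeomorph.preimage_closure,
    Homeomorph.isCompact_preimage]
  refine IsCompact.of_isClosed_subset (isCompact_univ_pi fun i => isCompact_Icc (a := a i) (b := b i))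
    isClosed_closure (closure_minimal (pi_mono fun i _ => Ioo_subset_Icc_self) ?_)
  exact isClosed_set_pi fun i _ => isClosed_Icc

theorem tsupport_lap_boxBump (h : ∀ i, a i < b i) :
    tsupport (lap (boxBump a b)) = closure (box a b) := by
  refine tsupport_lap_eq smooth_boxBump hasCompactSupport_boxBump ?_ isPreconnected_box
    analyticOnNhd_boxBump ?_
  · rw [Ne, ← Function.support_eq_empty_iff, support_boxBump]
    exact (nonempty_box h).ne_empty
  · rw [← tsupport_boxBump]
    exact (subset_tsupport _).trans (tsupport_lap_subset _)

end

/-- The open annulus between the centred circles of radii `1` and `2`. -/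
def annulus : Set Plane := ball 0 2 \ closedBall 0 1

theorem isOpen_annulus : IsOpen annulus := isOpen_ball.sdiff isClosed_closedBall

theorem mem_annulus {x : Plane} : x ∈ annulus ↔ 1 < ‖x‖ ∧ ‖x‖ < 2 := by
  simp [annulus, and_comm]

theorem closure_annulus_subset : closure annulus ⊆ {x | 1 ≤ ‖x‖} :=
  closure_minimal (fun _ hx => (mem_annulus.1 hx).1.le) (isClosed_le continuous_const continuous_norm)

theorem nonempty_annulus : annulus.Nonempty := by
  obtain ⟨y, hy⟩ := exists_norm_eq Plane (by norm_num : (0 : ℝ) ≤ 3 / 2)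
  exact ⟨y, mem_annulus.2 (by rw [hy]; norm_num)⟩

theorem isPreconnected_annulus : IsPreconnected annulus := by
  have h : annulus = (fun p : ℝ × Plane => p.1 • p.2) '' (Ioo 1 2 ×ˢ sphere 0 1) := by
    ext x
    rw [mem_annulus]
    constructor
    · rintro ⟨h1, h2⟩
      have h0 : ‖x‖ ≠ 0 := by linarith
      refine ⟨(‖x‖, ‖x‖⁻¹ • x), ⟨⟨h1, h2⟩, ?_⟩, ?_⟩
      · simp [norm_smul, h0]
      · simp [smul_smul, h0]
    · rintro ⟨⟨r, v⟩, ⟨⟨h1, h2⟩, hv⟩, rfl⟩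
      have hv' : ‖v‖ = 1 := by simpa using hv
      simp only [norm_smul, hv', mul_one, Real.norm_of_nonneg (zero_le_one.trans h1.le)]
      exact ⟨h1, h2⟩
  rw [h]
  refine (isPreconnected_Ioo.prod (isPreconnected_sphere ?_ _ _)).image _
    (continuous_fst.smul continuous_snd).continuousOn
  rw [← Module.finrank_eq_rank]
  simp

/-- A smooth function equal to the second coordinate on the unit disc and supported in the disc
of radius `2`. -/
def cutoffCoord (x : Plane) : ℝ := x 1 * Real.smoothTransition ((4 - ‖x‖ ^ 2) / 3)

theorem cutoffCoord_of_norm_le {x : Plane} (hx : ‖x‖ ≤ 1) : cutoffCoord x = x 1 := by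
  rw [cutoffCoord, Real.smoothTransition.one_of_one_le, mul_one]
  nlinarith [norm_nonneg x]

theorem cutoffCoord_of_le_norm {x : Plane} (hx : 2 ≤ ‖x‖) : cutoffCoord x = 0 := by
  rw [cutoffCoord, Real.smoothTransition.zero_of_nonpos, mul_zero]
  nlinarith [norm_nonneg x]

theorem smooth_cutoffCoord : Smooth cutoffCoord :=
  (smooth_coord 1).mul (Real.smoothTransition.contDiff.comp
    ((contDiff_const.sub (contDiff_norm_sq ℝ)).div_const 3))

theorem hasCompactSupport_cutoffCoord : HasCompactSupport cutoffCoord :=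
  HasCompactSupport.intro (isCompact_closedBall (0 : Plane) 2) fun x hx =>
    cutoffCoord_of_le_norm (le_of_lt (by simpa using hx))

theorem pd_cutoffCoord {x : Plane} (hx : ‖x‖ < 1) (i : Fin 2) :
    pd i cutoffCoord x = if i = 1 then 1 else 0 := by
  have h : cutoffCoord =ᶠ[𝓝 x] (EuclideanSpace.proj 1 : Plane →L[ℝ] ℝ) := by
    filter_upwards [(isOpen_lt continuous_norm continuous_const).mem_nhds hx] with y hy
    exact cutoffCoord_of_norm_le (le_of_lt hy)
  rw [pd, h.fderiv_eq, ContinuousLinearMap.fderiv]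
  simp [eq_comm]

theorem lap_cutoffCoord {x : Plane} (hx : ‖x‖ < 1) : lap cutoffCoord x = 0 := by
  have h : ∀ i j, pd i (pd j cutoffCoord) x = 0 := by
    intro i j
    have h : pd j cutoffCoord =ᶠ[𝓝 x] fun _ => if j = 1 then 1 else 0 := by
      filter_upwards [(isOpen_lt continuous_norm continuous_const).mem_nhds hx] with y hy
      exact pd_cutoffCoord hy j
    rw [pd, h.fderiv_eq]
    simp
  rw [lap, h, h, add_zero]

theorem analyticOnNhd_cutoffCoord : AnalyticOnNhd ℝ cutoffCoord annulus := by
  intro x hx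
  rw [mem_annulus] at hx
  have hn : AnalyticAt ℝ (fun y : Plane => (4 - ‖y‖ ^ 2) / 3) x := by
    have : (fun y : Plane => (4 - ‖y‖ ^ 2) / 3) = fun y => (4 - (y 0 * y 0 + y 1 * y 1)) / 3 := by
      ext y
      rw [EuclideanSpace.norm_sq_eq, Fin.sum_univ_two, Real.norm_eq_abs, Real.norm_eq_abs, sq_abs,
        sq_abs]
      ring
    rw [this]
    have h0 := analyticAt_coord 0 x
    have h1 := analyticAt_coord 1 x
    exact ((analyticAt_const.sub ((h0.mul h0).add (h1.mul h1))).div analyticAt_const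
      (by norm_num))
  refine (analyticAt_coord 1 x).mul (AnalyticAt.fun_comp (g := Real.smoothTransition) ?_ hn)
  apply analyticAt_smoothTransition
  constructor <;> nlinarith

theorem support_lap_cutoffCoord : Function.support (lap cutoffCoord) ⊆ annulus := by
  have ho : IsOpen (Function.support (lap cutoffCoord)) :=
    smooth_cutoffCoord.lap.continuous.isOpen_support
  have h1 : Function.support (lap cutoffCoord) ⊆ ball 0 2 := by
    rw [← interior_closedBall (0 : Plane) two_ne_zero]
    refine interior_maximal (((subset_tsupport _).trans (tsupport_lap_subset _)).trans
      (closure_minimal (fun x hx => ?_) isClosed_closedBall)) ho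
    by_contra h
    exact hx (cutoffCoord_of_le_norm (le_of_lt (by simpa using h)))
  have h2 : Function.support (lap cutoffCoord) ⊆ (closedBall 0 1)ᶜ := by
    rw [← closure_ball (0 : Plane) one_ne_zero, ← interior_compl]
    refine interior_maximal (fun x hx h => hx (lap_cutoffCoord (by simpa using h))) ho
  exact fun x hx => ⟨h1 hx, h2 hx⟩

theorem tsupport_lap_cutoffCoord : tsupport (lap cutoffCoord) = closure annulus := by
  refine tsupport_lap_eq smooth_cutoffCoord hasCompactSupport_cutoffCoord (fun h => ?_)
    isPreconnected_annulus analyticOnNhd_cutoffCoord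
    (support_lap_cutoffCoord.trans subset_closure)
  have := pd_cutoffCoord (x := 0) (by simp) 1
  rw [h] at this
  simp [pd] at this

end

section

open Metric Filter
open scoped Topology

theorem pd_add {φ ψ : Plane → ℝ} (hφ : Smooth φ) (hψ : Smooth ψ) (i : Fin 2) :
    pd i (fun x => φ x + ψ x) = fun x => pd i φ x + pd i ψ x := by
  ext1 x
  rw [pd, fderiv_fun_add (hφ.differentiable x) (hψ.differentiable x)]
  rfl

theorem lap_add {φ ψ : Plane → ℝ} (hφ : Smooth φ) (hψ : Smooth ψ) :
    lap (fun x => φ x + ψ x) = fun x => lap φ x + lap ψ x := by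
  ext1 x
  simp only [lap, pd_add hφ hψ, pd_add (hφ.pd _) (hψ.pd _)]
  ring

/-- The lower corners of the fixed box and of the two travelling boxes at time `τ`. -/
def lower (τ : ℝ) : Fin 3 → Fin 2 → ℝ := ![![-1/2, -1/4], ![1/2 - τ, 1/16], ![1/2 - τ, -3/16]]

/-- The upper corners of the fixed box and of the two travelling boxes at time `τ`. -/
def upper (τ : ℝ) : Fin 3 → Fin 2 → ℝ := ![![0, 1/4], ![5/8 - τ, 3/16], ![5/8 - τ, -1/16]]

/-- The stream function of each of the three boxes at time `τ`. -/
def boxStream (τ : ℝ) (k : Fin 3) : Plane → ℝ := boxBump (lower τ k) (upper τ k)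

/-- The stream function of the stationary scalar. -/
def fixedStream (x : Plane) : ℝ := cutoffCoord x + boxStream 0 0 x

/-- The stream function of the travelling scalar at time `τ`. -/
def movingStream (τ : ℝ) (x : Plane) : ℝ := boxStream τ 1 x + boxStream τ 2 x

/-- The annulus and the three boxes at time `τ`. -/
def region (τ : ℝ) : Fin 4 → Set Plane :=
  ![annulus, box (lower τ 0) (upper τ 0), box (lower τ 1) (upper τ 1), box (lower τ 2) (upper τ 2)]

/-- The scalar carried by each region at time `τ`. -/
def density (τ : ℝ) : Fin 4 → Plane → ℝ :=
  ![lap cutoffCoord, lap (boxStream τ 0), lap (boxStream τ 1), lap (boxStream τ 2)]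

theorem boxStream_zero (τ : ℝ) : boxStream τ 0 = boxStream 0 0 := by simp [boxStream, lower, upper]

theorem smooth_boxStream (τ : ℝ) (k : Fin 3) : Smooth (boxStream τ k) := smooth_boxBump

theorem smooth_fixedStream : Smooth fixedStream := smooth_cutoffCoord.add (smooth_boxStream _ _)

theorem smooth_movingStream (τ : ℝ) : Smooth (movingStream τ) :=
  (smooth_boxStream _ _).add (smooth_boxStream _ _)

theorem hasCompactSupport_fixedStream : HasCompactSupport fixedStream :=
  hasCompactSupport_cutoffCoord.add hasCompactSupport_boxBump

theorem hasCompactSupport_movingStream (τ : ℝ) : HasCompactSupport (movingStream τ) :=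
  hasCompactSupport_boxBump.add hasCompactSupport_boxBump

theorem movingStream_translate (τ : ℝ) :
    (fun x : Plane => movingStream 0 (x + τ • EuclideanSpace.single 0 1)) = movingStream τ := by
  ext x
  simp [movingStream, boxStream, boxBump, lower, upper, Fin.prod_univ_two, sub_sub_eq_add_sub,
    sub_add_eq_sub_sub, sub_right_comm]

theorem lap_movingStream_translate (τ : ℝ) (x : Plane) :
    lap (movingStream 0) (x + τ • EuclideanSpace.single 0 1) = lap (movingStream τ) x := by
  rw [← movingStream_translate τ, lap_translate]

theorem biotSavart_movingStream_translate (τ : ℝ) (x : Plane) :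
    biotSavart (lap (movingStream 0)) (x + τ • EuclideanSpace.single 0 1) =
      biotSavart (lap (movingStream τ)) x := by
  rw [← movingStream_translate τ, lap_translate, ← biotSavart_translate]

theorem norm_lt_one_of_coord {x : Plane} (h0 : |x 0| ≤ 5 / 8) (h1 : |x 1| ≤ 1 / 4) : ‖x‖ < 1 := by
  rw [← sq_lt_one_iff₀ (norm_nonneg x), EuclideanSpace.norm_sq_eq, Fin.sum_univ_two,
    Real.norm_eq_abs, Real.norm_eq_abs]
  nlinarith [abs_nonneg (x 0), abs_nonneg (x 1)]

section

variable {τ : ℝ}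

theorem lower_lt_upper (τ : ℝ) (k : Fin 3) (i : Fin 2) : lower τ k i < upper τ k i := by
  fin_cases k <;> fin_cases i <;> simp [lower, upper] <;> norm_num

theorem norm_lt_one_of_mem_closure_box (h0 : 0 ≤ τ) (h1 : τ ≤ 1 / 2) (k : Fin 3) {x : Plane}
    (hx : x ∈ closure (box (lower τ k) (upper τ k))) : ‖x‖ < 1 := by
  have hx := closure_box_subset hx
  have e0 := hx 0
  have e1 := hx 1
  refine norm_lt_one_of_coord (abs_le.2 ?_) (abs_le.2 ?_) <;> fin_cases k <;>
    simp [lower, upper] at e0 e1 <;> constructor <;> linarith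

theorem disjoint_annulus_box (h0 : 0 ≤ τ) (h1 : τ ≤ 1 / 2) (k : Fin 3) :
    Disjoint (closure annulus) (closure (box (lower τ k) (upper τ k))) := by
  refine disjoint_left.2 fun x hx hx' => ?_
  have := closure_annulus_subset hx
  exact absurd (norm_lt_one_of_mem_closure_box h0 h1 k hx') (not_lt.2 this)

theorem disjoint_box (h1 : τ ≤ 1 / 2) {j k : Fin 3} (h : j < k) :
    Disjoint (box (lower τ j) (upper τ j)) (box (lower τ k) (upper τ k)) := by
  refine disjoint_left.2 fun x hx hx' => ?_
  have e0 := hx 0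
  have e1 := hx 1
  have e2 := hx' 0
  have e3 := hx' 1
  fin_cases j <;> fin_cases k <;> simp [lower, upper] at h e0 e1 e2 e3 <;> linarith

theorem disjoint_closure_box (h1 : τ < 1 / 2) {j k : Fin 3} (h : j < k) :
    Disjoint (closure (box (lower τ j) (upper τ j))) (closure (box (lower τ k) (upper τ k))) := by
  refine disjoint_left.2 fun x hx hx' => ?_
  have e0 := closure_box_subset hx 0
  have e1 := closure_box_subset hx 1
  have e2 := closure_box_subset hx' 0
  have e3 := closure_box_subset hx' 1
  fin_cases j <;> fin_cases k <;> simp [lower, upper] at h e0 e1 e2 e3 <;> linarith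

theorem pairwise_fin_four {r : Fin 4 → Fin 4 → Prop} (hs : ∀ i j, r i j → r j i)
    (h0 : ∀ k : Fin 3, r 0 k.succ) (h1 : ∀ j k : Fin 3, j < k → r j.succ k.succ) (i j : Fin 4)
    (hij : i ≠ j) : r i j := by
  wlog hlt : i < j generalizing i j
  · exact hs _ _ (this j i hij.symm (lt_of_le_of_ne (not_lt.1 hlt) hij.symm))
  obtain ⟨k, rfl⟩ := Fin.exists_succ_eq.2 (Fin.ne_zero_of_lt hlt)
  rcases Fin.eq_zero_or_eq_succ i with rfl | ⟨l, rfl⟩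
  · exact h0 k
  · exact h1 l k (Fin.succ_lt_succ_iff.1 hlt)

theorem region_succ (τ : ℝ) (k : Fin 3) : region τ k.succ = box (lower τ k) (upper τ k) := by
  fin_cases k <;> rfl

theorem disjoint_region (h0 : 0 ≤ τ) (h1 : τ ≤ 1 / 2) (i j : Fin 4) (hij : i ≠ j) :
    Disjoint (region τ i) (region τ j) := by
  refine pairwise_fin_four (r := fun i j => Disjoint (region τ i) (region τ j))
    (fun _ _ h => h.symm) (fun k => ?_) (fun j k h => ?_) i j hij
  · simp only [region_succ]
    exact (disjoint_annulus_box h0 h1 k).mono subset_closure subset_closure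
  · simp only [region_succ]
    exact disjoint_box h1 h

theorem isOpen_region (τ : ℝ) (i : Fin 4) : IsOpen (region τ i) := by
  rcases Fin.eq_zero_or_eq_succ i with rfl | ⟨l, rfl⟩
  · exact isOpen_annulus
  · rw [region_succ]
    exact isOpen_box

theorem isPreconnected_region (τ : ℝ) (i : Fin 4) : IsPreconnected (region τ i) := by
  rcases Fin.eq_zero_or_eq_succ i with rfl | ⟨l, rfl⟩
  · exact isPreconnected_annulus
  · rw [region_succ]
    exact isPreconnected_box

theorem nonempty_region (τ : ℝ) (i : Fin 4) : (region τ i).Nonempty := by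
  rcases Fin.eq_zero_or_eq_succ i with rfl | ⟨l, rfl⟩
  · exact nonempty_annulus
  · rw [region_succ]
    exact nonempty_box (lower_lt_upper τ l)

theorem density_succ (τ : ℝ) (k : Fin 3) : density τ k.succ = lap (boxStream τ k) := by
  fin_cases k <;> rfl

theorem smooth_density (τ : ℝ) (i : Fin 4) : Smooth (density τ i) := by
  rcases Fin.eq_zero_or_eq_succ i with rfl | ⟨l, rfl⟩
  · exact smooth_cutoffCoord.lap
  · rw [density_succ]
    exact (smooth_boxStream τ l).lap

theorem tsupport_density (τ : ℝ) (i : Fin 4) : tsupport (density τ i) = closure (region τ i) := by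
  rcases Fin.eq_zero_or_eq_succ i with rfl | ⟨l, rfl⟩
  · exact tsupport_lap_cutoffCoord
  · rw [density_succ, region_succ]
    exact tsupport_lap_boxBump (lower_lt_upper τ l)

theorem lap_add_lap_eq_sum (τ : ℝ) (x : Plane) :
    lap fixedStream x + lap (movingStream τ) x = ∑ i, density τ i x := by
  have h1 : lap fixedStream = _ := lap_add smooth_cutoffCoord (smooth_boxStream 0 0)
  have h2 : lap (movingStream τ) = _ := lap_add (smooth_boxStream τ 1) (smooth_boxStream τ 2)
  rw [h1, h2, ← boxStream_zero τ]
  simp [Fin.sum_univ_four, density]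
  ring

theorem tsupport_momentum (h0 : 0 ≤ τ) (h1 : τ ≤ 1 / 2) :
    tsupport (fun x => (lap fixedStream x + lap (movingStream τ) x) / 2) =
      ⋃ i, closure (region τ i) := by
  have hs : Function.support (fun x => (lap fixedStream x + lap (movingStream τ) x) / 2) =
      ⋃ i, Function.support (density τ i) := by
    rw [← support_sum_of_disjoint]
    · ext x
      simp [lap_add_lap_eq_sum]
    · intro i j hij
      refine (disjoint_region h0 h1 i j hij).of_subset_closure (isOpen_region τ j)
        (smooth_density τ i).continuous.isOpen_support ?_ ?_
      · rw [← tsupport_density]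
        exact subset_tsupport _
      · rw [← tsupport_density]
        exact subset_tsupport _
  rw [tsupport, hs, closure_iUnion_of_finite]
  exact iUnion_congr fun i => tsupport_density τ i

theorem card_components_of_lt (h0 : 0 ≤ τ) (h1 : τ < 1 / 2) :
    Nat.card (ConnectedComponents (interior
      (tsupport (fun x => (lap fixedStream x + lap (movingStream τ) x) / 2)))) = 4 := by
  rw [card_connectedComponents_interior (isOpen_region τ) (nonempty_region τ)
    (isPreconnected_region τ) ?_ (tsupport_momentum h0 h1.le), Fintype.card_fin]
  refine pairwise_fin_four (r := fun i j => Disjoint (closure (region τ i)) (closure (region τ j)))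
    (fun _ _ h => h.symm) (fun k => ?_) (fun j k h => ?_)
  · simp only [region_succ]
    exact disjoint_annulus_box h0 h1.le k
  · simp only [region_succ]
    exact disjoint_closure_box h1 h

end

/-- The fixed box joined with the two travelling boxes at the time of contact. -/
def mergedRegion : Set Plane :=
  (box ![-1/2, -1/4] ![0, 1/4] ∪ box ![-1/4, 1/16] ![1/8, 3/16]) ∪
    box ![-1/4, -3/16] ![1/8, -1/16]

theorem closure_mergedRegion :
    closure mergedRegion = ⋃ k : Fin 3, closure (box (lower (1 / 2) k) (upper (1 / 2) k)) := by
  have h : ∀ a b : Fin 2 → ℝ, (∀ i, a i < b i) →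
      closure (box a b) = {x | x 0 ∈ Icc (a 0) (b 0) ∧ x 1 ∈ Icc (a 1) (b 1)} := fun a b hab => by
    rw [closure_box hab]
    simp only [Fin.forall_fin_two]
  rw [mergedRegion, closure_union, closure_union,
    iUnion_congr fun k => h _ _ (lower_lt_upper (1 / 2) k), h, h, h]
  · ext x
    simp only [mem_union, mem_iUnion, mem_ofPred_eq, Fin.exists_fin_succ, lower, upper, mem_Icc]
    norm_num
    constructor
    · rintro ((⟨⟨h1, h2⟩, h3, h4⟩ | ⟨⟨h1, h2⟩, h3, h4⟩) | ⟨⟨h1, h2⟩, h3, h4⟩)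
      · exact Or.inl ⟨⟨h1, h2⟩, h3, h4⟩
      · rcases le_total (x 0) 0 with h0 | h0
        · exact Or.inl ⟨⟨by linarith, h0⟩, by linarith, by linarith⟩
        · exact Or.inr (Or.inl ⟨⟨h0, h2⟩, h3, h4⟩)
      · rcases le_total (x 0) 0 with h0 | h0
        · exact Or.inl ⟨⟨by linarith, h0⟩, by linarith, by linarith⟩
        · exact Or.inr (Or.inr ⟨⟨h0, h2⟩, h3, h4⟩)
    · rintro (⟨⟨h1, h2⟩, h3, h4⟩ | ⟨⟨h1, h2⟩, h3, h4⟩ | ⟨⟨h1, h2⟩, h3, h4⟩)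
      · exact Or.inl (Or.inl ⟨⟨h1, h2⟩, h3, h4⟩)
      · exact Or.inl (Or.inr ⟨⟨by linarith, h2⟩, h3, h4⟩)
      · exact Or.inr ⟨⟨le_trans (by norm_num) (show 0 ≤ x 0 from h1), h2⟩, h3, h4⟩
  all_goals
    intro i
    fin_cases i <;> norm_num

theorem isOpen_mergedRegion : IsOpen mergedRegion := (isOpen_box.union isOpen_box).union isOpen_box

theorem isPreconnected_mergedRegion : IsPreconnected mergedRegion := by
  refine IsPreconnected.union' ⟨!₂[-1/8, -1/8], Or.inl ?_, ?_⟩ (IsPreconnected.union'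
    ⟨!₂[-1/8, 1/8], ?_, ?_⟩ isPreconnected_box isPreconnected_box) isPreconnected_box
  all_goals
    intro i
    fin_cases i <;> norm_num

theorem card_components_half :
    Nat.card (ConnectedComponents (interior
      (tsupport (fun x => (lap fixedStream x + lap (movingStream (1 / 2)) x) / 2)))) = 2 := by
  have h0 : (0 : ℝ) ≤ 1 / 2 := by norm_num
  have hd : Disjoint (closure annulus) (closure mergedRegion) := by
    rw [closure_mergedRegion]
    exact disjoint_iUnion_right.2 fun k => disjoint_annulus_box h0 le_rfl k
  rw [card_connectedComponents_interior (A := ![annulus, mergedRegion]) ?_ ?_ ?_ ?_ ?_,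
    Fintype.card_fin]
  · exact Fin.forall_fin_two.2 ⟨isOpen_annulus, isOpen_mergedRegion⟩
  · exact Fin.forall_fin_two.2 ⟨nonempty_annulus, (nonempty_box (lower_lt_upper 0 0)).mono
      (by simp only [mergedRegion, lower, upper]; exact fun x hx => Or.inl (Or.inl hx))⟩
  · exact Fin.forall_fin_two.2 ⟨isPreconnected_annulus, isPreconnected_mergedRegion⟩
  · simpa [Fin.forall_fin_two] using ⟨hd, hd.symm⟩
  · rw [tsupport_momentum h0 le_rfl]
    ext x
    simp only [mem_iUnion, Fin.exists_fin_succ (n := 3), Fin.exists_fin_two, region_succ,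
      Matrix.cons_val_zero, Matrix.cons_val_one, closure_mergedRegion]
    rfl

end

section

open Metric Filter
open scoped Topology

theorem tsupport_movingStream_subset (τ : ℝ) : tsupport (movingStream τ) ⊆
    closure (box (lower τ 1) (upper τ 1) ∪ box (lower τ 2) (upper τ 2)) := by
  rw [closure_union]
  exact (tsupport_add _ _).trans (union_subset_union tsupport_boxBump.subset tsupport_boxBump.subset)

theorem norm_lt_one_of_mem_tsupport {τ : ℝ} (h0 : 0 ≤ τ) (h1 : τ ≤ 1 / 2) {x : Plane}
    (hx : x ∈ tsupport (movingStream τ)) : ‖x‖ < 1 := by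
  have hx := tsupport_movingStream_subset τ hx
  rw [closure_union] at hx
  exact hx.elim (norm_lt_one_of_mem_closure_box h0 h1 1) (norm_lt_one_of_mem_closure_box h0 h1 2)

/-- A function supported in the fixed box vanishes wherever a continuous function supported in the
travelling boxes does not. -/
theorem eq_zero_of_mem_tsupport {τ : ℝ} (h1 : τ ≤ 1 / 2) {f g : Plane → ℝ}
    (hg : Continuous g) (hgs : tsupport g ⊆ tsupport (movingStream τ))
    (hfs : tsupport f ⊆ tsupport (boxStream 0 0)) {x : Plane} (hx : g x ≠ 0) :
    f x = 0 := by
  by_contra hfx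
  have hd : Disjoint (box (lower τ 1) (upper τ 1) ∪ box (lower τ 2) (upper τ 2))
      (box (lower τ 0) (upper τ 0)) :=
    disjoint_union_left.2 ⟨(disjoint_box h1 (by decide)).symm, (disjoint_box h1 (by decide)).symm⟩
  refine disjoint_left.1 (hd.of_subset_closure isOpen_box hg.isOpen_support
    ((subset_tsupport g).trans (hgs.trans (tsupport_movingStream_subset τ)))
    (V := Function.support f) ?_) hx hfx
  rw [← tsupport_boxBump]
  exact (subset_tsupport f).trans (hfs.trans (congrArg tsupport (boxStream_zero τ)).superset)

theorem lap_fixedStream_eq_zero {τ : ℝ} (h0 : 0 ≤ τ) (h1 : τ ≤ 1 / 2) {x : Plane}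
    (hx : biotSavart (lap (movingStream τ)) x ≠ 0) : lap fixedStream x = 0 := by
  obtain ⟨e0, e1⟩ := biotSavart_lap (smooth_movingStream τ) (hasCompactSupport_movingStream τ) x
  obtain ⟨i, hi⟩ : ∃ i, pd i (movingStream τ) x ≠ 0 := by
    by_contra! h
    refine hx ?_
    ext i
    fin_cases i
    · simp [e0, h]
    · simp [e1, h]
  have hsub := tsupport_pd_subset (movingStream τ) i
  have hb := eq_zero_of_mem_tsupport h1 ((smooth_movingStream τ).pd i).continuous hsub
    (tsupport_lap_subset _) hi
  have hl : lap fixedStream = _ := lap_add smooth_cutoffCoord (smooth_boxStream 0 0)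
  rw [hl]
  simp only [hb, add_zero]
  exact lap_cutoffCoord (norm_lt_one_of_mem_tsupport h0 h1 (hsub (subset_tsupport _ hi)))

theorem biotSavart_lap_fixedStream {τ : ℝ} (h0 : 0 ≤ τ) (h1 : τ ≤ 1 / 2) {x : Plane}
    (hx : lap (movingStream τ) x ≠ 0) :
    biotSavart (lap fixedStream) x = -EuclideanSpace.single 0 1 := by
  have hsub := tsupport_lap_subset (movingStream τ)
  have hn := norm_lt_one_of_mem_tsupport h0 h1 (hsub (subset_tsupport _ hx))
  have hpd : ∀ i, pd i fixedStream x = if i = 1 then 1 else 0 := fun i => by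
    have hb := eq_zero_of_mem_tsupport h1 (smooth_movingStream τ).lap.continuous hsub
      (tsupport_pd_subset (boxStream 0 0) i) hx
    have hl : pd i fixedStream = _ := pd_add smooth_cutoffCoord (smooth_boxStream 0 0) i
    rw [hl]
    simp only [hb, add_zero]
    exact pd_cutoffCoord hn i
  obtain ⟨e0, e1⟩ := biotSavart_lap smooth_fixedStream hasCompactSupport_fixedStream x
  ext i
  fin_cases i
  · simp [e0, hpd]
  · simp [e1, hpd]

/-- The initial data: a stationary scalar and a scalar travelling in the direction `-e₀`. -/
def initialData (b : Bool) : Plane → ℝ := cond b (lap fixedStream) (lap (movingStream 0))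

theorem smooth_initialData (b : Bool) : Smooth (initialData b) := by
  cases b
  · exact (smooth_movingStream 0).lap
  · exact smooth_fixedStream.lap

theorem hasCompactSupport_initialData (b : Bool) : HasCompactSupport (initialData b) := by
  cases b
  · exact (hasCompactSupport_movingStream 0).lap
  · exact hasCompactSupport_fixedStream.lap

theorem solution_initialData {τ : ℝ} (h0 : 0 ≤ τ) (h1 : τ ≤ 1 / 2) :
    solution initialData true τ = lap fixedStream ∧
      solution initialData false τ = lap (movingStream τ) := by
  have h := solution_eq_translate (p := lap fixedStream) (q := lap (movingStream 0))
    (e := EuclideanSpace.single 0 1) (D := 1 / 2) smooth_fixedStream.lap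
    (smooth_movingStream 0).lap hasCompactSupport_fixedStream.lap
    (hasCompactSupport_movingStream 0).lap
    (fun τ h0 h1 x hx => lap_fixedStream_eq_zero h0 h1
      (by rwa [biotSavart_movingStream_translate] at hx))
    (fun τ h0 h1 x hx => biotSavart_lap_fixedStream h0 h1
      (by rwa [lap_movingStream_translate] at hx)) h0 h1
  exact ⟨h.1, h.2.trans (funext (lap_movingStream_translate τ))⟩

/-- A smooth positive function of time equal to `t + 1/4` for `t > -1/8`. -/
def clock (t : ℝ) : ℝ :=
  1 / 16 + (t + 3 / 16) * Real.smoothTransition (16 * t + 3)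

theorem contDiff_clock : ContDiff ℝ (⊤ : ℕ∞) clock :=
  contDiff_const.add ((contDiff_id.add contDiff_const).mul
    (Real.smoothTransition.contDiff.comp ((contDiff_const.mul contDiff_id).add contDiff_const)))

theorem clock_pos (t : ℝ) : 0 < clock t := by
  rw [clock]
  rcases le_total (t + 3 / 16) 0 with h | h
  · rw [Real.smoothTransition.zero_of_nonpos (by linarith)]
    norm_num
  · have := mul_nonneg h (Real.smoothTransition.nonneg (16 * t + 3))
    linarith

theorem clock_eq {t : ℝ} (ht : -1 / 8 < t) : clock t = t + 1 / 4 := by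
  rw [clock, Real.smoothTransition.one_of_one_le (by linarith)]
  ring

/-- The solution issuing from `initialData`, reparametrised so that it is smooth for all times. -/
def shiftedSolution (b : Bool) (t : ℝ) : Plane → ℝ := solution initialData b (clock t)

theorem contDiff_shiftedSolution (b : Bool) :
    ContDiff ℝ (⊤ : ℕ∞) fun p : ℝ × Plane => shiftedSolution b p.1 p.2 := by
  have h := contDiffOn_solution smooth_initialData hasCompactSupport_initialData b
  rw [← contDiffOn_univ]
  exact h.comp (f := fun p : ℝ × Plane => (clock p.1, p.2))
    ((contDiff_clock.comp contDiff_fst).prodMk contDiff_snd).contDiffOn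
    fun p _ => ⟨clock_pos p.1, mem_univ _⟩

theorem hasCompactSupport_shiftedSolution (b : Bool) (t : ℝ) :
    HasCompactSupport (shiftedSolution b t) := by
  obtain ⟨R, -, hR⟩ := exists_suppIn_solution smooth_initialData hasCompactSupport_initialData
    (clock t)
  exact (hR b _ (clock_pos t).le le_rfl).hasCompactSupport

theorem deriv_shiftedSolution {t : ℝ} (ht : 0 ≤ t) (b : Bool) (x : Plane) :
    deriv (fun t => shiftedSolution b t x) t = fderiv ℝ (shiftedSolution b t) x
      (orient b • biotSavart (shiftedSolution (!b) t) x) := by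
  have h := hasDerivAt_solution smooth_initialData hasCompactSupport_initialData (clock_pos t) b x
  have hc : HasDerivAt clock 1 t := by
    refine ((hasDerivAt_id t).add_const (1 / 4)).congr_of_eventuallyEq ?_
    filter_upwards [lt_mem_nhds (show -1 / 8 < t by linarith)] with s hs using clock_eq hs
  have := h.comp t hc
  rw [mul_one] at this
  exact this.deriv

end

/-- Topology change of the canonical momentum
`F = (σ₊ + σ₋)/2` for the unscreened right-handed system: there exist `T > 0` and
smooth, compactly supported solutions such that the interior of the support of
`F(0,·)` has exactly `4` connected components while the interior of the support
of `F(T,·)` has exactly `2` connected components. -/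
theorem unscreened_topology_change :
    ∃ (T : ℝ), 0 < T ∧
    ∃ σp σm : ℝ → EuclideanSpace ℝ (Fin 2) → ℝ,
      (ContDiff ℝ (⊤ : ℕ∞) fun p : ℝ × EuclideanSpace ℝ (Fin 2) => σp p.1 p.2) ∧
      (ContDiff ℝ (⊤ : ℕ∞) fun p : ℝ × EuclideanSpace ℝ (Fin 2) => σm p.1 p.2) ∧
      (∀ t, HasCompactSupport (σp t)) ∧ (∀ t, HasCompactSupport (σm t)) ∧
      (∀ t ≥ (0:ℝ), ∀ x,
        deriv (fun s => σp s x) t - fderiv ℝ (σp t) x (biotSavart (σm t) x) = 0 ∧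
        deriv (fun s => σm s x) t + fderiv ℝ (σm t) x (biotSavart (σp t) x) = 0) ∧
      ∀ F : ℝ → EuclideanSpace ℝ (Fin 2) → ℝ,
        (F = fun t x => (σp t x + σm t x) / 2) →
        Nat.card (ConnectedComponents (interior (tsupport (F 0)))) = 4 ∧
        Nat.card (ConnectedComponents (interior (tsupport (F T)))) = 2 := by
  refine ⟨1 / 4, by norm_num, shiftedSolution true, shiftedSolution false,
    contDiff_shiftedSolution _, contDiff_shiftedSolution _, hasCompactSupport_shiftedSolution _,
    hasCompactSupport_shiftedSolution _, fun t ht x => ⟨?_, ?_⟩, ?_⟩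
  · rw [deriv_shiftedSolution ht]
    simp [orient]
  · rw [deriv_shiftedSolution ht]
    simp [orient]
  · rintro F rfl
    have key : ∀ t τ : ℝ, -1 / 8 < t → t + 1 / 4 = τ → 0 ≤ τ → τ ≤ 1 / 2 →
        (fun x => (shiftedSolution true t x + shiftedSolution false t x) / 2) =
          fun x => (lap fixedStream x + lap (movingStream τ) x) / 2 := fun t τ ht hτ h0 h1 => by
      obtain ⟨hp, hm⟩ := solution_initialData h0 h1
      simp only [shiftedSolution, clock_eq ht, hτ, hp, hm]
    have e0 := key 0 (1 / 4) (by norm_num) (by norm_num) (by norm_num) (by norm_num)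
    have e1 := key (1 / 4) (1 / 2) (by norm_num) (by norm_num) (by norm_num) (by norm_num)
    beta_reduce
    rw [e0, e1]
    exact ⟨card_components_of_lt (by norm_num) (by norm_num), card_components_half⟩

end
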